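/- arXiv:1602.07944 — 8 statements merged into one kernel-verified Lean document; each statement's English description precedes it below -/
import Mathlib

section
/- For every positive integer u with u ≡ 2 (mod 6) and u ≥ 14, there exists a PBD(u,{3,4,5*}). -/
/-- A PBD(u,{3,4,5*}) on the point set `Fin u`: a collection of blocks each of
size 3, 4 or 5, such that every pair of distinct points lies in exactly one
block and exactly one block has size 5. -/
def IsPBD345star (u : ℕ) (ℬ : Finset (Finset (Fin u))) : Prop :=
  (∀ B ∈ ℬ, B.card = 3 ∨ B.card = 4 ∨ B.card = 5) ∧
  (∀ p q : Fin u, p ≠ q → ∃! B, B ∈ ℬ ∧ p ∈ B ∧ q ∈ B) ∧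
  (ℬ.filter (fun B => B.card = 5)).card = 1

/-- `ℬ` decomposes the edges of `G` into cliques of size 3 or 4. -/
structure IsCliqueDecomposition {V : Type*} (G : SimpleGraph V) (ℬ : Set (Finset V)) : Prop where
  card_eq : ∀ B ∈ ℬ, B.card = 3 ∨ B.card = 4
  isClique : ∀ B ∈ ℬ, G.IsClique (B : Set V)
  exists_mem : ∀ p q, G.Adj p q → ∃ B ∈ ℬ, p ∈ B ∧ q ∈ B
  unique : ∀ B ∈ ℬ, ∀ C ∈ ℬ, ∀ p q, p ≠ q → p ∈ B → q ∈ B → p ∈ C → q ∈ C → B = C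

/-- The complete graph on `V` with the edges inside the hole `H` removed. -/
def holeGraph {V : Type*} (H : Set V) : SimpleGraph V where
  Adj p q := p ≠ q ∧ ¬(p ∈ H ∧ q ∈ H)
  symm := ⟨fun _ _ h => ⟨h.1.symm, fun h' => h.2 h'.symm⟩⟩
  loopless := ⟨fun _ h => h.1 rfl⟩

/-- There is an incomplete pairwise balanced design with hole `H` and block sizes 3 and 4. -/
def HasHoledDesign {V : Type*} (H : Set V) : Prop :=
  ∃ ℬ, IsCliqueDecomposition (holeGraph H) ℬ

namespace IsCliqueDecomposition

variable {V W : Type*}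

theorem sup {G G' : SimpleGraph V} {ℬ ℬ' : Set (Finset V)} (h : IsCliqueDecomposition G ℬ)
    (h' : IsCliqueDecomposition G' ℬ') (hd : ∀ p q, G.Adj p q → ¬G'.Adj p q) :
    IsCliqueDecomposition (G ⊔ G') (ℬ ∪ ℬ') where
  card_eq := by
    rintro B (hB | hB)
    exacts [h.card_eq B hB, h'.card_eq B hB]
  isClique := by
    rintro B (hB | hB) p hp q hq hpq
    exacts [Or.inl (h.isClique B hB hp hq hpq), Or.inr (h'.isClique B hB hp hq hpq)]
  exists_mem := by
    rintro p q (hpq | hpq)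
    · obtain ⟨B, hB, hp⟩ := h.exists_mem p q hpq
      exact ⟨B, Or.inl hB, hp⟩
    · obtain ⟨B, hB, hp⟩ := h'.exists_mem p q hpq
      exact ⟨B, Or.inr hB, hp⟩
  unique := by
    rintro B (hB | hB) C (hC | hC) p q hpq hpB hqB hpC hqC
    · exact h.unique B hB C hC p q hpq hpB hqB hpC hqC
    · exact absurd (h'.isClique C hC hpC hqC hpq) (hd _ _ (h.isClique B hB hpB hqB hpq))
    · exact absurd (h'.isClique B hB hpB hqB hpq) (hd _ _ (h.isClique C hC hpC hqC hpq))
    · exact h'.unique B hB C hC p q hpq hpB hqB hpC hqC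

theorem map {G : SimpleGraph V} {ℬ : Set (Finset V)} (h : IsCliqueDecomposition G ℬ)
    (f : V ↪ W) : IsCliqueDecomposition (G.map f) (Finset.map f '' ℬ) where
  card_eq := by
    rintro _ ⟨B, hB, rfl⟩
    simpa using h.card_eq B hB
  isClique := by
    rintro _ ⟨B, hB, rfl⟩ _ hp' _ hq' hpq
    obtain ⟨p, hp, rfl⟩ := Finset.mem_map.1 hp'
    obtain ⟨q, hq, rfl⟩ := Finset.mem_map.1 hq'
    exact (SimpleGraph.map_adj_apply).2 (h.isClique B hB hp hq (fun e => hpq (e ▸ rfl)))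
  exists_mem := by
    rintro _ _ ⟨hpq, p, q, hadj, rfl, rfl⟩
    obtain ⟨B, hB, hp, hq⟩ := h.exists_mem p q hadj
    exact ⟨_, ⟨B, hB, rfl⟩, Finset.mem_map_of_mem f hp, Finset.mem_map_of_mem f hq⟩
  unique := by
    rintro _ ⟨B, hB, rfl⟩ _ ⟨C, hC, rfl⟩ p q hpq hpB hqB hpC hqC
    obtain ⟨p, hp, rfl⟩ := Finset.mem_map.1 hpB
    obtain ⟨q, hq, rfl⟩ := Finset.mem_map.1 hqB
    rw [h.unique B hB C hC p q (fun e => hpq (e ▸ rfl)) hp hq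
      ((Finset.mem_map' f).1 hpC) ((Finset.mem_map' f).1 hqC)]

end IsCliqueDecomposition

theorem HasHoledDesign.map_equiv {V W : Type*} {H : Set V} (h : HasHoledDesign H) (e : V ≃ W) :
    HasHoledDesign (e '' H) := by
  obtain ⟨ℬ, hℬ⟩ := h
  have hG : holeGraph (e '' H) = (holeGraph H).map e.toEmbedding := by
    ext p q
    obtain ⟨p, rfl⟩ := e.surjective p
    obtain ⟨q, rfl⟩ := e.surjective q
    have : ((holeGraph H).map e.toEmbedding).Adj (e p) (e q) ↔ (holeGraph H).Adj p q :=
      SimpleGraph.map_adj_apply (f := e.toEmbedding)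
    rw [this]
    simp [holeGraph]
  exact ⟨_, hG ▸ hℬ.map e.toEmbedding⟩

/-- Only the sizes of the hole and of its complement matter. -/
theorem HasHoledDesign.range_inl {V W T : Type*} [Fintype V] [Fintype W] [Fintype T] {H : Set V}
    (h : HasHoledDesign H) (hW : H.ncard = Fintype.card W)
    (hV : Fintype.card V = Fintype.card W + Fintype.card T) :
    HasHoledDesign (Set.range (Sum.inl : W → W ⊕ T)) := by
  classical
  have hc := Fintype.card_congr (Equiv.Set.sumCompl H)
  rw [Fintype.card_sum] at hc
  have hH : Fintype.card H = Fintype.card W := by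
    rw [← hW, ← Nat.card_coe_set_eq, Nat.card_eq_fintype_card]
  let e₁ : H ≃ W := Fintype.equivOfCardEq hH
  let e₂ : (Hᶜ : Set V) ≃ T := Fintype.equivOfCardEq (by omega)
  let e : V ≃ W ⊕ T := (Equiv.Set.sumCompl H).symm.trans (Equiv.sumCongr e₁ e₂)
  have he : e '' H = Set.range Sum.inl := by
    ext x
    constructor
    · rintro ⟨p, hp, rfl⟩
      exact ⟨e₁ ⟨p, hp⟩, by simp [e, Equiv.Set.sumCompl_symm_apply_of_mem hp]⟩
    · rintro ⟨w, rfl⟩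
      exact ⟨e₁.symm w, (e₁.symm w).2, by simp [e]⟩
  exact he ▸ h.map_equiv e

section Tripling

variable {N W T : Type*}

/-- The points of a transversal design with groups `{i} × N` and `T`, together with extra
points `W`. -/
abbrev TriplePoint (N W T : Type*) := (W ⊕ T) ⊕ (Fin 3 × N)

/-- The inclusion of the `i`-th group together with `W`. -/
def groupEmbedding (N W T : Type*) (i : Fin 3) : W ⊕ N ↪ TriplePoint N W T where
  toFun := Sum.elim (fun w => Sum.inl (Sum.inl w)) fun x => Sum.inr (i, x)
  inj' := by rintro (a | a) (b | b) <;> simp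

@[simp] theorem groupEmbedding_inl {i : Fin 3} {w : W} :
    groupEmbedding N W T i (Sum.inl w) = Sum.inl (Sum.inl w) := rfl

@[simp] theorem groupEmbedding_inr {i : Fin 3} {x : N} :
    groupEmbedding N W T i (Sum.inr x) = Sum.inr (i, x) := rfl

/-- The graph covered by the blocks filling the `i`-th group. -/
def groupGraph (N W T : Type*) (i : Fin 3) : SimpleGraph (TriplePoint N W T) :=
  (holeGraph (Set.range (Sum.inl : W → W ⊕ N))).map (groupEmbedding N W T i)

@[simp] theorem groupGraph_adj_group_group {i j k : Fin 3} {a b : N} :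
    (groupGraph N W T i).Adj (Sum.inr (j, a)) (Sum.inr (k, b)) ↔ j = i ∧ k = i ∧ a ≠ b := by
  simp [groupGraph, SimpleGraph.map_adj, holeGraph]
  grind

@[simp] theorem groupGraph_adj_extra_group {i k : Fin 3} {w : W} {b : N} :
    (groupGraph N W T i).Adj (Sum.inl (Sum.inl w)) (Sum.inr (k, b)) ↔ k = i := by
  simp [groupGraph, SimpleGraph.map_adj, holeGraph]
  grind

@[simp] theorem not_groupGraph_adj_inl_inl {i : Fin 3} {p q : W ⊕ T} :
    ¬(groupGraph N W T i).Adj (Sum.inl p) (Sum.inl q) := by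
  simp [groupGraph, SimpleGraph.map_adj, holeGraph]

@[simp] theorem not_groupGraph_adj_tail {i : Fin 3} {t : T} {q : TriplePoint N W T} :
    ¬(groupGraph N W T i).Adj (Sum.inl (Sum.inr t)) q := by
  simp [groupGraph, SimpleGraph.map_adj, holeGraph]

@[simp] theorem groupGraph_adj_group_extra {i k : Fin 3} {w : W} {b : N} :
    (groupGraph N W T i).Adj (Sum.inr (k, b)) (Sum.inl (Sum.inl w)) ↔ k = i := by
  rw [SimpleGraph.adj_comm, groupGraph_adj_extra_group]

@[simp] theorem not_groupGraph_adj_tail_right {i : Fin 3} {t : T} {q : TriplePoint N W T} :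
    ¬(groupGraph N W T i).Adj q (Sum.inl (Sum.inr t)) := by
  rw [SimpleGraph.adj_comm]
  exact not_groupGraph_adj_tail

variable [AddCommGroup N] [DecidableEq N]

/-- The value `f` such that `(i, f)` lies on the line with parameters `x`, `y`. -/
def lineCoord (x y : N) : Fin 3 → N := ![x, y, x + y]

/-- The block of the transversal design on the line with parameters `x`, `y`. -/
def lineBlock [Fintype T] (f : T → N) (x y : N) : Finset (TriplePoint N W T) :=
  Finset.disjSum (Finset.disjSum ∅ (Finset.univ.filter fun t => f t = x - y))
    (Finset.univ.image fun i => (i, lineCoord x y i))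

/-- The collinearity graph of the transversal design. -/
def lineGraph [Fintype T] (f : T → N) : SimpleGraph (TriplePoint N W T) where
  Adj p q := p ≠ q ∧ ∃ x y, p ∈ lineBlock f x y ∧ q ∈ lineBlock f x y
  symm := ⟨fun _ _ ⟨h, x, y, hp, hq⟩ => ⟨h.symm, x, y, hq, hp⟩⟩
  loopless := ⟨fun _ h => h.1 rfl⟩

variable [Fintype T] {f : T → N}

@[simp] theorem extra_mem_lineBlock {x y : N} {w : W} :
    (Sum.inl (Sum.inl w) : TriplePoint N W T) ∈ lineBlock f x y ↔ False := by
  simp [lineBlock]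

@[simp] theorem tail_mem_lineBlock {x y : N} {t : T} :
    (Sum.inl (Sum.inr t) : TriplePoint N W T) ∈ lineBlock f x y ↔ f t = x - y := by
  simp [lineBlock]

@[simp] theorem group_mem_lineBlock {x y : N} {i : Fin 3} {a : N} :
    (Sum.inr (i, a) : TriplePoint N W T) ∈ lineBlock f x y ↔ lineCoord x y i = a := by
  simp [lineBlock]

theorem card_lineBlock (hf : f.Injective) (x y : N) :
    (lineBlock f x y : Finset (TriplePoint N W T)).card = 3 ∨
      (lineBlock f x y : Finset (TriplePoint N W T)).card = 4 := by
  have h₁ : (Finset.univ.filter fun t => f t = x - y).card ≤ 1 :=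
    Finset.card_le_one.2 fun a ha b hb => hf (by simp_all)
  have h₂ : (Finset.univ.image fun i : Fin 3 => (i, lineCoord x y i)).card = 3 :=
    Finset.card_image_of_injective _ fun i j h => congrArg Prod.fst h
  rw [lineBlock, Finset.card_disjSum, Finset.card_disjSum, h₂, Finset.card_empty]
  omega

theorem eq_of_mem_lineBlock (h2 : ∀ a b : N, a + a = b + b → a = b) (hf : f.Injective)
    {p q : TriplePoint N W T} (hpq : p ≠ q) {x y x' y' : N}
    (hp : p ∈ lineBlock f x y) (hq : q ∈ lineBlock f x y)
    (hp' : p ∈ lineBlock f x' y') (hq' : q ∈ lineBlock f x' y') : x = x' ∧ y = y' := by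
  have key : ∀ (t : T) (i : Fin 3), f t = x - y → f t = x' - y' →
      lineCoord x y i = lineCoord x' y' i → x = x' ∧ y = y' := by
    intro t i h h' hc
    have hs : x - y = x' - y' := h.symm.trans h'
    fin_cases i <;> simp [lineCoord] at hc
    · subst hc; simpa using hs
    · subst hc; simpa using hs
    · have hx : x = x' := h2 _ _ (by
        calc x + x = (x - y) + (x + y) := by abel
          _ = (x' - y') + (x' + y') := by rw [hs, hc]
          _ = x' + x' := by abel)
      subst hx; simpa using hs
  rcases p with (w | t) | ⟨i, a⟩ <;> rcases q with (w' | t') | ⟨j, b⟩ <;>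
    simp only [extra_mem_lineBlock, tail_mem_lineBlock, group_mem_lineBlock] at hp hq hp' hq'
  · exact absurd (by rw [hf (hp.trans hq.symm)]) hpq
  · exact key t j hp hp' (hq.trans hq'.symm)
  · exact key t' i hq hq' (hp.trans hp'.symm)
  · have hij : i ≠ j := by
      rintro rfl
      exact hpq (by rw [← hp, ← hq])
    rw [← hp'] at hp
    rw [← hq'] at hq
    fin_cases i <;> fin_cases j <;>
      first
      | exact absurd rfl hij
      | simp [lineCoord] at hp hq; grind

theorem isCliqueDecomposition_lineGraph (h2 : ∀ a b : N, a + a = b + b → a = b)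
    (hf : f.Injective) :
    IsCliqueDecomposition (lineGraph f : SimpleGraph (TriplePoint N W T))
      {B | ∃ x y, B = lineBlock f x y} where
  card_eq := by
    rintro _ ⟨x, y, rfl⟩
    exact card_lineBlock hf x y
  isClique := by
    rintro _ ⟨x, y, rfl⟩ p hp q hq hpq
    exact ⟨hpq, x, y, hp, hq⟩
  exists_mem := by
    rintro p q ⟨-, x, y, hp, hq⟩
    exact ⟨_, ⟨x, y, rfl⟩, hp, hq⟩
  unique := by
    rintro _ ⟨x, y, rfl⟩ _ ⟨x', y', rfl⟩ p q hpq hp hq hp' hq'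
    obtain ⟨rfl, rfl⟩ := eq_of_mem_lineBlock h2 hf hpq hp hq hp' hq'
    rfl

theorem lineGraph_adj_tail_group {t : T} {i : Fin 3} {a : N}
    (h2 : Function.Surjective fun a : N => a + a) :
    (lineGraph f : SimpleGraph (TriplePoint N W T)).Adj (Sum.inl (Sum.inr t)) (Sum.inr (i, a)) := by
  refine ⟨by simp, ?_⟩
  simp only [tail_mem_lineBlock, group_mem_lineBlock]
  fin_cases i
  · exact ⟨a, a - f t, by simp, by simp [lineCoord]⟩
  · exact ⟨a + f t, a, by simp, by simp [lineCoord]⟩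
  · obtain ⟨x, hx⟩ := h2 (f t + a)
    refine ⟨x, x - f t, by simp, ?_⟩
    simp only at hx
    simp only [lineCoord, Fin.reduceFinMk, Matrix.cons_val]
    rw [← add_sub_assoc, hx]
    abel

@[simp] theorem lineGraph_adj_group_group {i j : Fin 3} {a b : N} :
    (lineGraph f : SimpleGraph (TriplePoint N W T)).Adj (Sum.inr (i, a)) (Sum.inr (j, b)) ↔
      i ≠ j := by
  constructor
  · rintro ⟨h, x, y, hp, hq⟩ rfl
    rw [group_mem_lineBlock] at hp hq
    exact h (by rw [← hp, ← hq])
  · intro hij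
    refine ⟨by simp [hij], ?_⟩
    simp only [group_mem_lineBlock]
    fin_cases i <;> fin_cases j <;> simp [lineCoord] at hij ⊢
    · exact ⟨b - a, by abel⟩
    · exact ⟨b - a, by abel⟩
    · exact ⟨a - b, by abel⟩
    · exact ⟨a - b, by abel⟩

@[simp] theorem not_lineGraph_adj_extra {w : W} {q : TriplePoint N W T} :
    ¬(lineGraph f : SimpleGraph (TriplePoint N W T)).Adj (Sum.inl (Sum.inl w)) q := by
  rintro ⟨-, x, y, hp, -⟩
  simp at hp

theorem not_lineGraph_adj_tail_tail (hf : f.Injective) {s t : T} :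
    ¬(lineGraph f : SimpleGraph (TriplePoint N W T)).Adj
      (Sum.inl (Sum.inr s)) (Sum.inl (Sum.inr t)) := by
  rintro ⟨h, x, y, hp, hq⟩
  rw [tail_mem_lineBlock] at hp hq
  exact h (by rw [hf (hp.trans hq.symm)])

@[simp] theorem not_lineGraph_adj_extra_right {w : W} {q : TriplePoint N W T} :
    ¬(lineGraph f : SimpleGraph (TriplePoint N W T)).Adj q (Sum.inl (Sum.inl w)) := by
  rw [SimpleGraph.adj_comm]
  exact not_lineGraph_adj_extra

/-- Fill the groups of a transversal design on `3|N| + |T|` points, adjoining `W` to each. -/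
theorem HasHoledDesign.triple (h2 : Function.Bijective fun a : N => a + a)
    (hf : f.Injective) (hA : HasHoledDesign (Set.range (Sum.inl : W → W ⊕ N)))
    {H : Set (W ⊕ T)} (hH : ∀ w, Sum.inl w ∈ H) (hD : HasHoledDesign H) :
    HasHoledDesign (Sum.inl '' H : Set (TriplePoint N W T)) := by
  obtain ⟨𝒜, hA⟩ := hA
  obtain ⟨𝒟, hD⟩ := hD
  have htt : ∀ s t, ¬(lineGraph f : SimpleGraph (TriplePoint N W T)).Adj
      (Sum.inl (Sum.inr s)) (Sum.inl (Sum.inr t)) := fun _ _ => not_lineGraph_adj_tail_tail hf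
  have htg : ∀ t i a, (lineGraph f : SimpleGraph (TriplePoint N W T)).Adj
      (Sum.inl (Sum.inr t)) (Sum.inr (i, a)) := fun _ _ _ => lineGraph_adj_tail_group h2.surjective
  have hgt : ∀ t i a, (lineGraph f : SimpleGraph (TriplePoint N W T)).Adj
      (Sum.inr (i, a)) (Sum.inl (Sum.inr t)) := fun t i a => (htg t i a).symm
  let D : SimpleGraph (TriplePoint N W T) := (holeGraph H).map Function.Embedding.inl
  have hll : ∀ p q, D.Adj (Sum.inl p) (Sum.inl q) ↔ (holeGraph H).Adj p q := fun _ _ =>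
    SimpleGraph.map_adj_apply (f := Function.Embedding.inl)
  have hrl : ∀ p x, ¬D.Adj (Sum.inr x) p := by simp [D, SimpleGraph.map_adj]
  have hlr : ∀ p x, ¬D.Adj p (Sum.inr x) := by simp [D, SimpleGraph.map_adj]
  have hD : IsCliqueDecomposition D _ := hD.map Function.Embedding.inl
  have hG (i : Fin 3) : IsCliqueDecomposition (groupGraph N W T i) _ :=
    hA.map (groupEmbedding N W T i)
  have hdec := ((((isCliqueDecomposition_lineGraph h2.injective hf).sup hD ?_).sup
    (hG 0) ?_).sup (hG 1) ?_).sup (hG 2) ?_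
  · have : lineGraph f ⊔ D ⊔ groupGraph N W T 0 ⊔ groupGraph N W T 1 ⊔ groupGraph N W T 2 =
        holeGraph (Sum.inl '' H) := by
      ext ((w | t) | ⟨i, a⟩) ((w' | t') | ⟨j, b⟩) <;>
        simp [htt, htg, hgt, hll, hrl, hlr, holeGraph, hH]
      all_goals grind
    exact ⟨_, this ▸ hdec⟩
  all_goals
    rintro ((w | t) | ⟨i, a⟩) ((w' | t') | ⟨j, b⟩) <;>
      simp [htt, htg, hgt, hll, hrl, hlr, holeGraph, hH]
    all_goals grind

end Tripling

theorem hasHoledDesign_of_list {v w : ℕ} (L : List (List (Fin v)))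
    (hL : ∀ B ∈ L, B.Nodup ∧ (B.length = 3 ∨ B.length = 4))
    (hp : ∀ p q : Fin v, p ≠ q → (L.filter fun B => B.contains p && B.contains q).length =
      if p.val < w ∧ q.val < w then 0 else 1) :
    HasHoledDesign {i : Fin v | i.val < w} := by
  refine ⟨{B | ∃ b ∈ L, B = b.toFinset}, ?_, ?_, ?_, ?_⟩
  · rintro _ ⟨b, hb, rfl⟩
    rw [List.toFinset_card_of_nodup (hL b hb).1]
    exact (hL b hb).2
  · rintro _ ⟨b, hb, rfl⟩ p hpb q hqb hpq
    refine ⟨hpq, fun hw => ?_⟩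
    have h := hp p q hpq
    rw [if_pos (by simpa using hw), List.length_eq_zero_iff, List.filter_eq_nil_iff] at h
    exact h b hb (by simp_all)
  · rintro p q ⟨hpq, hw⟩
    have h := hp p q hpq
    rw [if_neg (by simpa using hw), List.length_eq_one_iff] at h
    obtain ⟨b, h⟩ := h
    have hb : b ∈ L.filter fun B => B.contains p && B.contains q := by rw [h]; simp
    simp only [List.mem_filter, Bool.and_eq_true, List.contains_iff_mem] at hb
    exact ⟨_, ⟨b, hb.1, rfl⟩, by simpa using hb.2⟩
  · rintro _ ⟨b, hb, rfl⟩ _ ⟨c, hc, rfl⟩ p q hpq hpb hqb hpc hqc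
    have h : (L.filter fun B => B.contains p && B.contains q).length ≤ 1 := by
      rw [hp p q hpq]
      split_ifs <;> omega
    have hb' : b ∈ L.filter fun B => B.contains p && B.contains q := by
      simp [hb, List.mem_toFinset.1 hpb, List.mem_toFinset.1 hqb]
    have hc' : c ∈ L.filter fun B => B.contains p && B.contains q := by
      simp [hc, List.mem_toFinset.1 hpc, List.mem_toFinset.1 hqc]
    obtain h | ⟨d, h⟩ := Nat.le_one_iff_eq_zero_or_eq_one.1 h |>.imp
      List.length_eq_zero_iff.1 List.length_eq_one_iff.1
    · rw [h] at hb'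
      simp at hb'
    · rw [h, List.mem_singleton] at hb' hc'
      rw [hb', hc']

theorem hasHoledDesign_7_0 : HasHoledDesign {i : Fin 7 | i.val < 0} :=
  hasHoledDesign_of_list
    [[0, 1, 3], [0, 2, 6], [0, 4, 5], [1, 2, 4], [1, 5, 6], [2, 3, 5], [3, 4, 6]]
    (by decide +kernel) (by decide +kernel)

theorem hasHoledDesign_11_5 : HasHoledDesign {i : Fin 11 | i.val < 5} :=
  hasHoledDesign_of_list
    [[0, 5, 7], [0, 6, 8], [0, 9, 10], [1, 5, 6], [1, 7, 10], [1, 8, 9], [2, 5, 9], [2, 6, 7], [2,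
    8, 10], [3, 5, 8], [3, 6, 10], [3, 7, 9], [4, 5, 10], [4, 6, 9], [4, 7, 8]]
    (by decide +kernel) (by decide +kernel)

theorem hasHoledDesign_13_0 : HasHoledDesign {i : Fin 13 | i.val < 0} :=
  hasHoledDesign_of_list
    [[0, 1, 5, 11], [0, 2, 3, 7], [0, 4, 10, 12], [0, 6, 8, 9], [1, 2, 6, 12], [1, 3, 4, 8], [1,
    7, 9, 10], [2, 4, 5, 9], [2, 8, 10, 11], [3, 5, 6, 10], [3, 9, 11, 12], [4, 6, 7, 11], [5, 7,
    8, 12]]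
    (by decide +kernel) (by decide +kernel)

theorem hasHoledDesign_14_5 : HasHoledDesign {i : Fin 14 | i.val < 5} :=
  hasHoledDesign_of_list
    [[0, 5, 11], [0, 6, 12], [0, 7, 13], [0, 8, 9, 10], [1, 5, 8], [1, 6, 9], [1, 7, 10], [1, 11,
    12, 13], [2, 5, 6, 7], [2, 8, 11], [2, 9, 12], [2, 10, 13], [3, 5, 10, 12], [3, 6, 8, 13], [3,
    7, 9, 11], [4, 5, 9, 13], [4, 6, 10, 11], [4, 7, 8, 12]]
    (by decide +kernel) (by decide +kernel)

theorem hasHoledDesign_17_5 : HasHoledDesign {i : Fin 17 | i.val < 5} :=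
  hasHoledDesign_of_list
    [[0, 5, 13], [0, 6, 11], [0, 7, 12], [0, 8, 16], [0, 9, 14], [0, 10, 15], [1, 5, 10], [1, 6,
    8], [1, 7, 9], [1, 11, 15], [1, 12, 16], [1, 13, 14], [2, 5, 12], [2, 6, 13], [2, 7, 11], [2,
    8, 14], [2, 9, 15], [2, 10, 16], [3, 5, 11], [3, 6, 12], [3, 7, 13], [3, 8, 15], [3, 9, 16],
    [3, 10, 14], [4, 5, 14], [4, 6, 15], [4, 7, 16], [4, 8, 13], [4, 9, 11], [4, 10, 12], [5, 6,
    16], [5, 7, 15], [5, 8, 9], [6, 7, 14], [6, 9, 10], [7, 8, 10], [8, 11, 12], [9, 12, 13], [10,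
    11, 13], [11, 14, 16], [12, 14, 15], [13, 15, 16]]
    (by decide +kernel) (by decide +kernel)

theorem hasHoledDesign_20_5 : HasHoledDesign {i : Fin 20 | i.val < 5} :=
  hasHoledDesign_of_list
    [[0, 5, 11], [0, 6, 15], [0, 7, 19], [0, 8, 9], [0, 10, 14], [0, 12, 17, 18], [0, 13, 16], [1,
    5, 9], [1, 6, 12], [1, 7, 16], [1, 8, 15], [1, 10, 11], [1, 13, 18, 19], [1, 14, 17], [2, 5,
    6], [2, 7, 13], [2, 8, 17], [2, 9, 16], [2, 10, 18], [2, 11, 12], [2, 14, 15, 19], [3, 5, 17],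
    [3, 6, 7], [3, 8, 14], [3, 9, 18], [3, 10, 15, 16], [3, 11, 19], [3, 12, 13], [4, 5, 19], [4,
    6, 18], [4, 7, 8], [4, 9, 10], [4, 11, 16, 17], [4, 12, 15], [4, 13, 14], [5, 7, 10], [5, 8,
    13], [5, 12, 14, 16], [5, 15, 18], [6, 8, 11], [6, 9, 14], [6, 10, 13, 17], [6, 16, 19], [7,
    9, 12], [7, 11, 14, 18], [7, 15, 17], [8, 10, 12, 19], [8, 16, 18], [9, 11, 13, 15], [9, 17,
    19]]
    (by decide +kernel) (by decide +kernel)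

theorem ncard_setOf_val_lt {v w : ℕ} (h : w ≤ v) : {i : Fin v | i.val < w}.ncard = w := by
  have hs : {i : Fin v | i.val < w} = Set.range (Fin.castLE h) := by
    ext i
    exact ⟨fun hi => ⟨⟨i, hi⟩, rfl⟩, by rintro ⟨j, rfl⟩; exact j.2⟩
  rw [hs, ← Set.image_univ, Set.ncard_image_of_injective _ (Fin.castLE_injective h)]
  simp

/-- There is a holed design on `v` points with a hole of size 5. -/
def HasFiveHoledDesign (v : ℕ) : Prop := HasHoledDesign {i : Fin v | i.val < 5}

theorem HasHoledDesign.hasFiveHoledDesign {V : Type*} [Fintype V] {H : Set V}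
    (h : HasHoledDesign H) (hH : H.ncard = 5) {v : ℕ} (hv : Fintype.card V = v) :
    HasFiveHoledDesign v := by
  have hle : 5 ≤ v := by
    rw [← hv, ← hH, ← Nat.card_eq_fintype_card]
    exact Set.ncard_le_card H
  obtain ⟨k, rfl⟩ := Nat.exists_eq_add_of_le hle
  have h₁ : HasHoledDesign (Set.range (Sum.inl : Fin 5 → Fin 5 ⊕ Fin k)) :=
    h.range_inl (by simpa using hH) (by simpa using hv)
  have h₂ := h₁.map_equiv finSumFinEquiv
  unfold HasFiveHoledDesign
  convert h₂ using 1
  ext i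
  constructor
  · intro hi
    exact ⟨Sum.inl ⟨i, hi⟩, by simp, by ext; simp⟩
  · rintro ⟨_, ⟨j, rfl⟩, rfl⟩
    simp

theorem bijective_add_self_zmod {n : ℕ} [NeZero n] (hn : Odd n) :
    Function.Bijective fun a : ZMod n => a + a := by
  refine Function.Injective.bijective_of_finite fun a b h => ?_
  have hu : IsUnit ((2 : ℕ) : ZMod n) :=
    (ZMod.isUnit_iff_coprime 2 n).2 (Nat.coprime_two_left.2 hn)
  refine hu.mul_left_cancel ?_
  simpa [two_mul] using h

theorem HasFiveHoledDesign.triple {n t : ℕ} (hn : Odd n) (htn : t ≤ n)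
    (hA : HasFiveHoledDesign (5 + n)) (hD : HasFiveHoledDesign (5 + t)) :
    HasFiveHoledDesign (3 * n + t + 5) := by
  have : NeZero n := ⟨hn.pos.ne'⟩
  obtain ⟨f⟩ : Nonempty (Fin t ↪ ZMod n) :=
    Function.Embedding.nonempty_of_card_le (by simpa [ZMod.card] using htn)
  have hA' := hA.range_inl (W := Fin 5) (T := ZMod n)
    (by simpa using ncard_setOf_val_lt (by omega)) (by simp [ZMod.card])
  have hD' := hD.range_inl (W := Fin 5) (T := Fin t)
    (by simpa using ncard_setOf_val_lt (by omega)) (by simp)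
  refine (HasHoledDesign.triple (bijective_add_self_zmod hn) f.injective hA'
    (by simp) hD').hasFiveHoledDesign ?_ ?_
  · rw [Set.ncard_image_of_injective _ Sum.inl_injective, ← Set.image_univ,
      Set.ncard_image_of_injective _ Sum.inl_injective]
    simp
  · simp [ZMod.card]
    omega

theorem hasFiveHoledDesign_of_filling {n : ℕ} (hn : Odd n) (h5 : 5 ≤ n)
    (hA : HasHoledDesign {i : Fin n | i.val < 0}) : HasFiveHoledDesign (3 * n + 5) := by
  have : NeZero n := ⟨hn.pos.ne'⟩
  obtain ⟨f⟩ : Nonempty (Fin 5 ↪ ZMod n) :=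
    Function.Embedding.nonempty_of_card_le (by simpa [ZMod.card] using h5)
  have hA' := hA.range_inl (W := Fin 0) (T := ZMod n) (by simp) (by simp [ZMod.card])
  have hD : HasHoledDesign (Set.univ : Set (Fin 0 ⊕ Fin 5)) :=
    ⟨∅, by simp, by simp, fun p q h => by simp [holeGraph] at h, by simp⟩
  refine (HasHoledDesign.triple (bijective_add_self_zmod hn) f.injective hA'
    (by simp) hD).hasFiveHoledDesign ?_ ?_
  · rw [Set.ncard_image_of_injective _ Sum.inl_injective]
    simp
  · simp [ZMod.card]
    omega

theorem hasFiveHoledDesign_five : HasFiveHoledDesign 5 :=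
  ⟨∅, by simp, by simp, fun p q h => absurd ⟨p.2, q.2⟩ h.2, by simp⟩

theorem hasFiveHoledDesign_of_mod (u : ℕ) (hmod : u % 6 = 2) (hu : 14 ≤ u) :
    HasFiveHoledDesign u := by
  induction u using Nat.strong_induction_on with
  | _ u ih =>
  by_cases h14 : u = 14
  · exact h14 ▸ hasHoledDesign_14_5
  by_cases h20 : u = 20
  · exact h20 ▸ hasHoledDesign_20_5
  by_cases h26 : u = 26
  · exact h26 ▸ hasFiveHoledDesign_of_filling (n := 7) (by decide) (by norm_num)
      hasHoledDesign_7_0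
  by_cases h44 : u = 44
  · exact h44 ▸ hasFiveHoledDesign_of_filling (n := 13) (by decide) (by norm_num)
      hasHoledDesign_13_0
  have step : ∀ n t, n % 6 = 3 → 9 ≤ n → t ≤ n → u = 3 * n + t + 5 →
      HasFiveHoledDesign (5 + t) → HasFiveHoledDesign u := by
    rintro n t hn h9 htn rfl hD
    exact HasFiveHoledDesign.triple (Nat.odd_iff.2 (by omega)) htn
      (ih (5 + n) (by omega) (by omega) (by omega)) hD
  obtain ⟨k, hk | hk | hk⟩ : ∃ k, u = 18 * k + 32 ∨ u = 18 * k + 38 ∨ u = 18 * k + 62 :=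
    ⟨if u % 18 = 14 then (u - 32) / 18 else if u % 18 = 2 then (u - 38) / 18 else (u - 62) / 18,
      by split_ifs <;> omega⟩
  · exact step (6 * k + 9) 0 (by omega) (by omega) (by omega) (by omega) hasFiveHoledDesign_five
  · exact step (6 * k + 9) 6 (by omega) (by omega) (by omega) (by omega) hasHoledDesign_11_5
  · exact step (6 * k + 15) 12 (by omega) (by omega) (by omega) (by omega) hasHoledDesign_17_5

theorem HasFiveHoledDesign.exists_isPBD345star {u : ℕ} (hu : 5 ≤ u) (h : HasFiveHoledDesign u) :
    ∃ ℬ : Finset (Finset (Fin u)), IsPBD345star u ℬ := by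
  classical
  obtain ⟨𝒜, h⟩ := h
  let A : Finset (Finset (Fin u)) := Finset.univ.filter (· ∈ 𝒜)
  let H : Finset (Fin u) := Finset.univ.filter fun i => i.val < 5
  have hH : H.card = 5 := by
    rw [← ncard_setOf_val_lt hu, ← Set.ncard_coe_finset]
    simp [H]
  refine ⟨insert H A, ?_, ?_, ?_⟩
  · intro B hB
    rcases Finset.mem_insert.1 hB with rfl | hB
    · exact Or.inr (Or.inr hH)
    · exact (h.card_eq B (by simpa [A] using hB)).imp_right Or.inl
  · intro p q hpq
    by_cases hw : p.val < 5 ∧ q.val < 5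
    · refine ⟨H, ⟨by simp, by simpa [H] using hw.1, by simpa [H] using hw.2⟩, ?_⟩
      rintro B ⟨hB, hp, hq⟩
      rcases Finset.mem_insert.1 hB with rfl | hB
      · rfl
      · exact absurd hw (h.isClique B (by simpa [A] using hB) hp hq hpq).2
    · obtain ⟨B, hB, hp, hq⟩ := h.exists_mem p q ⟨hpq, hw⟩
      refine ⟨B, ⟨by simp [A, hB], hp, hq⟩, ?_⟩
      rintro C ⟨hC, hpC, hqC⟩
      rcases Finset.mem_insert.1 hC with rfl | hC
      · exact absurd ⟨by simpa [H] using hpC, by simpa [H] using hqC⟩ hw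
      · exact h.unique C (by simpa [A] using hC) B hB p q hpq hpC hqC hp hq
  · rw [Finset.card_eq_one]
    refine ⟨H, ?_⟩
    ext B
    simp only [Finset.mem_filter, Finset.mem_insert, Finset.mem_singleton]
    constructor
    · rintro ⟨rfl | hB, h5⟩
      · rfl
      · have := h.card_eq B (by simpa [A] using hB)
        omega
    · rintro rfl
      exact ⟨Or.inl rfl, hH⟩

/-- For every positive integer u with u ≡ 2 (mod 6) and u ≥ 14,
there exists a PBD(u,{3,4,5*}). -/
theorem exists_pbd_345star (u : ℕ) (hmod : u % 6 = 2) (hu : 14 ≤ u) :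
    ∃ ℬ : Finset (Finset (Fin u)), IsPBD345star u ℬ := by
  exact (hasFiveHoledDesign_of_mod u hmod hu).exists_isPBD345star (by omega)
end

section
/- There exists a (3,3,1)-cyclic 3-HGDD of type (5,3^3). -/
/-- A (g,t,1)-cyclic 3-HGDD of type (u,g^t): blocks on `I_u × I_g × Z_t` with
groups `{i} × I_g × Z_t` (i ∈ I_u) and holes `I_u × I_g × {j}` (j ∈ Z_t).
No block contains two points of the same group (same first coordinate) or of
the same hole (same last coordinate); every pair of points from distinct
groups and distinct holes lies in exactly one block; the cyclic shift of the
last coordinate maps the block set onto itself. -/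
def IsCyclicHGDD (u g t : ℕ) (ℬ : Finset (Finset (Fin u × Fin g × ZMod t))) : Prop :=
  (∀ B ∈ ℬ, B.card = 3) ∧
  (∀ B ∈ ℬ, ∀ p ∈ B, ∀ q ∈ B, p ≠ q → p.1 ≠ q.1 ∧ p.2.2 ≠ q.2.2) ∧
  (∀ p q : Fin u × Fin g × ZMod t, p.1 ≠ q.1 → p.2.2 ≠ q.2.2 →
    ∃! B, B ∈ ℬ ∧ p ∈ B ∧ q ∈ B) ∧
  (∀ B ∈ ℬ, B.image (fun p => (p.1, p.2.1, p.2.2 + 1)) ∈ ℬ)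

/-- The point of `I_5 × I_3 × Z_3` with Chinese remainder coordinates `n mod 5`, `n mod 3`
in `I_5 × I_3`, at level `j`. -/
def crtPoint (n : Fin 15) (j : ZMod 3) : Fin 5 × Fin 3 × ZMod 3 :=
  (Fin.ofNat 5 n, Fin.ofNat 3 n, j)

/-- The residue modulo 15 with the given residues modulo 5 and modulo 3. -/
def crtResidue (p : Fin 5 × Fin 3 × ZMod 3) : Fin 15 :=
  Fin.ofNat 15 (6 * p.1 + 10 * p.2.1)

/-- Four base cycles modulo 15. Their successive differences `(1, 6, 8)`, `(2, 4, 9)`,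
`(3, 13, 14)`, `(7, 11, 12)` use every residue modulo 15 not divisible by 5 exactly once. -/
def baseCycle : Fin 4 → Fin 3 → Fin 15 :=
  ![![0, 1, 7], ![0, 2, 6], ![0, 3, 1], ![0, 7, 3]]

/-- The `k`-th point of the translate by `n` of a base cycle, placed on the levels from `j` on. -/
def cyclePoint (x : Fin 4 × Fin 15 × ZMod 3) (k : Fin 3) : Fin 5 × Fin 3 × ZMod 3 :=
  crtPoint (x.2.1 + baseCycle x.1 k) (x.2.2 + (k : ℕ))

/-- The block formed by the three points of a translated base cycle. -/
def cycleBlock (x : Fin 4 × Fin 15 × ZMod 3) : Finset (Fin 5 × Fin 3 × ZMod 3) :=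
  Finset.univ.image (cyclePoint x)

/-- The base cycle, and the position in it, at which a given difference modulo 15 occurs
(with an arbitrary value at the multiples of 5). -/
def differencePosition : Fin 15 → Fin 4 × Fin 3 :=
  ![(0, 0), (0, 0), (1, 0), (2, 0), (1, 1), (0, 0), (0, 1), (3, 0), (0, 2), (1, 2), (0, 0),
    (3, 1), (3, 2), (2, 1), (2, 2)]

/-- The index of the cycle block in which `q` is the successor of `p`. -/
def arcIndex (p q : Fin 5 × Fin 3 × ZMod 3) : Fin 4 × Fin 15 × ZMod 3 :=
  let d := differencePosition (crtResidue q - crtResidue p)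
  (d.1, crtResidue p - baseCycle d.1 d.2, p.2.2 - (d.2 : ℕ))

/-- The index of the cycle block through two points of distinct groups and holes. -/
def pairIndex (p q : Fin 5 × Fin 3 × ZMod 3) : Fin 4 × Fin 15 × ZMod 3 :=
  if q.2.2 = p.2.2 + 1 then arcIndex p q else arcIndex q p

lemma mem_cycleBlock {x : Fin 4 × Fin 15 × ZMod 3} {p : Fin 5 × Fin 3 × ZMod 3} :
    p ∈ cycleBlock x ↔ ∃ k, cyclePoint x k = p := by
  simp [cycleBlock]

lemma cyclePoint_transversal : ∀ x k l, k ≠ l →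
    (cyclePoint x k).1 ≠ (cyclePoint x l).1 ∧ (cyclePoint x k).2.2 ≠ (cyclePoint x l).2.2 := by
  decide +kernel

lemma cyclePoint_injective (x : Fin 4 × Fin 15 × ZMod 3) : Function.Injective (cyclePoint x) := by
  intro k l h
  by_contra hkl
  exact (cyclePoint_transversal x k l hkl).1 (congrArg Prod.fst h)

lemma shift_cyclePoint : ∀ (x : Fin 4 × Fin 15 × ZMod 3) (k : Fin 3),
    ((cyclePoint x k).1, (cyclePoint x k).2.1, (cyclePoint x k).2.2 + 1) =
      cyclePoint (x.1, x.2.1, x.2.2 + 1) k := by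
  decide +kernel

lemma exists_cyclePoint_pairIndex : ∀ p q : Fin 5 × Fin 3 × ZMod 3,
    p.1 ≠ q.1 → p.2.2 ≠ q.2.2 →
      (∃ k, cyclePoint (pairIndex p q) k = p) ∧ ∃ k, cyclePoint (pairIndex p q) k = q := by
  decide +kernel

lemma pairIndex_cyclePoint : ∀ x k l, k ≠ l →
    pairIndex (cyclePoint x k) (cyclePoint x l) = x := by
  decide +kernel

/-- There exists a (3,3,1)-cyclic 3-HGDD of type (5,3^3). -/
theorem exists_cyclic_hgdd_five_three_cubed :
    ∃ ℬ : Finset (Finset (Fin 5 × Fin 3 × ZMod 3)), IsCyclicHGDD 5 3 3 ℬ := by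
  refine ⟨Finset.univ.image cycleBlock, ?_, ?_, fun p q hg hh => ?_, ?_⟩
  · intro B hB
    obtain ⟨x, -, rfl⟩ := Finset.mem_image.mp hB
    exact Finset.card_image_of_injective _ (cyclePoint_injective x)
  · intro B hB p hp q hq hpq
    obtain ⟨x, -, rfl⟩ := Finset.mem_image.mp hB
    obtain ⟨k, rfl⟩ := mem_cycleBlock.mp hp
    obtain ⟨l, rfl⟩ := mem_cycleBlock.mp hq
    exact cyclePoint_transversal x k l (ne_of_apply_ne _ hpq)
  · obtain ⟨hp, hq⟩ := exists_cyclePoint_pairIndex p q hg hh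
    refine ⟨cycleBlock (pairIndex p q), ⟨Finset.mem_image_of_mem _ (Finset.mem_univ _),
      mem_cycleBlock.mpr hp, mem_cycleBlock.mpr hq⟩, ?_⟩
    rintro C ⟨hC, hpC, hqC⟩
    obtain ⟨x, -, rfl⟩ := Finset.mem_image.mp hC
    obtain ⟨k, rfl⟩ := mem_cycleBlock.mp hpC
    obtain ⟨l, rfl⟩ := mem_cycleBlock.mp hqC
    rw [pairIndex_cyclePoint x k l fun h => hg (h ▸ rfl)]
  · intro B hB
    obtain ⟨x, -, rfl⟩ := Finset.mem_image.mp hB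
    refine Finset.mem_image.mpr ⟨(x.1, x.2.1, x.2.2 + 1), Finset.mem_univ _, ?_⟩
    simp only [cycleBlock, Finset.image_image, Function.comp_def, shift_cyclePoint]
end

section
/- Let u, g, t be positive integers with u ≡ 0 or 1 (mod 3), u ≥ 3, t odd and t ≥ 3, and (u,g,t) ≠ (6,1,3). Then there exists a (g,t,1)-cyclic 3-HGDD of type (u,g^t). -/
open Finset

/-- A finite family of triples that covers every admissible pair, and has at most as many triples
as a perfect packing allows, covers every admissible pair exactly once. -/
theorem existsUnique_block_of_card_le {X : Type*} [Fintype X] [DecidableEq X]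
    (𝓑 : Finset (Finset X)) (adm : X → X → Prop) [DecidableRel adm]
    (irrefl : ∀ p, ¬ adm p p) (hcard : ∀ B ∈ 𝓑, B.card = 3)
    (hadm : ∀ B ∈ 𝓑, ∀ p ∈ B, ∀ q ∈ B, p ≠ q → adm p q)
    (hcov : ∀ p q, adm p q → ∃ B ∈ 𝓑, p ∈ B ∧ q ∈ B)
    (hcount : 6 * 𝓑.card ≤ (univ.filter fun s : X × X => adm s.1 s.2).card)
    (p q : X) (hpq : adm p q) : ∃! B, B ∈ 𝓑 ∧ p ∈ B ∧ q ∈ B := by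
  set S := univ.filter fun s : X × X => adm s.1 s.2 with hS
  let r : Finset X → X × X → Prop := fun B s => s.1 ∈ B ∧ s.2 ∈ B
  have hdouble := sum_card_bipartiteAbove_eq_sum_card_bipartiteBelow (s := 𝓑) (t := S) r
  have habove : ∀ B ∈ 𝓑, (bipartiteAbove r S B).card = 6 := by
    intro B hB
    have : bipartiteAbove r S B = B.offDiag := by
      ext s
      simp only [mem_bipartiteAbove, mem_offDiag, hS, mem_filter, mem_univ, true_and, r]
      constructor
      · rintro ⟨h, h1, h2⟩
        exact ⟨h1, h2, fun h' => irrefl s.2 (h' ▸ h)⟩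
      · rintro ⟨h1, h2, h3⟩
        exact ⟨hadm B hB _ h1 _ h2 h3, h1, h2⟩
    rw [this, offDiag_card, hcard B hB]
  have hbelow : ∀ s ∈ S, 1 ≤ (bipartiteBelow r 𝓑 s).card := by
    intro s hs
    obtain ⟨B, hB, h⟩ := hcov s.1 s.2 (by simpa [hS] using hs)
    exact card_pos.2 ⟨B, by simpa [mem_bipartiteBelow, r] using ⟨hB, h⟩⟩
  rw [sum_congr rfl habove, sum_const, smul_eq_mul] at hdouble
  have hle : ∑ _s ∈ S, 1 = ∑ s ∈ S, (bipartiteBelow r 𝓑 s).card := by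
    apply le_antisymm (sum_le_sum hbelow)
    rw [← hdouble, sum_const, smul_eq_mul]
    omega
  have hone := (sum_eq_sum_iff_of_le hbelow).1 hle (p, q) (by simpa [hS] using hpq)
  obtain ⟨B, hB⟩ := card_eq_one.1 hone.symm
  have hmem : ∀ C, C ∈ 𝓑 ∧ p ∈ C ∧ q ∈ C ↔ C = B := by
    intro C
    rw [← mem_singleton, ← hB]
    simp [mem_bipartiteBelow, r]
  exact ⟨B, (hmem B).2 rfl, fun C hC => (hmem C).1 hC⟩

theorem le_card_admissible_pairs (u g t : ℕ) [NeZero t] :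
    u * (u - 1) * (g * g) * (t * (t - 1)) ≤
      (univ.filter fun s : (Fin u × Fin g × ZMod t) × (Fin u × Fin g × ZMod t) =>
        s.1.1 ≠ s.2.1 ∧ s.1.2.2 ≠ s.2.2.2).card := by
  have hu : (univ : Finset (Fin u)).offDiag.card = u * (u - 1) := by
    simp [offDiag_card, Nat.mul_sub]
  have ht : (univ : Finset (ZMod t)).offDiag.card = t * (t - 1) := by
    simp [offDiag_card, Nat.mul_sub, ZMod.card]
  have hg : (univ : Finset (Fin g × Fin g)).card = g * g := by simp
  rw [← hu, ← ht, ← hg, ← card_product, ← card_product]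
  refine card_le_card_of_injOn
    (fun s => ((s.1.1.1, s.1.2.1, s.2.1), (s.1.1.2, s.1.2.2, s.2.2))) ?_ ?_
  · intro s hs
    simpa [and_assoc] using hs
  · rintro ⟨⟨⟨a, b⟩, c, d⟩, e, f⟩ _ ⟨⟨⟨a', b'⟩, c', d'⟩, e', f'⟩ _ h
    simp only [Prod.mk.injEq] at h ⊢
    tauto

/-- A triangle on `a`, `b`, `c` whose arcs `a → b`, `b → c`, `c → a` carry the labels
`p`, `q`, `r`. -/
structure LabelledTriangle (V A : Type) where
  (a b c : V)
  (p q r : A)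

namespace LabelledTriangle

variable {V A : Type} [AddCommGroup A]

/-- The arc `x → y` of the triangle carries the label `d`. -/
def HasArc (β : LabelledTriangle V A) (x y : V) (d : A) : Prop :=
  (β.a = x ∧ β.b = y ∧ β.p = d) ∨ (β.b = x ∧ β.c = y ∧ β.q = d) ∨ (β.c = x ∧ β.a = y ∧ β.r = d)

/-- The arc `x → y` carries the label `d`, or the reversed arc carries the label `-d`. -/
def Covers (β : LabelledTriangle V A) (x y : V) (d : A) : Prop :=
  β.HasArc x y d ∨ β.HasArc y x (-d)

instance [DecidableEq V] [DecidableEq A] (β : LabelledTriangle V A) (x y : V) (d : A) :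
    Decidable (β.HasArc x y d) := by unfold HasArc; infer_instance

instance [DecidableEq V] [DecidableEq A] (β : LabelledTriangle V A) (x y : V) (d : A) :
    Decidable (β.Covers x y d) := by unfold Covers; infer_instance

theorem Covers.reverse {β : LabelledTriangle V A} {x y : V} {d : A} (h : β.Covers x y d) :
    β.Covers y x (-d) := by
  rw [Covers, neg_neg]
  exact h.symm

end LabelledTriangle

/-- A difference family: labelled triangles with zero label sum covering every arc of the complete
digraph on `V` with every label satisfying `D`. -/
structure IsDifferenceFamily {V A ι : Type} [AddCommGroup A] (D : A → Prop)
    (B : ι → LabelledTriangle V A) : Prop where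
  ne : ∀ i, (B i).a ≠ (B i).b ∧ (B i).b ≠ (B i).c ∧ (B i).c ≠ (B i).a
  mem : ∀ i, D (B i).p ∧ D (B i).q ∧ D (B i).r
  sum : ∀ i, (B i).p + (B i).q + (B i).r = 0
  covers : ∀ x y d, x ≠ y → D d → ∃ i, (B i).Covers x y d

/-- There is a difference family with no more triangles than needed. -/
def HasDifferenceFamily (V A : Type) [Fintype V] [AddCommGroup A] (D : A → Prop) : Prop :=
  ∃ (ι : Type) (_ : Fintype ι) (B : ι → LabelledTriangle V A), IsDifferenceFamily D B ∧
    6 * Fintype.card ι ≤ Fintype.card V * (Fintype.card V - 1) * Nat.card {d // D d}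

/-- The block of `V × A × G` obtained by developing a labelled triangle from `x : A` and
`i j : G`. -/
def LabelledTriangle.develop {V A G : Type} [AddCommGroup A] [AddCommGroup G]
    (β : LabelledTriangle V A) (x : A) (i j : G) : Fin 3 → V × A × G :=
  ![(β.a, x, i), (β.b, x + β.p, j), (β.c, x + β.p + β.q, -i - j)]

theorem LabelledTriangle.exists_develop_of_hasArc {V A G : Type} [AddCommGroup A] [AddCommGroup G]
    {β : LabelledTriangle V A} (hsum : β.p + β.q + β.r = 0) {v w : V} {x y : A}
    (h : β.HasArc v w (y - x)) (i j : G) :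
    ∃ x' i' j', ∃ k l, β.develop x' i' j' k = (v, x, i) ∧ β.develop x' i' j' l = (w, y, j) := by
  rcases h with ⟨rfl, rfl, h⟩ | ⟨rfl, rfl, h⟩ | ⟨rfl, rfl, h⟩
  · exact ⟨x, i, j, 0, 1, by simp [develop], by simp [develop, h]⟩
  · refine ⟨x - β.p, -i - j, i, 1, 2, by simp [develop], ?_⟩
    simp [develop, h]
  · refine ⟨y, j, -i - j, 2, 0, ?_, by simp [develop]⟩
    have : y + β.p + β.q = x := by
      have : β.p + β.q = x - y := by
        rw [← neg_sub, ← h]; exact eq_neg_of_add_eq_zero_left hsum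
      rw [add_assoc, this]; abel
    have hij : -j - (-i - j) = i := by abel
    simp [develop, this, hij]

theorem exists_isCyclicHGDD_of_hasDifferenceFamily {V A J G : Type} [Fintype V] [Fintype J]
    [Fintype G] [AddCommGroup A] [AddCommGroup J] [AddCommGroup G] {u g t : ℕ} [NeZero t]
    {D : A → Prop} (h : HasDifferenceFamily V A D) (e : A ≃+ J × ZMod t)
    (he : ∀ d, D d ↔ (e d).2 ≠ 0) (hV : Fintype.card V = u)
    (hg : Fintype.card J * Fintype.card G = g) :
    ∃ ℬ : Finset (Finset (Fin u × Fin g × ZMod t)), IsCyclicHGDD u g t ℬ := by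
  classical
  obtain ⟨ι, _, B, hB, hcount⟩ := h
  have : Fintype A := Fintype.ofEquiv _ e.symm.toEquiv
  let eV : V ≃ Fin u := Fintype.equivFinOfCardEq hV
  let eG : J × G ≃ Fin g := Fintype.equivFinOfCardEq (by rw [Fintype.card_prod, hg])
  let f : V × A × G → Fin u × Fin g × ZMod t := fun s =>
    (eV s.1, eG ((e s.2.1).1, s.2.2), (e s.2.1).2)
  have hf : Function.Surjective f := by
    rintro ⟨a, b, c⟩
    refine ⟨(eV.symm a, e.symm ((eG.symm b).1, c), (eG.symm b).2), ?_⟩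
    simp [f]
  let blk : ι × A × G × G → Fin 3 → Fin u × Fin g × ZMod t := fun s k =>
    f ((B s.1).develop s.2.1 s.2.2.1 s.2.2.2 k)
  have hadm : ∀ s k l, k ≠ l → (blk s k).1 ≠ (blk s l).1 ∧ (blk s k).2.2 ≠ (blk s l).2.2 := by
    rintro ⟨s, x, i, j⟩ k l hkl
    obtain ⟨h1, h2, h3⟩ := hB.ne s
    obtain ⟨m1, m2, m3⟩ := hB.mem s
    rw [he] at m1 m2 m3
    have hs := hB.sum s
    have hs' : (e (B s).p).2 + (e (B s).q).2 = - (e (B s).r).2 := by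
      have := congrArg (fun z => (e z).2) hs
      simp only [map_add, Prod.snd_add, map_zero, Prod.snd_zero] at this
      exact eq_neg_of_add_eq_zero_left this
    have hpq : (e (B s).p).2 + (e (B s).q).2 ≠ 0 := by rw [hs']; simpa using m3
    fin_cases k <;> fin_cases l <;> first
      | exact absurd rfl hkl
      | simp [blk, f, LabelledTriangle.develop, add_assoc, h1, h1.symm, h2, h2.symm, h3, h3.symm,
          m1, m2, hpq]
  have hinj : ∀ s, Function.Injective (blk s) := by
    intro s k l hkl
    by_contra hne
    exact (hadm s k l hne).1 (by rw [hkl])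
  let ℬ := univ.image fun s => univ.image (blk s)
  have hmem : ∀ C, C ∈ ℬ ↔ ∃ s, univ.image (blk s) = C := by simp [ℬ]
  have hℬadm : ∀ C ∈ ℬ, ∀ p ∈ C, ∀ q ∈ C, p ≠ q → p.1 ≠ q.1 ∧ p.2.2 ≠ q.2.2 := by
    intro C hC p hp q hq hpq
    obtain ⟨s, rfl⟩ := (hmem C).1 hC
    obtain ⟨k, -, rfl⟩ := mem_image.1 hp
    obtain ⟨l, -, rfl⟩ := mem_image.1 hq
    exact hadm s k l fun h => hpq (by rw [h])
  have hℬcard : ∀ C ∈ ℬ, C.card = 3 := by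
    intro C hC
    obtain ⟨s, rfl⟩ := (hmem C).1 hC
    rw [card_image_of_injective _ (hinj s), card_univ, Fintype.card_fin]
  refine ⟨ℬ, hℬcard, hℬadm, ?_, ?_⟩
  · suffices ∀ p q : Fin u × Fin g × ZMod t, (p.1 ≠ q.1 ∧ p.2.2 ≠ q.2.2) →
        ∃! C, C ∈ ℬ ∧ p ∈ C ∧ q ∈ C from fun p q h1 h2 => this p q ⟨h1, h2⟩
    refine existsUnique_block_of_card_le ℬ _ (by simp) hℬcard hℬadm ?_ ?_
    · intro p q hpq
      obtain ⟨⟨v, x, i⟩, rfl⟩ := hf p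
      obtain ⟨⟨w, y, j⟩, rfl⟩ := hf q
      have hvw : v ≠ w := fun h => hpq.1 (by simp [f, h])
      have hxy : D (y - x) := by
        rw [he, map_sub, Prod.snd_sub, sub_ne_zero]
        exact hpq.2.symm
      obtain ⟨s, hs⟩ := hB.covers v w _ hvw hxy
      obtain ⟨x', i', j', k, l, hk, hl⟩ : ∃ x' i' j' k l,
          (B s).develop x' i' j' k = (v, x, i) ∧ (B s).develop x' i' j' l = (w, y, j) := by
        rcases hs with hs | hs
        · exact LabelledTriangle.exists_develop_of_hasArc (hB.sum s) hs i j
        · rw [neg_sub] at hs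
          obtain ⟨x', i', j', k, l, hk, hl⟩ :=
            LabelledTriangle.exists_develop_of_hasArc (hB.sum s) hs j i
          exact ⟨x', i', j', l, k, hl, hk⟩
      refine ⟨_, (hmem _).2 ⟨(s, x', i', j'), rfl⟩, mem_image.2 ⟨k, mem_univ _, ?_⟩,
        mem_image.2 ⟨l, mem_univ _, ?_⟩⟩
      · simp only [blk, hk]
      · simp only [blk, hl]
    · have hle :
          ℬ.card ≤ Fintype.card ι * (Fintype.card A * (Fintype.card G * Fintype.card G)) := by
        refine card_image_le.trans ?_
        simp [card_univ, Fintype.card_prod]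
      have hA : Fintype.card A = Fintype.card J * t := by
        rw [Fintype.card_congr e.toEquiv, Fintype.card_prod, ZMod.card]
      have hD : Nat.card {d // D d} = Fintype.card J * (t - 1) := by
        have e' : {d // D d} ≃ J × {z : ZMod t // z ≠ 0} :=
          { toFun := fun d => ((e d.1).1, ⟨(e d.1).2, (he _).1 d.2⟩)
            invFun := fun z => ⟨e.symm (z.1, z.2.1), by rw [he]; simpa using z.2.2⟩
            left_inv := fun d => by simp
            right_inv := fun z => by simp }
        rw [Nat.card_congr e', Nat.card_prod, Nat.card_eq_fintype_card, Nat.card_eq_fintype_card,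
          Fintype.card_subtype_compl, Fintype.card_subtype_eq, ZMod.card]
      rw [hV, hD] at hcount
      refine le_trans ?_ (le_card_admissible_pairs u g t)
      calc 6 * ℬ.card ≤
          6 * Fintype.card ι * (Fintype.card A * (Fintype.card G * Fintype.card G)) := by
            rw [mul_assoc]; exact Nat.mul_le_mul_left _ hle
        _ ≤ u * (u - 1) * (Fintype.card J * (t - 1)) *
            (Fintype.card A * (Fintype.card G * Fintype.card G)) := Nat.mul_le_mul_right _ hcount
        _ = u * (u - 1) * (g * g) * (t * (t - 1)) := by rw [hA, ← hg]; ring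
  · intro C hC
    obtain ⟨⟨s, x, i, j⟩, rfl⟩ := (hmem C).1 hC
    refine (hmem _).2 ⟨(s, x + e.symm (0, 1), i, j), ?_⟩
    rw [image_image]
    refine image_congr fun k _ => ?_
    fin_cases k <;>
      simp [blk, f, LabelledTriangle.develop] <;> abel

/-- Read triples `(a, m, b)` as directed triangles `a → m → b → a`. The pair `x`, `y` occurs in both
directions, either both times as an arc closing a triangle or both times as another arc. -/
def PairMatched {V κ : Type} (T : κ → V × V × V) (x y : V) : Prop :=
  ((∃ k, ((T k).1 = x ∧ (T k).2.1 = y) ∨ ((T k).2.1 = x ∧ (T k).2.2 = y)) ∧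
    (∃ k, ((T k).1 = y ∧ (T k).2.1 = x) ∨ ((T k).2.1 = y ∧ (T k).2.2 = x))) ∨
  ((∃ k, (T k).2.2 = x ∧ (T k).1 = y) ∧ (∃ k, (T k).2.2 = y ∧ (T k).1 = x))

instance {V κ : Type} [DecidableEq V] [Fintype κ] (T : κ → V × V × V) (x y : V) :
    Decidable (PairMatched T x y) := by unfold PairMatched; infer_instance

theorem PairMatched.map {V W κ μ : Type} {T : κ → V × V × V} {U : μ → W × W × W} (f : V → W)
    (h : ∀ k, ∃ l, U l = (f (T k).1, f (T k).2.1, f (T k).2.2)) {x y : V}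
    (hxy : PairMatched T x y) : PairMatched U (f x) (f y) := by
  choose l hl using h
  rcases hxy with ⟨⟨i, hi⟩, ⟨j, hj⟩⟩ | ⟨⟨i, hi⟩, ⟨j, hj⟩⟩
  · refine Or.inl ⟨⟨l i, ?_⟩, ⟨l j, ?_⟩⟩ <;> simp only [hl] <;> [rcases hi with hi | hi;
      rcases hj with hi | hi] <;> simp [hi.1, hi.2]
  · refine Or.inr ⟨⟨l i, ?_⟩, ⟨l j, ?_⟩⟩ <;> simp [hl, hi.1, hi.2, hj.1, hj.2]

/-- A system of triples of distinct points in which all pairs are matched. -/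
structure IsMatchedTripleSystem {V κ : Type} (T : κ → V × V × V) : Prop where
  ne : ∀ k, (T k).1 ≠ (T k).2.1 ∧ (T k).2.1 ≠ (T k).2.2 ∧ (T k).2.2 ≠ (T k).1
  pairMatched : ∀ x y, x ≠ y → PairMatched T x y

/-- There is a matched triple system with no more triples than needed. -/
def HasMatchedTripleSystem (V : Type) [Fintype V] : Prop :=
  ∃ (κ : Type) (_ : Fintype κ) (T : κ → V × V × V), IsMatchedTripleSystem T ∧
    3 * Fintype.card κ ≤ Fintype.card V * (Fintype.card V - 1)

theorem ZMod.exists_eq_or_eq_neg_of_ne_zero {n : ℕ} {d : ZMod (2 * n + 1)} (hd : d ≠ 0) :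
    ∃ i : Fin n, d = ((i + 1 : ℕ) : ZMod (2 * n + 1)) ∨ d = -((i + 1 : ℕ) : ZMod (2 * n + 1)) := by
  have hlt := ZMod.val_lt d
  have hpos : 0 < d.val := Nat.pos_of_ne_zero (by rwa [Ne, ZMod.val_eq_zero])
  have hcast : ((d.val : ℕ) : ZMod (2 * n + 1)) = d := ZMod.natCast_zmod_val d
  by_cases h : d.val ≤ n
  · refine ⟨⟨d.val - 1, by omega⟩, Or.inl ?_⟩
    rw [show d.val - 1 + 1 = d.val by omega, hcast]
  · refine ⟨⟨2 * n - d.val, by omega⟩, Or.inr ?_⟩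
    rw [show 2 * n - d.val + 1 = 2 * n + 1 - d.val by omega, Nat.cast_sub hlt.le, hcast,
      ZMod.natCast_self, zero_sub, neg_neg]

theorem HasMatchedTripleSystem.hasDifferenceFamily {V : Type} [Fintype V]
    (h : HasMatchedTripleSystem V) (n : ℕ) :
    HasDifferenceFamily V (ZMod (2 * n + 1)) (· ≠ 0) := by
  obtain ⟨κ, _, T, hT, hcount⟩ := h
  let lab : Fin n → ZMod (2 * n + 1) := fun i => ((i + 1 : ℕ) : ZMod (2 * n + 1))
  have hself : (2 * (n : ZMod (2 * n + 1)) + 1) = 0 := by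
    have := ZMod.natCast_self (2 * n + 1)
    push_cast at this
    exact this
  have hlab : ∀ i, lab i ≠ 0 := by
    intro i
    rw [Ne, ZMod.natCast_eq_zero_iff]
    intro hdvd
    have := Nat.le_of_dvd (by omega) hdvd
    omega
  have htwo : ∀ z : ZMod (2 * n + 1), -2 * z = 0 → z = 0 := by
    intro z hz
    linear_combination z * hself + n * hz
  refine ⟨κ × Fin n, inferInstance, fun s => ⟨(T s.1).1, (T s.1).2.1, (T s.1).2.2,
    lab s.2, lab s.2, -2 * lab s.2⟩, ⟨fun s => hT.ne s.1, fun s => ⟨hlab _, hlab _,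
    fun h => hlab _ (htwo _ h)⟩, fun s => by ring, ?_⟩, ?_⟩
  · intro x y d hxy hd
    rcases hT.pairMatched x y hxy with ⟨⟨k, hk⟩, ⟨l, hl⟩⟩ | ⟨⟨k, hk⟩, ⟨l, hl⟩⟩
    · obtain ⟨i, rfl | rfl⟩ := ZMod.exists_eq_or_eq_neg_of_ne_zero hd
      · refine ⟨(k, i), Or.inl ?_⟩
        rcases hk with hk | hk
        · exact Or.inl ⟨hk.1, hk.2, rfl⟩
        · exact Or.inr (Or.inl ⟨hk.1, hk.2, rfl⟩)
      · refine ⟨(l, i), Or.inr ?_⟩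
        rw [neg_neg]
        rcases hl with hl | hl
        · exact Or.inl ⟨hl.1, hl.2, rfl⟩
        · exact Or.inr (Or.inl ⟨hl.1, hl.2, rfl⟩)
    · have hd' : (n : ZMod (2 * n + 1)) * d ≠ 0 := by
        intro h0
        apply hd
        linear_combination d * hself - 2 * h0
      obtain ⟨i, hi | hi⟩ := ZMod.exists_eq_or_eq_neg_of_ne_zero hd'
      · refine ⟨(k, i), Or.inl (Or.inr (Or.inr ⟨hk.1, hk.2, ?_⟩))⟩
        change -2 * lab i = d
        change _ = lab i at hi
        linear_combination d * hself * (-1) + 2 * hi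
      · refine ⟨(l, i), Or.inr (Or.inr (Or.inr ⟨hl.1, hl.2, ?_⟩))⟩
        change -2 * lab i = -d
        change _ = -lab i at hi
        linear_combination d * hself - 2 * hi
  · have hcard : Nat.card {d : ZMod (2 * n + 1) // d ≠ 0} = 2 * n := by
      rw [Nat.card_eq_fintype_card, Fintype.card_subtype_compl, Fintype.card_subtype_eq, ZMod.card]
      simp
    rw [Fintype.card_prod, Fintype.card_fin, hcard]
    nlinarith [Nat.mul_le_mul_right (2 * n) hcount]

/-- There is an idempotent quasigroup of order `k`. -/
def HasIdempotentQuasigroup (k : ℕ) : Prop :=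
  ∃ (Q : Type) (_ : Fintype Q) (_ : DecidableEq Q) (op : Q → Q → Q), Fintype.card Q = k ∧
    (∀ x, op x x = x) ∧ (∀ y z, ∃ x, op x y = z) ∧ (∀ x z, ∃ y, op x y = z)

theorem ZMod.exists_two_mul_eq_one {n : ℕ} (hn : Odd n) : ∃ h : ZMod n, 2 * h = 1 := by
  obtain ⟨m, rfl⟩ := hn
  refine ⟨m + 1, ?_⟩
  have := ZMod.natCast_self (2 * m + 1)
  push_cast at this
  linear_combination this

theorem hasIdempotentQuasigroup_of_odd {k : ℕ} (hk : Odd k) : HasIdempotentQuasigroup k := by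
  have : NeZero k := ⟨hk.pos.ne'⟩
  obtain ⟨h, hh⟩ := ZMod.exists_two_mul_eq_one hk
  refine ⟨ZMod k, inferInstance, inferInstance, fun x y => (x + y) * h, ZMod.card k, ?_, ?_, ?_⟩
  · intro x
    linear_combination x * hh
  · intro y z
    exact ⟨2 * z - y, by linear_combination z * hh⟩
  · intro x z
    exact ⟨2 * z - x, by linear_combination z * hh⟩

theorem hasIdempotentQuasigroup_of_odd_of_three_le {n : ℕ} (hn : Odd n) (h3 : 3 ≤ n) :
    HasIdempotentQuasigroup (n + 1) := by
  have : NeZero n := ⟨hn.pos.ne'⟩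
  obtain ⟨h, hh⟩ := ZMod.exists_two_mul_eq_one hn
  have htwo : (2 : ZMod n) ≠ 0 := by
    intro h2
    have h2' : ((2 : ℕ) : ZMod n) = 0 := by exact_mod_cast h2
    rw [ZMod.natCast_eq_zero_iff] at h2'
    have := Nat.le_of_dvd (by omega) h2'
    omega
  let op : Option (ZMod n) → Option (ZMod n) → Option (ZMod n)
    | some x, some y => if y = x + 2 then none else some ((x + y) * h)
    | some x, none => some (x + 1)
    | none, some y => some (y - 1)
    | none, none => none
  refine ⟨Option (ZMod n), inferInstance, inferInstance, op, by simp, ?_, ?_, ?_⟩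
  · rintro (_ | x)
    · rfl
    · have : x ≠ x + 2 := by simpa using htwo
      simp only [op, if_neg this, Option.some.injEq]
      linear_combination x * hh
  · rintro (_ | y) (_ | z)
    · exact ⟨none, rfl⟩
    · exact ⟨some (z - 1), by simp [op]⟩
    · exact ⟨some (y - 2), by simp [op]⟩
    · by_cases hyz : y = z + 1
      · exact ⟨none, by simp [op, hyz]⟩
      · refine ⟨some (2 * z - y), ?_⟩
        have : y ≠ 2 * z - y + 2 := fun he => hyz (by linear_combination h * he - (y - z - 1) * hh)
        simp only [op, if_neg this, Option.some.injEq]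
        linear_combination z * hh
  · rintro (_ | x) (_ | z)
    · exact ⟨none, rfl⟩
    · exact ⟨some (z + 1), by simp [op]⟩
    · exact ⟨some (x + 2), by simp [op]⟩
    · by_cases hxz : z = x + 1
      · exact ⟨none, by simp [op, hxz]⟩
      · refine ⟨some (2 * z - x), ?_⟩
        have : 2 * z - x ≠ x + 2 := fun he => hxz (by linear_combination h * he - (z - x - 1) * hh)
        simp only [op, if_neg this, Option.some.injEq]
        linear_combination z * hh

theorem hasIdempotentQuasigroup {k : ℕ} (h0 : k ≠ 0) (h2 : k ≠ 2) : HasIdempotentQuasigroup k := by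
  rcases Nat.even_or_odd k with hk | hk
  · obtain ⟨m, rfl⟩ := hk
    obtain ⟨n, hn⟩ : ∃ n, m + m = n + 1 := ⟨m + m - 1, by omega⟩
    rw [hn]
    exact hasIdempotentQuasigroup_of_odd_of_three_le (by rw [Nat.odd_iff]; omega) (by omega)
  · exact hasIdempotentQuasigroup_of_odd hk

/-- A system of triples on `ZMod 3` together with a point at infinity. -/
def quadTriples : Fin 4 → Option (ZMod 3) × Option (ZMod 3) × Option (ZMod 3) :=
  ![(some 1, some 2, some 0), (some 0, none, some 1), (none, some 0, some 2),
    (some 2, some 1, none)]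

theorem isMatchedTripleSystem_quadTriples : IsMatchedTripleSystem quadTriples :=
  ⟨by decide, by decide⟩

/-- A system of triples on `ZMod 3`. -/
def pairTriples : Fin 2 → ZMod 3 × ZMod 3 × ZMod 3 := ![(0, 1, 2), (2, 1, 0)]

theorem isMatchedTripleSystem_pairTriples : IsMatchedTripleSystem pairTriples :=
  ⟨by decide, by decide⟩

/-- The triples `((x, i), (op x y, i + 1), (y, i))` for distinct `x` and `y`. -/
def boseTriple {Q : Type} (op : Q → Q → Q) (s : {p : Q × Q // p.1 ≠ p.2} × ZMod 3) :
    (Q × ZMod 3) × (Q × ZMod 3) × (Q × ZMod 3) :=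
  ((s.1.1.1, s.2), (op s.1.1.1 s.1.1.2, s.2 + 1), (s.1.1.2, s.2))

theorem boseTriple_ne {Q : Type} (op : Q → Q → Q) (s : {p : Q × Q // p.1 ≠ p.2} × ZMod 3) :
    (boseTriple op s).1 ≠ (boseTriple op s).2.1 ∧
      (boseTriple op s).2.1 ≠ (boseTriple op s).2.2 ∧
      (boseTriple op s).2.2 ≠ (boseTriple op s).1 := by
  obtain ⟨⟨⟨x, y⟩, h⟩, i⟩ := s
  simp only [boseTriple, ne_eq, Prod.mk.injEq, not_and]
  refine ⟨fun _ => ?_, fun _ => ?_, fun h' => absurd h'.symm h⟩ <;> revert i <;> decide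

theorem pairMatched_boseTriple {Q : Type} {op : Q → Q → Q} (hid : ∀ x, op x x = x)
    (hl : ∀ y z, ∃ x, op x y = z) (hr : ∀ x z, ∃ y, op x y = z) {x y : Q} (hxy : x ≠ y)
    (i j : ZMod 3) : PairMatched (boseTriple op) (x, i) (y, j) := by
  have up : ∀ (x y : Q) (i : ZMod 3), x ≠ y →
      (∃ k, (boseTriple op k).1 = (x, i) ∧ (boseTriple op k).2.1 = (y, i + 1)) ∧
      (∃ k, (boseTriple op k).2.1 = (y, i + 1) ∧ (boseTriple op k).2.2 = (x, i)) := by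
    intro x y i hxy
    obtain ⟨w, hw⟩ := hr x y
    obtain ⟨v, hv⟩ := hl x y
    refine ⟨⟨⟨⟨(x, w), ?_⟩, i⟩, rfl, by rw [boseTriple, hw]⟩,
      ⟨⟨⟨(v, x), ?_⟩, i⟩, by rw [boseTriple, hv], rfl⟩⟩
    · intro (h : x = w)
      exact hxy ((hid x).symm.trans ((congrArg (op x) h).trans hw))
    · intro (h : v = x)
      subst h
      exact hxy ((hid v).symm.trans hv)
  have hij : j = i ∨ j = i + 1 ∨ i = j + 1 := by
    revert i j
    decide
  rcases hij with rfl | rfl | rfl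
  · exact Or.inr ⟨⟨⟨⟨(y, x), hxy.symm⟩, j⟩, rfl, rfl⟩, ⟨⟨⟨(x, y), hxy⟩, j⟩, rfl, rfl⟩⟩
  · obtain ⟨⟨k, hk⟩, ⟨l, hl⟩⟩ := up x y i hxy
    exact Or.inl ⟨⟨k, Or.inl hk⟩, ⟨l, Or.inr hl⟩⟩
  · obtain ⟨⟨k, hk⟩, ⟨l, hl⟩⟩ := up y x j hxy.symm
    exact Or.inl ⟨⟨l, Or.inr hl⟩, ⟨k, Or.inl hk⟩⟩

theorem card_ne_pairs (Q : Type) [Fintype Q] [DecidableEq Q] :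
    Fintype.card {p : Q × Q // p.1 ≠ p.2} = Fintype.card Q * (Fintype.card Q - 1) := by
  rw [Fintype.card_subtype, Nat.mul_sub, mul_one, ← card_univ, ← offDiag_card]
  congr 1
  ext p
  simp

theorem exists_hasMatchedTripleSystem_three_mul {k : ℕ} (h0 : k ≠ 0) (h2 : k ≠ 2) :
    ∃ (V : Type) (_ : Fintype V), Fintype.card V = 3 * k ∧ HasMatchedTripleSystem V := by
  obtain ⟨Q, _, _, op, hQ, hid, hl, hr⟩ := hasIdempotentQuasigroup h0 h2
  let T : ({p : Q × Q // p.1 ≠ p.2} × ZMod 3) ⊕ (Q × Fin 2) →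
      (Q × ZMod 3) × (Q × ZMod 3) × (Q × ZMod 3) :=
    Sum.elim (boseTriple op) fun s =>
      ((s.1, (pairTriples s.2).1), (s.1, (pairTriples s.2).2.1), (s.1, (pairTriples s.2).2.2))
  refine ⟨Q × ZMod 3, inferInstance, by simp [hQ, ZMod.card, mul_comm], _, inferInstance, T,
    ⟨?_, ?_⟩, ?_⟩
  · rintro (s | ⟨x, s⟩)
    · exact boseTriple_ne op s
    · have := isMatchedTripleSystem_pairTriples.ne s
      simpa [T] using this
  · rintro ⟨x, i⟩ ⟨y, j⟩ hxy
    by_cases h : x = y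
    · subst h
      have hij : i ≠ j := fun h => hxy (by rw [h])
      exact (isMatchedTripleSystem_pairTriples.pairMatched i j hij).map (fun i => (x, i))
        fun k => ⟨Sum.inr (x, k), rfl⟩
    · exact (pairMatched_boseTriple hid hl hr h i j).map id fun k => ⟨Sum.inl k, rfl⟩
  · obtain ⟨n, rfl⟩ := Nat.exists_eq_succ_of_ne_zero h0
    have h3 : (n + 1) * 3 - 1 = 3 * n + 2 := by omega
    simp only [Fintype.card_sum, Fintype.card_prod, card_ne_pairs, ZMod.card, Fintype.card_fin, hQ,
      Nat.succ_eq_add_one, Nat.add_sub_cancel, h3]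
    nlinarith

theorem exists_hasMatchedTripleSystem_three_mul_add_one {k : ℕ} (h0 : k ≠ 0) (h2 : k ≠ 2) :
    ∃ (V : Type) (_ : Fintype V), Fintype.card V = 3 * k + 1 ∧ HasMatchedTripleSystem V := by
  obtain ⟨Q, _, _, op, hQ, hid, hl, hr⟩ := hasIdempotentQuasigroup h0 h2
  let f : Q → Option (ZMod 3) → Option (Q × ZMod 3) := fun x => Option.map fun i => (x, i)
  have hf : ∀ x, Function.Injective (f x) := fun x =>
    Option.map_injective fun i j h => (Prod.mk.inj h).2
  let T : ({p : Q × Q // p.1 ≠ p.2} × ZMod 3) ⊕ (Q × Fin 4) →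
      Option (Q × ZMod 3) × Option (Q × ZMod 3) × Option (Q × ZMod 3) :=
    Sum.elim
      (fun s => (some (boseTriple op s).1, some (boseTriple op s).2.1, some (boseTriple op s).2.2))
      fun s => (f s.1 (quadTriples s.2).1, f s.1 (quadTriples s.2).2.1, f s.1 (quadTriples s.2).2.2)
  have hquad : ∀ x i j, i ≠ j → PairMatched T (f x i) (f x j) := fun x i j hij =>
    (isMatchedTripleSystem_quadTriples.pairMatched i j hij).map (f x)
      fun k => ⟨Sum.inr (x, k), rfl⟩
  refine ⟨Option (Q × ZMod 3), inferInstance, by simp [hQ, ZMod.card, mul_comm], _, inferInstance,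
    T, ⟨?_, ?_⟩, ?_⟩
  · rintro (s | ⟨x, s⟩)
    · have := boseTriple_ne op s
      simpa [T] using this
    · have := isMatchedTripleSystem_quadTriples.ne s
      simpa only [T, Sum.elim_inr, ne_eq, (hf x).eq_iff] using this
  · rintro (_ | ⟨x, i⟩) (_ | ⟨y, j⟩) hxy
    · exact absurd rfl hxy
    · exact hquad y none (some j) (by simp)
    · exact hquad x (some i) none (by simp)
    · by_cases h : x = y
      · subst h
        exact hquad x (some i) (some j) fun h => hxy (by simpa using h)
      · exact (pairMatched_boseTriple hid hl hr h i j).map some fun k => ⟨Sum.inl k, rfl⟩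
  · obtain ⟨n, rfl⟩ := Nat.exists_eq_succ_of_ne_zero h0
    simp only [Fintype.card_sum, Fintype.card_prod, card_ne_pairs, ZMod.card, Fintype.card_fin, hQ,
      Nat.succ_eq_add_one, Nat.add_sub_cancel, Fintype.card_option]
    nlinarith

theorem hasMatchedTripleSystem_zmod_seven : HasMatchedTripleSystem (ZMod 7) := by
  refine ⟨ZMod 7 × Bool, inferInstance, fun s =>
    if s.2 then (s.1, s.1 + 1, s.1 + 3) else (s.1 + 3, s.1 + 1, s.1), ⟨by decide, by decide⟩, ?_⟩
  simp [ZMod.card]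

theorem exists_hasMatchedTripleSystem {u : ℕ} (hu3 : 3 ≤ u) (humod : u % 3 = 0 ∨ u % 3 = 1)
    (h6 : u ≠ 6) :
    ∃ (V : Type) (_ : Fintype V), Fintype.card V = u ∧ HasMatchedTripleSystem V := by
  have hdiv := Nat.div_add_mod u 3
  rcases humod with h | h
  · rw [h] at hdiv
    have := exists_hasMatchedTripleSystem_three_mul (k := u / 3) (by omega) (by omega)
    rwa [show 3 * (u / 3) = u by omega] at this
  · by_cases h7 : u = 7
    · subst h7
      exact ⟨ZMod 7, inferInstance, ZMod.card 7, hasMatchedTripleSystem_zmod_seven⟩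
    · have := exists_hasMatchedTripleSystem_three_mul_add_one (k := u / 3) (by omega) (by omega)
      rwa [show 3 * (u / 3) + 1 = u by omega] at this

theorem exists_isCyclicHGDD_of_hasDifferenceFamily_zmod {V : Type} [Fintype V] {u g t : ℕ}
    [NeZero g] [NeZero t] (h : HasDifferenceFamily V (ZMod t) (· ≠ 0)) (hV : Fintype.card V = u) :
    ∃ ℬ : Finset (Finset (Fin u × Fin g × ZMod t)), IsCyclicHGDD u g t ℬ :=
  exists_isCyclicHGDD_of_hasDifferenceFamily (J := PUnit) (G := ZMod g) h
    (AddEquiv.uniqueProd).symm (fun _ => Iff.rfl) hV (by simp [ZMod.card])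

theorem exists_isCyclicHGDD_of_ne_six {u g t : ℕ} [NeZero g] (hu3 : 3 ≤ u)
    (humod : u % 3 = 0 ∨ u % 3 = 1) (ht : Odd t) (h6 : u ≠ 6) :
    ∃ ℬ : Finset (Finset (Fin u × Fin g × ZMod t)), IsCyclicHGDD u g t ℬ := by
  obtain ⟨n, rfl⟩ := ht
  obtain ⟨V, _, hV, h⟩ := exists_hasMatchedTripleSystem hu3 humod h6
  exact exists_isCyclicHGDD_of_hasDifferenceFamily_zmod (h.hasDifferenceFamily n) hV

/-- Develop labelled triangles on `ZMod 5` with a point at infinity modulo 5. -/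
def shiftTriangles {A : Type} {n : ℕ} (T : Fin n → LabelledTriangle (Option (ZMod 5)) A)
    (s : Fin n × ZMod 5) : LabelledTriangle (Option (ZMod 5)) A :=
  ⟨(T s.1).a.map (· + s.2), (T s.1).b.map (· + s.2), (T s.1).c.map (· + s.2),
    (T s.1).p, (T s.1).q, (T s.1).r⟩

theorem hasDifferenceFamily_of_shiftTriangles {A : Type} [AddCommGroup A] {n : ℕ} {D : A → Prop}
    (T : Fin n → LabelledTriangle (Option (ZMod 5)) A) (h : IsDifferenceFamily D (shiftTriangles T))
    (hn : n = Nat.card {d // D d}) : HasDifferenceFamily (Option (ZMod 5)) A D := by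
  refine ⟨_, inferInstance, _, h, ?_⟩
  simp only [Fintype.card_prod, Fintype.card_fin, ZMod.card, Fintype.card_option]
  omega

theorem hasDifferenceFamily_zmod_nine :
    HasDifferenceFamily (Option (ZMod 5)) (ZMod 9) (· ≠ 0) := by
  refine hasDifferenceFamily_of_shiftTriangles ![
    ⟨some 0, some 1, none, 1, 4, 4⟩, ⟨some 0, some 2, none, 3, 7, 8⟩,
    ⟨some 0, some 1, some 2, 7, 8, 3⟩, ⟨some 0, some 1, some 2, 2, 3, 4⟩,
    ⟨some 0, some 2, none, 7, 8, 3⟩, ⟨some 0, some 1, some 2, 5, 6, 7⟩,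
    ⟨some 0, some 1, some 3, 4, 1, 4⟩, ⟨some 0, some 2, none, 8, 3, 7⟩]
    ⟨by decide, by decide, by decide, by decide +kernel⟩ ?_
  rw [Nat.card_eq_fintype_card]
  decide

set_option synthInstance.maxSize 2000 in
theorem hasDifferenceFamily_zmod_two_prod_zmod_three :
    HasDifferenceFamily (Option (ZMod 5)) (ZMod 2 × ZMod 3) (·.2 ≠ 0) := by
  refine hasDifferenceFamily_of_shiftTriangles ![
    ⟨some 0, some 1, some 2, (0, 2), (1, 2), (1, 2)⟩,
    ⟨some 0, some 2, none, (0, 2), (1, 2), (1, 2)⟩,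
    ⟨some 0, some 1, some 2, (1, 1), (0, 1), (1, 1)⟩,
    ⟨some 0, some 2, none, (0, 1), (0, 1), (0, 1)⟩]
    ⟨by decide, by decide, by decide, by decide +kernel⟩ ?_
  rw [Nat.card_eq_fintype_card]
  decide

set_option synthInstance.maxSize 2000 in
theorem hasDifferenceFamily_zmod_three_prod_zmod_three :
    HasDifferenceFamily (Option (ZMod 5)) (ZMod 3 × ZMod 3) (·.2 ≠ 0) := by
  refine hasDifferenceFamily_of_shiftTriangles ![
    ⟨some 0, some 1, some 2, (0, 1), (2, 1), (1, 1)⟩,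
    ⟨some 0, some 1, none, (1, 1), (1, 1), (1, 1)⟩,
    ⟨some 0, some 2, none, (0, 1), (0, 1), (0, 1)⟩,
    ⟨some 0, some 1, some 3, (2, 2), (0, 2), (1, 2)⟩,
    ⟨some 0, some 1, some 2, (0, 2), (1, 2), (2, 2)⟩,
    ⟨some 0, some 2, none, (2, 1), (2, 1), (2, 1)⟩]
    ⟨by decide, by decide, by decide, by decide +kernel⟩ ?_
  rw [Nat.card_eq_fintype_card]
  decide

/-- Closed walks `a → b → c → a` on six points, together with one of three rules for the labels of
their arcs. -/
abbrev RuledWalk := Fin 3 × Fin 6 × Fin 6 × Fin 6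

/-- The end points of an arc of a walk. -/
def RuledWalk.arc (T : RuledWalk) : Fin 3 → Fin 6 × Fin 6 :=
  ![(T.2.1, T.2.2.1), (T.2.2.1, T.2.2.2), (T.2.2.2, T.2.1)]

/-- The arc `u → v` occurs at position `i` of a walk with rule `r`. -/
def Occurs (T : Fin 10 → RuledWalk) (r i : Fin 3) (u v : Fin 6) : Prop :=
  ∃ k, (T k).1 = r ∧ (T k).arc i = (u, v)

instance (T : Fin 10 → RuledWalk) (r i : Fin 3) (u v : Fin 6) : Decidable (Occurs T r i u v) := by
  unfold Occurs; infer_instance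

/-- Rotate the points `0`, `1`, `2`. -/
def rotate (i : Fin 3) : Fin 6 → Fin 6 := ![
  ![0, 1, 2, 3, 4, 5], ![1, 2, 0, 3, 4, 5], ![2, 0, 1, 3, 4, 5]] i

/-- The arcs between consecutive levels of a chain `d, 2 * d, 4 * d, …` come in three symmetric
sets, and those of the other two sets are the rotated ones of the first. -/
def Linked (i : Fin 3) (u v : Fin 6) : Prop :=
  s(u, v) ∈ [s(0, 1), s(0, 2), s(0, 3), s(1, 2), s(4, 5)].map (Sym2.map (rotate i))

instance (i : Fin 3) (u v : Fin 6) : Decidable (Linked i u v) := by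
  unfold Linked; infer_instance

/-- Walks whose closing arcs are linked by `j` and whose other arcs are not linked by `i`. -/
def regularWalks (i j : Fin 3) (k : Fin 10) : RuledWalk :=
  let T : RuledWalk := if j = i + 1 then ![
    (0, 1, 3, 2), (0, 2, 3, 1), (0, 1, 5, 0), (0, 4, 2, 5), (0, 3, 5, 1),
    (0, 1, 4, 3), (0, 2, 4, 0), (0, 0, 5, 2), (0, 0, 4, 1), (0, 5, 3, 4)] k else ![
    (0, 1, 3, 2), (0, 2, 3, 1), (0, 4, 1, 5), (0, 1, 4, 0), (0, 3, 5, 2),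
    (0, 0, 4, 2), (0, 0, 5, 1), (0, 2, 5, 0), (0, 2, 4, 3), (0, 5, 3, 4)] k
  (T.1, rotate i T.2.1, rotate i T.2.2.1, rotate i T.2.2.2)

/-- The walks for the level of order three. -/
def torsionWalks : Fin 10 → RuledWalk := ![
    (0, 0, 1, 4), (0, 0, 2, 5), (0, 3, 1, 5), (0, 3, 2, 4), (0, 4, 1, 0),
    (0, 5, 2, 0), (0, 5, 1, 3), (0, 4, 2, 3), (2, 3, 0, 1), (2, 0, 3, 2)]

/-- The walks for the first of the two levels joined to the level of order three. -/
def leftWalks : Fin 10 → RuledWalk := ![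
    (0, 0, 4, 2), (0, 3, 4, 0), (0, 0, 5, 1), (0, 1, 3, 5), (0, 2, 3, 1),
    (0, 4, 1, 5), (0, 5, 3, 2), (0, 5, 2, 4), (1, 4, 5, 0), (1, 5, 4, 3)]

/-- The walks for the level following the one of `leftWalks`. -/
def leftDoubleWalks : Fin 3 → Fin 10 → RuledWalk := ![
  ![(0, 1, 3, 0), (0, 2, 4, 0), (0, 3, 5, 0), (0, 4, 1, 5), (0, 1, 4, 2),
    (0, 0, 5, 2), (0, 0, 4, 3), (0, 2, 3, 1), (0, 0, 2, 1), (0, 5, 3, 4)],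
  ![(0, 4, 3, 5), (0, 1, 5, 3), (0, 1, 4, 2), (0, 1, 3, 0), (0, 2, 3, 1),
    (0, 2, 4, 0), (0, 0, 5, 2), (0, 5, 0, 4), (0, 0, 2, 1), (0, 3, 4, 1)],
  ![(0, 5, 3, 4), (0, 1, 5, 0), (0, 1, 4, 2), (0, 2, 1, 3), (0, 0, 4, 1),
    (0, 4, 3, 5), (0, 0, 5, 2), (0, 2, 4, 0), (0, 3, 0, 2), (0, 2, 3, 1)]]

/-- The walks for the second of the two levels joined to the level of order three. -/
def rightWalks : Fin 10 → RuledWalk := ![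
    (0, 2, 5, 0), (0, 1, 4, 0), (0, 0, 5, 3), (0, 1, 3, 4), (0, 2, 3, 1),
    (0, 4, 1, 5), (0, 5, 2, 4), (0, 4, 3, 2), (1, 1, 2, 5), (1, 2, 1, 4)]

/-- The walks for the level following the one of `rightWalks`. -/
def rightDoubleWalks : Fin 3 → Fin 10 → RuledWalk := ![
  ![(0, 0, 3, 2), (0, 1, 5, 2), (0, 1, 4, 0), (0, 4, 2, 5), (0, 3, 5, 0),
    (0, 2, 1, 0), (0, 2, 3, 1), (0, 0, 4, 3), (0, 0, 5, 1), (0, 5, 3, 4)],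
  ![(0, 2, 3, 1), (0, 0, 5, 1), (0, 4, 3, 5), (0, 2, 5, 0), (0, 1, 4, 0),
    (0, 0, 4, 2), (0, 1, 0, 3), (0, 1, 5, 2), (0, 3, 2, 1), (0, 5, 3, 4)],
  ![(0, 0, 3, 2), (0, 2, 1, 0), (0, 2, 3, 1), (0, 5, 0, 4), (0, 1, 5, 2),
    (0, 1, 4, 0), (0, 4, 3, 5), (0, 2, 5, 3), (0, 3, 4, 2), (0, 0, 5, 1)]]

/-- Consecutive points of a walk are distinct. -/
def RuledWalk.IsProper (T : RuledWalk) : Prop :=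
  T.2.1 ≠ T.2.2.1 ∧ T.2.2.1 ≠ T.2.2.2 ∧ T.2.2.2 ≠ T.2.1

instance (T : RuledWalk) : Decidable T.IsProper := by unfold RuledWalk.IsProper; infer_instance

theorem Linked.symm {i : Fin 3} {u v : Fin 6} (h : Linked i u v) : Linked i v u := by
  rwa [Linked, Sym2.eq_swap (a := v)]

theorem isProper_regularWalks : ∀ i j k, (regularWalks i j k).IsProper := by decide +kernel

theorem isProper_torsionWalks : ∀ k, (torsionWalks k).IsProper := by decide

theorem isProper_leftWalks : ∀ k, (leftWalks k).IsProper := by decide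

theorem isProper_rightWalks : ∀ k, (rightWalks k).IsProper := by decide

theorem isProper_leftDoubleWalks : ∀ j k, (leftDoubleWalks j k).IsProper := by decide

theorem isProper_rightDoubleWalks : ∀ j k, (rightDoubleWalks j k).IsProper := by decide

theorem regularWalks_covers : ∀ i j, i ≠ j → ∀ u v, u ≠ v → Linked i u v ∨
    Occurs (regularWalks i j) 0 0 u v ∨ Occurs (regularWalks i j) 0 1 u v := by decide +kernel

theorem regularWalks_closes : ∀ i j, i ≠ j → ∀ u v, Linked j u v →
    Occurs (regularWalks i j) 0 2 u v := by decide +kernel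

theorem leftWalks_covers : ∀ u v, u ≠ v → Linked 0 u v ∨ Occurs leftWalks 0 0 u v ∨
    Occurs leftWalks 0 1 u v ∨ Occurs leftWalks 1 1 u v ∨ Occurs rightWalks 1 1 u v := by
  decide +kernel

theorem rightWalks_covers : ∀ u v, u ≠ v → Linked 0 u v ∨ Occurs rightWalks 0 0 u v ∨
    Occurs rightWalks 0 1 u v ∨ Occurs leftWalks 1 2 u v ∨ Occurs rightWalks 1 2 u v := by
  decide +kernel

theorem leftDoubleWalks_covers : ∀ j u v, u ≠ v → Occurs leftWalks 0 2 u v ∨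
    Occurs torsionWalks 2 1 u v ∨ Occurs (leftDoubleWalks j) 0 0 u v ∨
    Occurs (leftDoubleWalks j) 0 1 u v := by decide +kernel

theorem rightDoubleWalks_covers : ∀ j u v, u ≠ v → Occurs rightWalks 0 2 u v ∨
    Occurs torsionWalks 2 2 u v ∨ Occurs (rightDoubleWalks j) 0 0 u v ∨
    Occurs (rightDoubleWalks j) 0 1 u v := by decide +kernel

theorem leftDoubleWalks_closes : ∀ j u v, Linked j u v → Occurs (leftDoubleWalks j) 0 2 u v := by
  decide +kernel

theorem rightDoubleWalks_closes : ∀ j u v, Linked j u v → Occurs (rightDoubleWalks j) 0 2 u v := by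
  decide +kernel

theorem torsionWalks_covers : ∀ u v, u ≠ v → Occurs torsionWalks 0 0 u v ∨
    Occurs torsionWalks 0 1 u v ∨ Occurs torsionWalks 0 2 u v ∨ Occurs torsionWalks 2 0 u v ∨
    Occurs leftWalks 1 0 u v ∨ Occurs rightWalks 1 0 u v := by decide +kernel

theorem regularWalks_rule : ∀ i j k, (regularWalks i j k).1 = 0 := by decide +kernel

/-- The labels of a walk with rule `0`, `1` or `2` on the level `d`. -/
def ruleLabels {A : Type} [CommRing A] (ω x y d : A) : Fin 3 → Fin 3 → A :=
  ![![d, d, -2 * d], ![ω, x, y], ![ω, -2 * x, -2 * y]]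

/-- The labelled triangle of a walk on the level `d`. -/
def RuledWalk.triangle {A : Type} [CommRing A] (ω x y d : A) (T : RuledWalk) :
    LabelledTriangle (Fin 6) A :=
  ⟨T.2.1, T.2.2.1, T.2.2.2, ruleLabels ω x y d T.1 0, ruleLabels ω x y d T.1 1,
    ruleLabels ω x y d T.1 2⟩

theorem Occurs.exists_hasArc {A : Type} [CommRing A] {T : Fin 10 → RuledWalk} {r i : Fin 3}
    {u v : Fin 6} (h : Occurs T r i u v) (ω x y d : A) :
    ∃ k, ((T k).triangle ω x y d).HasArc u v (ruleLabels ω x y d r i) := by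
  obtain ⟨k, rfl, h⟩ := h
  refine ⟨k, ?_⟩
  fin_cases i
  · exact Or.inl ⟨congrArg Prod.fst h, congrArg Prod.snd h, rfl⟩
  · exact Or.inr (Or.inl ⟨congrArg Prod.fst h, congrArg Prod.snd h, rfl⟩)
  · exact Or.inr (Or.inr ⟨congrArg Prod.fst h, congrArg Prod.snd h, rfl⟩)

/-- The walks `W` contain the arc `u → v` with label `d`, or the reversed arc with label `-d`, on
a level satisfying `D` and `s`. -/
def WalksCover {A : Type} [CommRing A] (D s : A → Prop) (ω x y : A) (W : A → Fin 10 → RuledWalk)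
    (u v : Fin 6) (d : A) : Prop :=
  ∃ e r i, D e ∧ s e ∧ ((Occurs (W e) r i u v ∧ ruleLabels ω x y e r i = d) ∨
    (Occurs (W e) r i v u ∧ ruleLabels ω x y e r i = -d))

theorem two_mul_card_le_of_not_neg {A : Type} [AddCommGroup A] [Finite A] {D s : A → Prop}
    (hneg : ∀ d, D d → D (-d)) (hs : ∀ d, D d → s d → ¬ s (-d)) :
    2 * Nat.card {d // D d ∧ s d} ≤ Nat.card {d // D d} := by
  have : 2 * Nat.card {d // D d ∧ s d} = Nat.card ({d // D d ∧ s d} ⊕ {d // D d ∧ s d}) := by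
    rw [Nat.card_sum, two_mul]
  rw [this]
  refine Nat.card_le_card_of_injective
    (Sum.elim (fun d => ⟨d.1, d.2.1⟩) fun d => ⟨-d.1, hneg _ d.2.1⟩) ?_
  rintro (⟨a, ha⟩ | ⟨a, ha⟩) (⟨b, hb⟩ | ⟨b, hb⟩) h <;>
    simp only [Sum.elim_inl, Sum.elim_inr, Subtype.mk.injEq, neg_inj] at h <;> subst h
  · rfl
  · exact absurd ha.2 (hs b hb.1 hb.2)
  · exact absurd hb.2 (hs a ha.1 ha.2)
  · rfl

theorem hasDifferenceFamily_of_walks {A : Type} [CommRing A] [Finite A] {D s : A → Prop}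
    {ω x y : A} {W : A → Fin 10 → RuledWalk} (hsum : ω + x + y = 0) (hω : 3 * ω = 0)
    (hneg : ∀ d, D d → D (-d)) (htwo : ∀ d, D d → D (2 * d))
    (hs : ∀ d, D d → s d → ¬ s (-d)) (hs' : ∀ d, D d → s d ∨ s (-d))
    (hproper : ∀ d k, (W d k).IsProper)
    (hlabel : ∀ d k, (W d k).1 = 0 ∨ (D ω ∧ D x ∧ D y))
    (hcover : ∀ d, D d → s d → ∀ u v, u ≠ v → WalksCover D s ω x y W u v d) :
    HasDifferenceFamily (Fin 6) A D := by
  have : Fintype {d // D d ∧ s d} := Fintype.ofFinite _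
  have hneg_two : ∀ d, D d → D (-2 * d) := fun d hd => by
    rw [neg_mul]
    exact hneg _ (htwo d hd)
  refine ⟨{d // D d ∧ s d} × Fin 10, inferInstance,
    fun i => (W i.1 i.2).triangle ω x y i.1, ⟨fun i => hproper _ _, ?_, ?_, ?_⟩, ?_⟩
  · rintro ⟨⟨d, hd, -⟩, k⟩
    suffices ∀ i, D (ruleLabels ω x y d (W d k).1 i) from ⟨this 0, this 1, this 2⟩
    rcases hlabel d k with h | ⟨h1, h2, h3⟩
    · rw [h]
      exact Fin.forall_fin_succ.2 ⟨hd, Fin.forall_fin_two.2 ⟨hd, hneg_two d hd⟩⟩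
    · generalize (W d k).1 = r
      intro i
      fin_cases r <;> fin_cases i <;> first
        | exact hd
        | exact h1
        | exact h2
        | exact h3
        | exact hneg_two _ ‹_›
  · rintro ⟨⟨d, hd, -⟩, k⟩
    simp only [RuledWalk.triangle]
    generalize (W d k).1 = r
    fin_cases r
    · change d + d + -2 * d = 0
      ring
    · exact hsum
    · change ω + -2 * x + -2 * y = 0
      linear_combination hω - 2 * hsum
  · suffices ∀ d, D d → s d → ∀ u v, u ≠ v → ∃ i : {d // D d ∧ s d} × Fin 10,
        ((W i.1 i.2).triangle ω x y (i.1 : A)).Covers u v d by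
      intro u v d huv hd
      rcases hs' d hd with h | h
      · exact this d hd h u v huv
      · obtain ⟨i, hi⟩ := this (-d) (hneg d hd) h v u huv.symm
        exact ⟨i, by simpa using hi.reverse⟩
    intro d hd hsd u v huv
    obtain ⟨e, r, i, hDe, hse, ⟨h, hl⟩ | ⟨h, hl⟩⟩ := hcover d hd hsd u v huv
    · obtain ⟨k, hk⟩ := h.exists_hasArc ω x y e
      exact ⟨(⟨e, hDe, hse⟩, k), Or.inl (hl ▸ hk)⟩
    · obtain ⟨k, hk⟩ := h.exists_hasArc ω x y e
      exact ⟨(⟨e, hDe, hse⟩, k), Or.inr (hl ▸ hk)⟩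
  · have := two_mul_card_le_of_not_neg hneg hs
    rw [Nat.card_eq_fintype_card] at this
    simp only [Fintype.card_prod, Fintype.card_fin]
    omega

theorem exists_sign {A : Type} [AddCommGroup A] {P : A → Prop} (hP : ∀ d, P d → ¬ P (-d)) :
    ∃ s : A → Prop, (∀ d, P d → s d) ∧ (∀ d, d ≠ -d → s d → ¬ s (-d)) ∧
      ∀ d, d ≠ -d → s d ∨ s (-d) := by
  refine ⟨fun d => P d ∨ (¬ P (-d) ∧ WellOrderingRel d (-d)), fun d => Or.inl, ?_, ?_⟩
  · intro d hd h h'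
    rw [neg_neg] at h'
    rcases h with h | ⟨h, hr⟩
    · rcases h' with h' | ⟨h', -⟩
      · exact hP d h h'
      · exact h' h
    · rcases h' with h' | ⟨-, hr'⟩
      · exact h h'
      · exact asymm hr hr'
  · intro d hd
    dsimp only
    rw [neg_neg]
    rcases trichotomous_of WellOrderingRel d (-d) with h | h | h
    · tauto
    · exact absurd h hd
    · tauto

theorem exists_three_coloring {A : Type} [CommRing A] [Finite A] {hf : A} (hhf : 2 * hf = 1)
    {P : A → Prop} (hP : ∀ d, P d → P (-d)) (hP2 : ∀ d, P d → ¬ P (2 * d)) :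
    ∃ c : A → Fin 3, (∀ d, c (-d) = c d) ∧ (∀ d, P d → c d = 0) ∧
      ∀ d, 3 * d ≠ 0 → c d ≠ c (2 * d) := by
  classical
  have := Fintype.ofFinite A
  suffices ∀ S : Finset A, ∃ c : A → Fin 3, (∀ d, c (-d) = c d) ∧ (∀ d, P d → c d = 0) ∧
      ∀ d, (d ∈ S ∨ -d ∈ S ∨ P d) → (2 * d ∈ S ∨ -(2 * d) ∈ S ∨ P (2 * d)) → 3 * d ≠ 0 →
        c d ≠ c (2 * d) by
    obtain ⟨c, h1, h2, h3⟩ := this univ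
    exact ⟨c, h1, h2, fun d => h3 d (Or.inl (mem_univ _)) (Or.inl (mem_univ _))⟩
  intro S
  induction S using Finset.induction_on with
  | empty =>
    refine ⟨fun _ => 0, fun _ => rfl, fun _ _ => rfl, fun d h h' => ?_⟩
    simp only [notMem_empty, false_or] at h h'
    exact absurd h' (hP2 d h)
  | insert a S _ ih =>
    obtain ⟨c, h1, h2, h3⟩ := ih
    by_cases ha : a ∈ S ∨ -a ∈ S ∨ P a
    · have key : ∀ d, (d ∈ insert a S ∨ -d ∈ insert a S ∨ P d) → (d ∈ S ∨ -d ∈ S ∨ P d) := by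
        intro d h
        rw [mem_insert, mem_insert] at h
        rcases h with (rfl | h) | (h | h) | h
        · exact ha
        · exact Or.inl h
        · rw [← h, neg_neg] at ha
          rcases ha with ha | ha | ha
          · exact Or.inr (Or.inl ha)
          · exact Or.inl ha
          · exact Or.inr (Or.inr (by simpa using hP _ ha))
        · exact Or.inr (Or.inl h)
        · exact Or.inr (Or.inr h)
      exact ⟨c, h1, h2, fun d h h' => h3 d (key d h) (key _ h')⟩
    · obtain ⟨z, hz1, hz2⟩ : ∃ z, z ≠ c (2 * a) ∧ z ≠ c (hf * a) := by
        generalize c (2 * a) = p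
        generalize c (hf * a) = q
        revert p q
        decide
      have key : ∀ d, (d ∈ insert a S ∨ -d ∈ insert a S ∨ P d) → d ≠ a → d ≠ -a →
          (d ∈ S ∨ -d ∈ S ∨ P d) := by
        intro d h hd hd'
        rw [mem_insert, mem_insert] at h
        have : -d ≠ a := fun h => hd' (by rw [← h, neg_neg])
        tauto
      have hpm : ∀ d, d = a ∨ d = -a → c d = c a := by
        rintro d (rfl | rfl)
        · rfl
        · exact h1 _
      refine ⟨fun d => if d = a ∨ d = -a then z else c d, ?_, ?_, ?_⟩
      · intro d
        have : (-d = a ∨ -d = -a) ↔ (d = a ∨ d = -a) := by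
          rw [neg_inj, neg_eq_iff_eq_neg, or_comm]
        simp only [this, h1]
      · intro d hd
        have : ¬ (d = a ∨ d = -a) := by
          rintro (rfl | rfl)
          · exact ha (Or.inr (Or.inr hd))
          · exact ha (Or.inr (Or.inr (by simpa using hP _ hd)))
        simp only [if_neg this, h2 d hd]
      · intro d hd hd' hd3
        dsimp only
        by_cases h : d = a ∨ d = -a
        · have h' : ¬ (2 * d = a ∨ 2 * d = -a) := by
            rintro h'
            apply hd3
            rcases h with rfl | rfl <;> rcases h' with h' | h'
            · linear_combination 3 * h'
            · linear_combination h'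
            · linear_combination h'
            · linear_combination 3 * h'
          have hc : c (2 * d) = c (2 * a) := by
            rcases h with rfl | rfl
            · rfl
            · rw [mul_neg, h1]
          rw [if_pos h, if_neg h', hc]
          exact hz1
        · by_cases h' : 2 * d = a ∨ 2 * d = -a
          · have hc : c d = c (hf * a) := by
              rcases h' with h' | h'
              · congr 1
                linear_combination hf * h' - d * hhf
              · rw [← h1]
                congr 1
                linear_combination -hf * h' + d * hhf
            rw [if_neg h, if_pos h', hc]
            exact hz2.symm
          · rw [if_neg h, if_neg h']
            rw [not_or] at h h'
            exact h3 d (key d hd h.1 h.2) (key _ hd' h'.1 h'.2) hd3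

theorem walksCover_of_linked {A : Type} [CommRing A] {D s : A → Prop} {ω x y d e : A}
    {W : A → Fin 10 → RuledWalk} {j : Fin 3} {u v : Fin 6} (h : Linked j u v) (hDe : D e)
    (hse : s e) (he : 2 * e = d ∨ 2 * e = -d)
    (hW : ∀ u v, Linked j u v → Occurs (W e) 0 2 u v) : WalksCover D s ω x y W u v d := by
  rcases he with he | he
  · exact ⟨e, 0, 2, hDe, hse, Or.inr ⟨hW v u h.symm, by rw [← he]; exact neg_mul _ _⟩⟩
  · exact ⟨e, 0, 2, hDe, hse, Or.inl ⟨hW u v h, by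
      rw [← neg_neg d, ← he]; exact neg_mul _ _⟩⟩

theorem exists_half {A : Type} [CommRing A] {D s : A → Prop} {hf d : A} (hhf : 2 * hf = 1)
    (hneg : ∀ d, D d → D (-d)) (hhalf : ∀ d, D d → D (hf * d)) (hs' : ∀ d, D d → s d ∨ s (-d))
    (hd : D d) : ∃ e, D e ∧ s e ∧ (2 * e = d ∨ 2 * e = -d) := by
  rcases hs' _ (hhalf d hd) with h | h
  · exact ⟨_, hhalf d hd, h, Or.inl (by linear_combination d * hhf)⟩
  · exact ⟨_, hneg _ (hhalf d hd), h, Or.inr (by linear_combination -d * hhf)⟩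

theorem hasDifferenceFamily_of_three_mul_ne_zero {A : Type} [CommRing A] [Finite A]
    {D : A → Prop} {hf : A} (hhf : 2 * hf = 1) (hD0 : ¬ D 0) (hneg : ∀ d, D d → D (-d))
    (htwo : ∀ d, D d → D (2 * d)) (hhalf : ∀ d, D d → D (hf * d))
    (hthree : ∀ d, D d → 3 * d ≠ 0) : HasDifferenceFamily (Fin 6) A D := by
  obtain ⟨s, -, hs, hs'⟩ := exists_sign (A := A) (P := fun _ => False) fun _ h => h.elim
  obtain ⟨c, hc1, -, hc3⟩ :=
    exists_three_coloring (A := A) hhf (P := fun _ => False) (fun _ h => h) fun _ h => h.elim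
  have hne : ∀ d, D d → d ≠ -d := by
    intro d hd h
    have : d = 0 := by linear_combination hf * h - d * hhf
    exact hD0 (this ▸ hd)
  have hcd : ∀ d e, 2 * e = d ∨ 2 * e = -d → c (2 * e) = c d := by
    rintro d e (h | h)
    · rw [h]
    · rw [h, hc1]
  refine hasDifferenceFamily_of_walks (s := s) (ω := 0) (x := 0) (y := 0)
    (W := fun d => regularWalks (c d) (c (2 * d))) (by simp) (by simp) hneg htwo
    (fun d hd => hs d (hne d hd)) (fun d hd => hs' d (hne d hd))
    (fun d => isProper_regularWalks _ _) (fun d k => Or.inl (regularWalks_rule _ _ k)) ?_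
  intro d hd hsd u v huv
  rcases regularWalks_covers _ _ (hc3 d (hthree d hd)) u v huv with h | h | h
  · obtain ⟨e, hDe, hse, he⟩ := exists_half hhf hneg hhalf (fun d hd => hs' d (hne d hd)) hd
    refine walksCover_of_linked h hDe hse he ?_
    rw [← hcd d e he]
    exact regularWalks_closes _ _ (hc3 e (hthree e hDe))
  · exact ⟨d, 0, 0, hd, hsd, Or.inl ⟨h, rfl⟩⟩
  · exact ⟨d, 0, 1, hd, hsd, Or.inl ⟨h, rfl⟩⟩

theorem levels_not_neg {A : Type} [CommRing A] {ω y : A} (hω : 3 * ω = 0)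
    (h3 : (3 : A) ≠ 0) (h9 : (9 : A) ≠ 0) (h12 : (12 : A) ≠ 0) (hω0 : ω ≠ 0) (hy : y = -ω - 1)
    (d : A)
    (hd : d = ω ∨ d = 1 ∨ d = -2 ∨ d = y ∨ d = -2 * y) :
    ¬ (-d = ω ∨ -d = 1 ∨ -d = -2 ∨ -d = y ∨ -d = -2 * y) := by
  rcases hd with rfl | rfl | rfl | rfl | rfl <;> rintro (h | h | h | h | h) <;>
    first
    | grind
    | exact hω0 (by linear_combination hω + h)

theorem levels_independent {A : Type} [CommRing A] {ω y : A}
    (hω : 3 * ω = 0) (h9 : (9 : A) ≠ 0) (hy : y = -ω - 1) (d : A)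
    (hd : d = 1 ∨ d = -1 ∨ d = y ∨ d = -y) :
    ¬ (2 * d = 1 ∨ 2 * d = -1 ∨ 2 * d = y ∨ 2 * d = -y) := by
  rcases hd with rfl | rfl | rfl | rfl <;> rintro (h | h | h | h) <;> grind

theorem hasDifferenceFamily_of_three_torsion {A : Type} [CommRing A] [Finite A] {D : A → Prop}
    {hf ω : A} (hhf : 2 * hf = 1) (hω : 3 * ω = 0) (h9 : (9 : A) ≠ 0) (hD0 : ¬ D 0)
    (hneg : ∀ d, D d → D (-d)) (htwo : ∀ d, D d → D (2 * d)) (hhalf : ∀ d, D d → D (hf * d))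
    (hthree : ∀ d, D d → 3 * d = 0 → d = ω ∨ d = -ω) (hDω : D ω) (hD1 : D 1)
    (hDy : D (-ω - 1)) : HasDifferenceFamily (Fin 6) A D := by
  classical
  obtain ⟨y, hy⟩ : ∃ y : A, y = -ω - 1 := ⟨_, rfl⟩
  rw [← hy] at hDy
  have hω0 : ω ≠ 0 := fun h => hD0 (h ▸ hDω)
  have h3 : (3 : A) ≠ 0 := fun h => h9 (by linear_combination 3 * h)
  have h6 : (6 : A) ≠ 0 := fun h => h3 (by linear_combination hf * h - 3 * hhf)
  have h12 : (12 : A) ≠ 0 := fun h => h6 (by linear_combination hf * h - 6 * hhf)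
  have n1 : 1 ≠ ω := by grind
  have n2 : -2 ≠ ω := by grind
  have n3 : y ≠ ω := by grind
  have n4 : -2 * y ≠ ω := by grind
  have n5 : y ≠ 1 := by grind
  have n6 : (-2 : A) ≠ 1 := by grind
  have n7 : -2 * y ≠ 1 := by grind
  have n8 : -2 ≠ y := by grind
  have n9 : -2 * y ≠ y := by grind
  have n10 : -2 * y ≠ -2 := by grind
  have hDneg2 : ∀ d, D d → D (-2 * d) := fun d hd => by
    rw [neg_mul]
    exact hneg _ (htwo d hd)
  have hne : ∀ d, D d → d ≠ -d := by
    intro d hd h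
    have : d = 0 := by linear_combination hf * h - d * hhf
    exact hD0 (this ▸ hd)
  obtain ⟨s, hsP, hs, hs'⟩ := exists_sign (A := A)
    (P := fun d => d = ω ∨ d = 1 ∨ d = -2 ∨ d = y ∨ d = -2 * y)
    (levels_not_neg hω h3 h9 h12 hω0 hy)
  obtain ⟨c, hc1, hc2, hc3⟩ := exists_three_coloring (A := A) hhf
    (P := fun d => d = 1 ∨ d = -1 ∨ d = y ∨ d = -y)
    (by rintro d (h | h | h | h) <;> simp [h]) (levels_independent hω h9 hy)
  replace hs : ∀ d, D d → s d → ¬ s (-d) := fun d hd => hs d (hne d hd)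
  replace hs' : ∀ d, D d → s d ∨ s (-d) := fun d hd => hs' d (hne d hd)
  have hsω : s ω := hsP ω (by simp)
  have hs1 : s 1 := hsP 1 (by simp)
  have hs2 : s (-2) := hsP _ (by simp)
  have hsy : s y := hsP y (by simp)
  have hs2y : s (-2 * y) := hsP _ (by simp)
  have hD2 : D (-2) := by simpa using hDneg2 1 hD1
  have hD2y : D (-2 * y) := hDneg2 y hDy
  let W : A → Fin 10 → RuledWalk := fun d =>
    if d = ω then torsionWalks else if d = 1 then leftWalks else if d = y then rightWalks
    else if d = -2 then leftDoubleWalks (c (2 * d)) else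
    if d = -2 * y then rightDoubleWalks (c (2 * d)) else regularWalks (c d) (c (2 * d))
  have hWω : W ω = torsionWalks := if_pos rfl
  have hW1 : W 1 = leftWalks := by simp only [W, if_neg n1, if_true]
  have hWy : W y = rightWalks := by simp only [W, if_neg n3, if_neg n5, if_true]
  have hW2 : W (-2) = leftDoubleWalks (c (2 * -2)) := by
    simp only [W, if_neg n2, if_neg n6, if_neg n8, if_true]
  have hW2y : W (-2 * y) = rightDoubleWalks (c (2 * (-2 * y))) := by
    simp only [W, if_neg n4, if_neg n7, if_neg n9, if_neg n10, if_true]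
  have hWreg : ∀ d, d ≠ ω → d ≠ 1 → d ≠ y → d ≠ -2 → d ≠ -2 * y →
      W d = regularWalks (c d) (c (2 * d)) := by
    intro d h1 h2 h3 h4 h5
    simp only [W, if_neg h1, if_neg h2, if_neg h3, if_neg h4, if_neg h5]
  have hreg : ∀ d, D d → s d → d ≠ ω → c d ≠ c (2 * d) := by
    intro d hd hsd hdω
    refine hc3 d fun h => ?_
    rcases hthree d hd h with rfl | rfl
    · exact hdω rfl
    · exact hs ω hDω hsω hsd
  have hcloses : ∀ e, D e → s e → e ≠ ω → e ≠ 1 → e ≠ y → ∀ u v, Linked (c (2 * e)) u v →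
      Occurs (W e) 0 2 u v := by
    intro e hDe hse h1 h2 h3
    by_cases h4 : e = -2
    · rw [h4, hW2]
      exact leftDoubleWalks_closes _
    by_cases h5 : e = -2 * y
    · rw [h5, hW2y]
      exact rightDoubleWalks_closes _
    rw [hWreg e h1 h2 h3 h4 h5]
    exact regularWalks_closes _ _ (hreg e hDe hse h1)
  have hlinked : ∀ d, D d → s d → d ≠ ω → d ≠ -2 → d ≠ -2 * y → ∀ u v, Linked (c d) u v →
      WalksCover D s ω 1 y W u v d := by
    intro d hd hsd h1 h2 h3 u v h
    obtain ⟨e, hDe, hse, he⟩ := exists_half hhf hneg hhalf hs' hd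
    have hc : c (2 * e) = c d := by
      rcases he with he | he
      · rw [he]
      · rw [he, hc1]
    have key : ∀ f, s (-2 * f) → D (-2 * f) → d ≠ -2 * f → e ≠ f := by
      rintro f hsf hDf hdf rfl
      rcases he with he | he
      · refine hs _ hDf hsf ?_
        rwa [neg_mul, neg_neg, he]
      · exact hdf (by rw [neg_mul, he, neg_neg])
    have hω' : -2 * ω = ω := by linear_combination -hω
    refine walksCover_of_linked h hDe hse he ?_
    rw [← hc]
    exact hcloses e hDe hse (key ω (by rwa [hω']) (by rwa [hω']) (by rwa [hω']))
      (key 1 (by rwa [mul_one]) (by rwa [mul_one]) (by rwa [mul_one])) (key y hs2y hD2y h3)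
  refine hasDifferenceFamily_of_walks (s := s) (x := 1) (W := W) (by rw [hy]; ring) hω hneg htwo
    hs hs' ?_ (fun _ _ => Or.inr ⟨hDω, hD1, hDy⟩) ?_
  · intro d
    dsimp only [W]
    split_ifs
    · exact isProper_torsionWalks
    · exact isProper_leftWalks
    · exact isProper_rightWalks
    · exact isProper_leftDoubleWalks _
    · exact isProper_rightDoubleWalks _
    · exact isProper_regularWalks _ _
  intro d hd hsd u v huv
  have mk : ∀ e r i, D e → s e → Occurs (W e) r i u v → ruleLabels ω 1 y e r i = d →
      WalksCover D s ω 1 y W u v d := fun e r i h1 h2 h3 h4 => ⟨e, r, i, h1, h2, Or.inl ⟨h3, h4⟩⟩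
  by_cases h1 : d = ω
  · subst h1
    rcases torsionWalks_covers u v huv with h | h | h | h | h | h
    · exact mk d 0 0 hd hsd (hWω ▸ h) rfl
    · exact mk d 0 1 hd hsd (hWω ▸ h) rfl
    · exact mk d 0 2 hd hsd (hWω ▸ h) (by change -2 * d = d; linear_combination -hω)
    · exact mk d 2 0 hd hsd (hWω ▸ h) rfl
    · exact mk 1 1 0 hD1 hs1 (hW1 ▸ h) rfl
    · exact mk y 1 0 hDy hsy (hWy ▸ h) rfl
  by_cases h2 : d = -2
  · subst h2
    rcases leftDoubleWalks_covers _ u v huv with h | h | h | h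
    · exact mk 1 0 2 hD1 hs1 (hW1 ▸ h) (mul_one _)
    · exact mk ω 2 1 hDω hsω (hWω ▸ h) (mul_one _)
    · exact mk _ 0 0 hd hsd (hW2 ▸ h) rfl
    · exact mk _ 0 1 hd hsd (hW2 ▸ h) rfl
  by_cases h3 : d = -2 * y
  · subst h3
    rcases rightDoubleWalks_covers _ u v huv with h | h | h | h
    · exact mk y 0 2 hDy hsy (hWy ▸ h) rfl
    · exact mk ω 2 2 hDω hsω (hWω ▸ h) rfl
    · exact mk _ 0 0 hd hsd (hW2y ▸ h) rfl
    · exact mk _ 0 1 hd hsd (hW2y ▸ h) rfl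
  have hin := hlinked d hd hsd h1 h2 h3 u v
  by_cases h4 : d = 1
  · subst h4
    rcases leftWalks_covers u v huv with h | h | h | h | h
    · exact hin (by rwa [hc2 1 (by simp)])
    · exact mk 1 0 0 hd hsd (hW1 ▸ h) rfl
    · exact mk 1 0 1 hd hsd (hW1 ▸ h) rfl
    · exact mk 1 1 1 hd hsd (hW1 ▸ h) rfl
    · exact mk y 1 1 hDy hsy (hWy ▸ h) rfl
  by_cases h5 : d = y
  · subst h5
    rcases rightWalks_covers u v huv with h | h | h | h | h
    · exact hin (by rwa [hc2 d (by simp)])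
    · exact mk d 0 0 hd hsd (hWy ▸ h) rfl
    · exact mk d 0 1 hd hsd (hWy ▸ h) rfl
    · exact mk 1 1 2 hD1 hs1 (hW1 ▸ h) rfl
    · exact mk d 1 2 hd hsd (hWy ▸ h) rfl
  have hW := hWreg d h1 h4 h5 h2 h3
  rcases regularWalks_covers _ _ (hreg d hd hsd h1) u v huv with h | h | h
  · exact hin h
  · exact mk d 0 0 hd hsd (hW ▸ h) rfl
  · exact mk d 0 1 hd hsd (hW ▸ h) rfl

theorem exists_isCyclicHGDD_six_of_not_three_dvd {g t : ℕ} [NeZero g] (ht : Odd t)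
    (h3 : ¬ 3 ∣ t) : ∃ ℬ : Finset (Finset (Fin 6 × Fin g × ZMod t)), IsCyclicHGDD 6 g t ℬ := by
  have : NeZero t := ⟨ht.pos.ne'⟩
  obtain ⟨hf, hhf⟩ := ZMod.exists_two_mul_eq_one ht
  have hunit : IsUnit (3 : ZMod t) := by
    have : IsUnit ((3 : ℕ) : ZMod t) :=
      (ZMod.isUnit_iff_coprime 3 t).2 ((Nat.prime_three.coprime_iff_not_dvd).2 h3)
    exact_mod_cast this
  refine exists_isCyclicHGDD_of_hasDifferenceFamily_zmod (V := Fin 6)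
    (hasDifferenceFamily_of_three_mul_ne_zero hhf (by simp) (by simp) ?_ ?_ ?_) (by simp)
  · intro d hd h
    exact hd (by linear_combination hf * h - d * hhf)
  · intro d hd h
    exact hd (by linear_combination 2 * h - d * hhf)
  · intro d hd h
    exact hd (hunit.mul_right_eq_zero.1 h)

theorem exists_isCyclicHGDD_six_three_mul {g m : ℕ} [NeZero g] (hm : Odd m) (h5 : 5 ≤ m) :
    ∃ ℬ : Finset (Finset (Fin 6 × Fin g × ZMod (3 * m))), IsCyclicHGDD 6 g (3 * m) ℬ := by
  have : NeZero (3 * m) := ⟨by omega⟩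
  obtain ⟨hf, hhf⟩ := ZMod.exists_two_mul_eq_one (Odd.mul (by decide : Odd 3) hm)
  have hmul : (3 : ZMod (3 * m)) * (m : ZMod (3 * m)) = 0 := by
    exact_mod_cast ZMod.natCast_self (3 * m)
  have hm0 : (m : ZMod (3 * m)) ≠ 0 := by
    rw [Ne, ZMod.natCast_eq_zero_iff]
    intro h
    have := Nat.le_of_dvd (by omega) h
    omega
  have h9 : (9 : ZMod (3 * m)) ≠ 0 := by
    intro h
    have h' : ((9 : ℕ) : ZMod (3 * m)) = 0 := by exact_mod_cast h
    rw [ZMod.natCast_eq_zero_iff] at h'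
    have := Nat.le_of_dvd (by omega) h'
    omega
  refine exists_isCyclicHGDD_of_hasDifferenceFamily_zmod (V := Fin 6)
    (hasDifferenceFamily_of_three_torsion hhf hmul h9 (by simp) (by simp) ?_ ?_ ?_ hm0 ?_ ?_)
    (by simp)
  · intro d hd h
    exact hd (by linear_combination hf * h - d * hhf)
  · intro d hd h
    exact hd (by linear_combination 2 * h - d * hhf)
  · intro d hd h
    have hlt := ZMod.val_lt d
    have hcast : ((d.val : ℕ) : ZMod (3 * m)) = d := ZMod.natCast_zmod_val d
    have hpos : d.val ≠ 0 := by rwa [Ne, ZMod.val_eq_zero]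
    rw [← hcast] at h
    have h' : ((3 * d.val : ℕ) : ZMod (3 * m)) = 0 := by exact_mod_cast h
    rw [ZMod.natCast_eq_zero_iff] at h'
    obtain ⟨k, hk⟩ := Nat.dvd_of_mul_dvd_mul_left (by omega) h'
    have hk3 : k < 3 := by nlinarith
    interval_cases k
    · omega
    · left
      rw [← hcast, hk, mul_one]
    · right
      rw [← hcast, hk]
      push_cast
      linear_combination hmul
  · intro h
    exact h9 (by linear_combination 9 * h)
  · intro h
    exact h9 (by linear_combination -9 * h - 3 * hmul)

theorem exists_isCyclicHGDD_six_nine {g : ℕ} [NeZero g] :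
    ∃ ℬ : Finset (Finset (Fin 6 × Fin g × ZMod 9)), IsCyclicHGDD 6 g 9 ℬ :=
  exists_isCyclicHGDD_of_hasDifferenceFamily_zmod hasDifferenceFamily_zmod_nine
    (by simp [ZMod.card])

theorem hasDifferenceFamily_zmod_prime_prod_zmod_three {p : ℕ} [Fact p.Prime] (h5 : 5 ≤ p) :
    HasDifferenceFamily (Fin 6) (ZMod p × ZMod 3) (·.2 ≠ 0) := by
  have hp : p.Prime := Fact.out
  obtain ⟨h, hh⟩ := ZMod.exists_two_mul_eq_one (hp.odd_of_ne_two (by omega))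
  have h3 : (3 : ZMod p) ≠ 0 := by
    intro h
    have h' : ((3 : ℕ) : ZMod p) = 0 := by exact_mod_cast h
    rw [ZMod.natCast_eq_zero_iff] at h'
    have := Nat.le_of_dvd (by omega) h'
    omega
  refine hasDifferenceFamily_of_three_torsion (hf := (h, 2)) (ω := (0, 1)) ?_ ?_ ?_ ?_ ?_ ?_ ?_ ?_
    ?_ ?_ ?_
  · exact Prod.ext hh (show (2 : ZMod 3) * 2 = 1 by decide)
  · exact Prod.ext (mul_zero _) (show (3 : ZMod 3) * 1 = 0 by decide)
  · intro h9
    have : (9 : ZMod p) = 0 := congrArg Prod.fst h9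
    have : (3 : ZMod p) * 3 = 0 := by rw [← this]; norm_num
    exact h3 (mul_self_eq_zero.1 this)
  · simp
  · simp
  · rintro ⟨a, b⟩
    change b ≠ 0 → 2 * b ≠ 0
    revert b
    decide
  · rintro ⟨a, b⟩
    change b ≠ 0 → 2 * b ≠ 0
    revert b
    decide
  · rintro ⟨a, b⟩ hb hab
    have ha : 3 * a = 0 := congrArg Prod.fst hab
    have ha0 : a = 0 := (mul_eq_zero.1 ha).resolve_left h3
    have hb' : b = 1 ∨ b = -1 := by
      change b ≠ 0 at hb
      clear hab
      revert b
      decide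
    rcases hb' with rfl | rfl
    · left
      rw [ha0]
    · right
      rw [ha0, Prod.neg_mk, neg_zero]
  · change (1 : ZMod 3) ≠ 0
    decide
  · change (1 : ZMod 3) ≠ 0
    decide
  · change (-1 - 1 : ZMod 3) ≠ 0
    decide

theorem exists_isCyclicHGDD_of_hasDifferenceFamily_prod {V : Type} [Fintype V] {u g p t : ℕ}
    [NeZero g] [NeZero t] (hp : p ∣ g) (h : HasDifferenceFamily V (ZMod p × ZMod t) (·.2 ≠ 0))
    (hV : Fintype.card V = u) :
    ∃ ℬ : Finset (Finset (Fin u × Fin g × ZMod t)), IsCyclicHGDD u g t ℬ := by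
  obtain ⟨q, hq⟩ := hp
  have hg := NeZero.ne g
  have : NeZero p := ⟨fun h => hg (by rw [hq, h, zero_mul])⟩
  have : NeZero q := ⟨fun h => hg (by rw [hq, h, mul_zero])⟩
  exact exists_isCyclicHGDD_of_hasDifferenceFamily (J := ZMod p) (G := ZMod q) h (AddEquiv.refl _)
    (fun _ => Iff.rfl) hV (by rw [ZMod.card, ZMod.card, hq])

theorem exists_isCyclicHGDD_six_three {g : ℕ} [NeZero g] (hg : g ≠ 1) :
    ∃ ℬ : Finset (Finset (Fin 6 × Fin g × ZMod 3)), IsCyclicHGDD 6 g 3 ℬ := by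
  obtain ⟨p, hp, hpg⟩ := Nat.exists_prime_and_dvd hg
  have : Fact p.Prime := ⟨hp⟩
  have := hp.two_le
  have h4 : p ≠ 4 := by
    rintro rfl
    exact absurd hp (by decide)
  rcases (by omega : p = 2 ∨ p = 3 ∨ 5 ≤ p) with rfl | rfl | h5
  · exact exists_isCyclicHGDD_of_hasDifferenceFamily_prod hpg
      hasDifferenceFamily_zmod_two_prod_zmod_three (by simp [ZMod.card])
  · exact exists_isCyclicHGDD_of_hasDifferenceFamily_prod hpg
      hasDifferenceFamily_zmod_three_prod_zmod_three (by simp [ZMod.card])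
  · exact exists_isCyclicHGDD_of_hasDifferenceFamily_prod hpg
      (hasDifferenceFamily_zmod_prime_prod_zmod_three h5) (by simp)

/-- Let u, g, t be positive integers with u ≡ 0 or 1 (mod 3),
u ≥ 3, t odd and t ≥ 3, and (u,g,t) ≠ (6,1,3). Then there exists a
(g,t,1)-cyclic 3-HGDD of type (u,g^t). -/
theorem exists_cyclic_hgdd_u_zero_one_mod_three
    (u g t : ℕ) (hg : 0 < g) (hu3 : 3 ≤ u) (humod : u % 3 = 0 ∨ u % 3 = 1)
    (ht : Odd t) (ht3 : 3 ≤ t) (hexc : ¬(u = 6 ∧ g = 1 ∧ t = 3)) :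
    ∃ ℬ : Finset (Finset (Fin u × Fin g × ZMod t)), IsCyclicHGDD u g t ℬ := by
  have : NeZero g := ⟨hg.ne'⟩
  by_cases h6 : u = 6
  · subst h6
    by_cases h3 : 3 ∣ t
    · obtain ⟨m, rfl⟩ := h3
      have hm : Odd m := (Nat.odd_mul.1 ht).2
      rw [Nat.odd_iff] at hm
      rcases (by omega : m = 1 ∨ m = 3 ∨ 5 ≤ m) with rfl | rfl | h5
      · exact exists_isCyclicHGDD_six_three fun h => hexc ⟨rfl, h, rfl⟩
      · exact exists_isCyclicHGDD_six_nine
      · exact exists_isCyclicHGDD_six_three_mul (Nat.odd_iff.2 hm) h5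
    · exact exists_isCyclicHGDD_six_of_not_three_dvd ht h3
  · exact exists_isCyclicHGDD_of_ne_six hu3 humod ht h6
end

section
/- For every positive integer u with u ≡ 2 (mod 6) and u ≥ 8, there exists a (3,3,1)-cyclic 3-HGDD of type (u,3^3). -/
section Semisymmetric

variable {u g : ℕ} (f : Fin u × Fin g → Fin u × Fin g → Fin u × Fin g)

/-- The transversal triple `(a, s), (b, s + 1), (f a b, s + 2)`. -/
def hgddBlock (a b : Fin u × Fin g) (s : ZMod 3) : Finset (Fin u × Fin g × ZMod 3) :=
  {(a.1, a.2, s), (b.1, b.2, s + 1), ((f a b).1, (f a b).2, s + 2)}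

theorem mem_hgddBlock {a b : Fin u × Fin g} {s : ZMod 3} {p : Fin u × Fin g × ZMod 3} :
    p ∈ hgddBlock f a b s ↔ p = (a.1, a.2, s) ∨ p = (b.1, b.2, s + 1) ∨
      p = ((f a b).1, (f a b).2, s + 2) := by
  simp [hgddBlock]

theorem hgddBlock_rotate (hf : ∀ a b, a.1 ≠ b.1 → f b (f a b) = a)
    {a b : Fin u × Fin g} (hab : a.1 ≠ b.1) (s : ZMod 3) :
    hgddBlock f b (f a b) (s + 1) = hgddBlock f a b s := by
  have h2 : s + 1 + 1 = s + 2 := by ring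
  have h3 : s + 1 + 2 = s := by
    rw [add_assoc, show (1 + 2 : ZMod 3) = 0 from rfl, add_zero]
  ext p
  simp only [mem_hgddBlock, hf a b hab, h2, h3]
  tauto

/-- A holey semisymmetric quasigroup, with one hole for each first coordinate, yields a cyclic
HGDD with three holes. -/
theorem exists_isCyclicHGDD_of_semisymmetric
    (hne : ∀ a b, a.1 ≠ b.1 → (f a b).1 ≠ b.1) (hf : ∀ a b, a.1 ≠ b.1 → f b (f a b) = a) :
    ∃ ℬ : Finset (Finset (Fin u × Fin g × ZMod 3)), IsCyclicHGDD u g 3 ℬ := by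
  classical
  have hne' : ∀ a b, a.1 ≠ b.1 → (f a b).1 ≠ a.1 := fun a b hab h =>
    hne b (f a b) (hne a b hab).symm (by rw [hf a b hab, h])
  have hs : ∀ s : ZMod 3, s ≠ s + 1 ∧ s ≠ s + 2 ∧ s + 1 ≠ s + 2 := by decide
  let ℬ : Finset (Finset (Fin u × Fin g × ZMod 3)) :=
    Finset.univ.filter fun B => ∃ a b s, a.1 ≠ b.1 ∧ B = hgddBlock f a b s
  have hmem : ∀ B, B ∈ ℬ ↔ ∃ a b s, a.1 ≠ b.1 ∧ B = hgddBlock f a b s := fun B => by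
    simp [ℬ]
  have hstart : ∀ B ∈ ℬ, ∀ s, ∃ a b, a.1 ≠ b.1 ∧ B = hgddBlock f a b s := by
    intro B hB s
    obtain ⟨a, b, r, hab, rfl⟩ := (hmem B).1 hB
    have h1 := hgddBlock_rotate f hf hab r
    have hb := (hne a b hab).symm
    have h2 := hgddBlock_rotate f hf hb (r + 1)
    have hr : s = r ∨ s = r + 1 ∨ s = r + 1 + 1 := by
      clear * -
      decide +revert
    rcases hr with rfl | rfl | rfl
    · exact ⟨a, b, hab, rfl⟩
    · exact ⟨b, f a b, hb, h1.symm⟩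
    · exact ⟨f a b, f b (f a b), (hne b (f a b) hb).symm, (h2.trans h1).symm⟩
  have hpair : ∀ (a b : Fin u × Fin g) (s : ZMod 3), a.1 ≠ b.1 →
      ∃! B, B ∈ ℬ ∧ (a.1, a.2, s) ∈ B ∧ (b.1, b.2, s + 1) ∈ B := by
    intro a b s hab
    refine ⟨hgddBlock f a b s, ⟨(hmem _).2 ⟨a, b, s, hab, rfl⟩, ?_, ?_⟩, ?_⟩
    · simp [mem_hgddBlock]
    · simp [mem_hgddBlock]
    · rintro B ⟨hB, ha, hb⟩
      obtain ⟨a', b', -, rfl⟩ := hstart B hB s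
      obtain ⟨h01, h02, h12⟩ := hs s
      have ha' : a = a' := by
        simp only [mem_hgddBlock, Prod.mk.injEq, h01, h02, and_false, or_false, and_true] at ha
        exact Prod.ext ha.1 ha.2
      have hb' : b = b' := by
        simp only [mem_hgddBlock, Prod.mk.injEq, h01.symm, h12, and_false, or_false, false_or,
          and_true] at hb
        exact Prod.ext hb.1 hb.2
      rw [ha', hb']
  refine ⟨ℬ, ?_, ?_, ?_, ?_⟩
  · intro B hB
    obtain ⟨a, b, s, hab, rfl⟩ := (hmem B).1 hB
    obtain ⟨h01, h02, h12⟩ := hs s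
    exact Finset.card_eq_three.2 ⟨_, _, _, by simp [h01], by simp [-left_eq_add, h02], by simp [h12], rfl⟩
  · intro B hB p hp q hq hpq
    obtain ⟨a, b, s, hab, rfl⟩ := (hmem B).1 hB
    obtain ⟨h01, h02, h12⟩ := hs s
    have h1 := hne a b hab
    have h2 := hne' a b hab
    rw [mem_hgddBlock] at hp hq
    rcases hp with rfl | rfl | rfl <;> rcases hq with rfl | rfl | rfl <;>
      first
      | exact absurd rfl hpq
      | exact ⟨by first | assumption | exact Ne.symm (by assumption),
          by first | assumption | exact Ne.symm (by assumption)⟩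
  · rintro ⟨i, x, s⟩ ⟨j, y, r⟩ hij hsr
    have hr : r = s + 1 ∨ s = r + 1 := by
      replace hsr : s ≠ r := hsr
      clear * - hsr
      decide +revert
    rcases hr with rfl | rfl
    · exact hpair (i, x) (j, y) s hij
    · simpa only [and_comm, and_left_comm] using hpair (j, y) (i, x) r (Ne.symm hij)
  · intro B hB
    obtain ⟨a, b, s, hab, rfl⟩ := (hmem B).1 hB
    refine (hmem _).2 ⟨a, b, s + 1, hab, ?_⟩
    simp [hgddBlock, Finset.image_insert, add_right_comm]

end Semisymmetric

section DifferenceFamily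

variable {R : Type*} [CommRing R] [DecidableEq R] (c : ZMod 3 → Rˣ)

/-- The product on `(R ∪ {∞}) × ZMod 3` developed over `R × ZMod 3` from the difference triples
`(c 0 * a, 0), (c 1 * a, 1), (c 2 * a, 2)` with `a ≠ 0`, where the triple with `a = 1` is spent
on the points at infinity. -/
def holeyProduct : Option R × ZMod 3 → Option R × ZMod 3 → Option R × ZMod 3
  | (some x, i), (some y, j) =>
    if y - x = c (j - i) then (none, j - i)
    else (some (y + c (j - i + 1) * ((c (j - i))⁻¹ * (y - x))), j + (j - i + 1))
  | (none, e), (some x, i) => (some (x + c e), i + e)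
  | (some x, i), (none, e) => (some (x - c e), i - e)
  | (none, e), (none, _) => (none, e)

theorem holeyProduct_fst_ne [Nontrivial R] (a b : Option R × ZMod 3) (hab : a.1 ≠ b.1) :
    (holeyProduct c a b).1 ≠ b.1 := by
  obtain ⟨_ | x, i⟩ := a <;> obtain ⟨_ | y, j⟩ := b
  · exact absurd rfl hab
  · simp [holeyProduct]
  · simp [holeyProduct]
  · have hyx : y - x ≠ 0 := fun h => hab (by rw [sub_eq_zero.1 h])
    simp only [holeyProduct]
    split_ifs
    · simp
    · simpa using hyx

theorem holeyProduct_semisymm (hc : ∀ e, (c e + c (e + 1) + c (e + 2) : R) = 0)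
    (a b : Option R × ZMod 3) (hab : a.1 ≠ b.1) :
    holeyProduct c b (holeyProduct c a b) = a := by
  obtain ⟨_ | x, i⟩ := a <;> obtain ⟨_ | y, j⟩ := b
  · exact absurd rfl hab
  · simp [holeyProduct]
  · simp [holeyProduct]
  · by_cases h : y - x = c (j - i)
    · simp only [holeyProduct, if_pos h]
      simp [← h]
    · obtain ⟨d, hd⟩ : ∃ d, d = ((c (j - i))⁻¹ : Rˣ) * (y - x) := ⟨_, rfl⟩
      have hyx : y - x = c (j - i) * d := by rw [hd, Units.mul_inv_cancel_left]
      have hd1 : ¬ (c (j - i + 1) * d : R) = c (j - i + 1) := by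
        intro h1
        apply h
        have : d = 1 := by
          simpa using congrArg (fun z : R => ((c (j - i + 1))⁻¹ : Rˣ) * z) h1
        rw [hyx, this, mul_one]
      have hj : j + (j - i + 1) + (j - i + 1 + 1) = i := by
        clear * -
        decide +revert
      have h2 : j - i + 1 + 1 = j - i + 2 := by ring
      simp only [holeyProduct, if_neg h, ← hd, add_sub_cancel_left, if_neg hd1,
        Units.inv_mul_cancel_left, hj, Prod.mk.injEq, Option.some.injEq, and_true]
      rw [h2]
      linear_combination d * hc (j - i) + hyx

end DifferenceFamily

/-- For every positive integer u with u ≡ 2 (mod 6) and u ≥ 8,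
there exists a (3,3,1)-cyclic 3-HGDD of type (u,3^3). -/
theorem exists_cyclic_hgdd_u_two_mod_six
    (u : ℕ) (hmod : u % 6 = 2) (hu : 8 ≤ u) :
    ∃ ℬ : Finset (Finset (Fin u × Fin 3 × ZMod 3)), IsCyclicHGDD u 3 3 ℬ := by
  obtain ⟨k, rfl⟩ : ∃ k, u = 2 * k + 1 + 1 := ⟨u / 2 - 1, by omega⟩
  have : Fact (1 < 2 * k + 1) := ⟨by omega⟩
  have htwo : (-2 : ZMod (2 * k + 1)) * k = 1 := by
    have h := ZMod.natCast_self (2 * k + 1)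
    push_cast at h
    linear_combination -h
  let c : ZMod 3 → (ZMod (2 * k + 1))ˣ := ![1, 1, ⟨-2, k, htwo, (mul_comm _ _).trans htwo⟩]
  have hc : ∀ e, (c e + c (e + 1) + c (e + 2) : ZMod (2 * k + 1)) = 0 := by
    have h012 : (c 0 + c 1 + c 2 : ZMod (2 * k + 1)) = 0 := by
      change (1 + 1 + -2 : ZMod (2 * k + 1)) = 0
      ring
    intro e
    have he : e = 0 ∨ e = 1 ∨ e = 2 := by
      revert e; decide
    rcases he with rfl | rfl | rfl
    · exact h012
    · change (c 1 + c 2 + c 0 : ZMod (2 * k + 1)) = 0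
      linear_combination h012
    · change (c 2 + c 0 + c 1 : ZMod (2 * k + 1)) = 0
      linear_combination h012
  let φ : Fin (2 * k + 1 + 1) ≃ Option (ZMod (2 * k + 1)) := finSuccEquiv (2 * k + 1)
  let ψ : Fin (2 * k + 1 + 1) × Fin 3 ≃ Option (ZMod (2 * k + 1)) × ZMod 3 :=
    φ.prodCongr (Equiv.refl (Fin 3))
  have hψ : ∀ a, (ψ a).1 = φ a.1 := fun _ => rfl
  have hψne : ∀ a b, a.1 ≠ b.1 → (ψ a).1 ≠ (ψ b).1 := fun a b h => φ.injective.ne h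
  refine exists_isCyclicHGDD_of_semisymmetric
    (fun a b => ψ.symm (holeyProduct c (ψ a) (ψ b))) ?_ ?_
  · intro a b hab h
    apply holeyProduct_fst_ne c (ψ a) (ψ b) (hψne a b hab)
    rw [hψ b, ← h, ← hψ, ψ.apply_symm_apply]
  · intro a b hab
    simp only [ψ.apply_symm_apply]
    rw [holeyProduct_semisymm c hc _ _ (hψne a b hab), ψ.symm_apply_apply]
end

section
/- Let u ≡ 2 (mod 6) with u ≥ 8, and let g, t be positive integers with g ≡ 3 (mod 6) and t ≡ 3 (mod 6). Then there exists a (g,t,1)-cyclic 3-HGDD of type (u,g^t). -/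
/-- A rule completing two points in distinct groups and distinct holes to a block: a symmetric
partial operation that is an involution in each argument and commutes with the cyclic shift. -/
structure BlockCompletion (X R C : Type*) [CommRing C] where
  third : X × R × C → X × R × C → X × R × C
  comm : ∀ p q, p.1 ≠ q.1 → p.2.2 ≠ q.2.2 → third p q = third q p
  invol : ∀ p q, p.1 ≠ q.1 → p.2.2 ≠ q.2.2 → third p (third p q) = q
  group_ne : ∀ p q, p.1 ≠ q.1 → p.2.2 ≠ q.2.2 → p.1 ≠ (third p q).1
  hole_ne : ∀ p q, p.1 ≠ q.1 → p.2.2 ≠ q.2.2 → p.2.2 ≠ (third p q).2.2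
  shift : ∀ p q, p.1 ≠ q.1 → p.2.2 ≠ q.2.2 →
    third (p.1, p.2.1, p.2.2 + 1) (q.1, q.2.1, q.2.2 + 1) =
      ((third p q).1, (third p q).2.1, (third p q).2.2 + 1)

/-- Relabel the groups and the points inside the groups. -/
def BlockCompletion.congr {X X' R R' C : Type*} [CommRing C] (T : BlockCompletion X R C)
    (e : X' ≃ X) (f : R' ≃ R) : BlockCompletion X' R' C where
  third p q := (e.prodCongr (f.prodCongr (Equiv.refl C))).symm
    (T.third (e p.1, f p.2.1, p.2.2) (e q.1, f q.2.1, q.2.2))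
  comm p q h h' := by
    rw [T.comm] <;> simpa
  invol p q h h' := by
    have := T.invol (e p.1, f p.2.1, p.2.2) (e q.1, f q.2.1, q.2.2) (by simpa) (by simpa)
    simp [this]
  group_ne p q h h' := by
    have := T.group_ne (e p.1, f p.2.1, p.2.2) (e q.1, f q.2.1, q.2.2) (by simpa) (by simpa)
    intro h0
    exact this (by simpa using congrArg e h0)
  hole_ne p q h h' :=
    T.hole_ne (e p.1, f p.2.1, p.2.2) (e q.1, f q.2.1, q.2.2) (by simpa) (by simpa)
  shift p q h h' := by
    have := T.shift (e p.1, f p.2.1, p.2.2) (e q.1, f q.2.1, q.2.2) (by simpa) (by simpa)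
    simp only at this
    simp [this]

theorem BlockCompletion.exists_isCyclicHGDD {u g t : ℕ} [NeZero t]
    (T : BlockCompletion (Fin u) (Fin g) (ZMod t)) :
    ∃ ℬ : Finset (Finset (Fin u × Fin g × ZMod t)), IsCyclicHGDD u g t ℬ := by
  classical
  let block (p q : Fin u × Fin g × ZMod t) : Finset (Fin u × Fin g × ZMod t) :=
    {p, q, T.third p q}
  let S : Finset ((Fin u × Fin g × ZMod t) × (Fin u × Fin g × ZMod t)) :=
    Finset.univ.filter fun z => z.1.1 ≠ z.2.1 ∧ z.1.2.2 ≠ z.2.2.2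
  have hblock : ∀ B, B ∈ S.image (fun z => block z.1 z.2) ↔
      ∃ p q, p.1 ≠ q.1 ∧ p.2.2 ≠ q.2.2 ∧ B = block p q := by
    intro B
    simp only [Finset.mem_image, S, Finset.mem_filter, Finset.mem_univ, true_and]
    constructor
    · rintro ⟨z, ⟨h, h'⟩, rfl⟩
      exact ⟨z.1, z.2, h, h', rfl⟩
    · rintro ⟨p, q, h, h', rfl⟩
      exact ⟨(p, q), ⟨h, h'⟩, rfl⟩
  have hswap : ∀ p q, p.1 ≠ q.1 → p.2.2 ≠ q.2.2 → block q p = block p q := by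
    intro p q h h'
    ext r
    simp only [block, T.comm p q h h', Finset.mem_insert, Finset.mem_singleton]
    tauto
  have hthird : ∀ p q, p.1 ≠ q.1 → p.2.2 ≠ q.2.2 → block p (T.third p q) = block p q := by
    intro p q h h'
    ext r
    simp only [block, T.invol p q h h', Finset.mem_insert, Finset.mem_singleton]
    tauto
  have hthird' : ∀ p q, p.1 ≠ q.1 → p.2.2 ≠ q.2.2 → block q (T.third p q) = block p q := by
    intro p q h h'
    rw [T.comm p q h h', hthird q p h.symm h'.symm, hswap p q h h']
  have hne : ∀ p q, p.1 ≠ q.1 → p.2.2 ≠ q.2.2 →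
      q.1 ≠ (T.third p q).1 ∧ q.2.2 ≠ (T.third p q).2.2 := by
    intro p q h h'
    rw [T.comm p q h h']
    exact ⟨T.group_ne q p h.symm h'.symm, T.hole_ne q p h.symm h'.symm⟩
  have hmem : ∀ p q, p.1 ≠ q.1 → p.2.2 ≠ q.2.2 → ∀ r ∈ block p q, ∀ s ∈ block p q, r ≠ s →
      (r.1 ≠ s.1 ∧ r.2.2 ≠ s.2.2) ∧ block r s = block p q := by
    intro p q h h' r hr s hs hrs
    have h1 := T.group_ne p q h h'
    have h2 := T.hole_ne p q h h'
    obtain ⟨h3, h4⟩ := hne p q h h'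
    simp only [block, Finset.mem_insert, Finset.mem_singleton] at hr hs
    rcases hr with rfl | rfl | rfl <;> rcases hs with rfl | rfl | rfl
    · exact absurd rfl hrs
    · exact ⟨⟨h, h'⟩, rfl⟩
    · exact ⟨⟨h1, h2⟩, hthird _ _ h h'⟩
    · exact ⟨⟨h.symm, h'.symm⟩, hswap _ _ h h'⟩
    · exact absurd rfl hrs
    · exact ⟨⟨h3, h4⟩, hthird' _ _ h h'⟩
    · exact ⟨⟨h1.symm, h2.symm⟩, (hswap _ _ h1 h2).trans (hthird _ _ h h')⟩
    · exact ⟨⟨h3.symm, h4.symm⟩, (hswap _ _ h3 h4).trans (hthird' _ _ h h')⟩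
    · exact absurd rfl hrs
  refine ⟨S.image (fun z => block z.1 z.2), ?_, ?_, ?_, ?_⟩
  · intro B hB
    obtain ⟨p, q, h, h', rfl⟩ := (hblock B).1 hB
    refine Finset.card_eq_three.2 ⟨p, q, T.third p q, ?_, ?_, ?_, rfl⟩
    · exact fun h0 => h (congrArg _ h0)
    · exact fun h0 => T.group_ne p q h h' (congrArg _ h0)
    · exact fun h0 => (hne p q h h').1 (congrArg _ h0)
  · intro B hB r hr s hs hrs
    obtain ⟨p, q, h, h', rfl⟩ := (hblock B).1 hB
    exact (hmem p q h h' r hr s hs hrs).1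
  · intro p q h h'
    refine ⟨block p q, ⟨(hblock _).2 ⟨p, q, h, h', rfl⟩, by simp [block], by simp [block]⟩, ?_⟩
    rintro B ⟨hB, hp, hq⟩
    obtain ⟨a, b, hab, hab', rfl⟩ := (hblock B).1 hB
    exact (hmem a b hab hab' p hp q hq fun h0 => h (congrArg _ h0)).2.symm
  · intro B hB
    obtain ⟨p, q, h, h', rfl⟩ := (hblock B).1 hB
    refine (hblock _).2 ⟨(p.1, p.2.1, p.2.2 + 1), (q.1, q.2.1, q.2.2 + 1), h, by simpa, ?_⟩
    simp [T.shift p q h h', block, Finset.image_insert]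

/-- An idempotent quasigroup operation on `X` for each `δ ∈ C`, with left division, such that
opposite parameters give opposite operations. -/
structure IdempotentFamily (X C : Type*) [CommRing C] where
  op : C → X → X → X
  ldiv : C → X → X → X
  op_swap : ∀ δ x y, δ ≠ 0 → op (-δ) y x = op δ x y
  op_ldiv : ∀ δ x y, op δ x (ldiv δ x y) = y
  ldiv_op : ∀ δ x y, ldiv δ x (op δ x y) = y
  op_self : ∀ δ x, op δ x x = x

namespace IdempotentFamily

variable {X A C : Type*} [CommRing C] [AddCommGroup A] (F : IdempotentFamily X C)

theorem op_ne {δ : C} {x y : X} (h : x ≠ y) : x ≠ F.op δ x y := by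
  intro h0
  have h1 := F.ldiv_op δ x y
  have h2 := F.ldiv_op δ x x
  rw [F.op_self] at h2
  rw [← h0, h2] at h1
  exact h h1

theorem ldiv_ne {δ : C} {x y : X} (h : x ≠ y) : x ≠ F.ldiv δ x y := by
  intro h0
  have h1 := F.op_ldiv δ x y
  rw [← h0, F.op_self] at h1
  exact h h1

theorem ldiv_neg {δ : C} (hδ : δ ≠ 0) (x y : X) : F.ldiv (-δ) (F.ldiv δ x y) y = x := by
  have h1 := F.ldiv_op (-δ) (F.ldiv δ x y) x
  rwa [F.op_swap δ _ _ hδ, F.op_ldiv] at h1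

/-- Complete two points in the same row `i`: the third point is in row `i + 1`, and its hole is
the midpoint of their holes. -/
def apex (half : C) (p q : X × (ZMod 3 × A) × C) : X × (ZMod 3 × A) × C :=
  (F.op (q.2.2 - p.2.2) p.1 q.1, (p.2.1.1 + 1, p.2.1.2 + q.2.1.2), half * (p.2.2 + q.2.2))

/-- Complete a point `p` in row `i` and the apex `q` in row `i + 1` of its block. -/
def base (p q : X × (ZMod 3 × A) × C) : X × (ZMod 3 × A) × C :=
  (F.ldiv (2 * (q.2.2 - p.2.2)) p.1 q.1, (p.2.1.1, q.2.1.2 - p.2.1.2), 2 * q.2.2 - p.2.2)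

/-- The third point of the block through `p` and `q`. -/
def third (half : C) (p q : X × (ZMod 3 × A) × C) : X × (ZMod 3 × A) × C :=
  if p.2.1.1 = q.2.1.1 then F.apex half p q
  else if q.2.1.1 = p.2.1.1 + 1 then F.base p q else F.base q p

/-- The Bose-type construction: rows indexed by `ZMod 3`, with an arbitrary weight `A`. -/
def blockCompletion (half : C) (hhalf : 2 * half = 1) :
    BlockCompletion X (ZMod 3 × A) C where
  third := F.third half
  comm := by
    rintro ⟨x, ⟨i, a⟩, c⟩ ⟨y, ⟨j, b⟩, d⟩ h h'
    have hrow : ∀ i j : ZMod 3, i ≠ j → (j = i + 1 ↔ ¬ i = j + 1) := by decide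
    simp only at h h'
    by_cases hij : i = j
    · subst hij
      have := F.op_swap (d - c) x y (sub_ne_zero.2 h'.symm)
      rw [neg_sub] at this
      simp [third, apex, this, add_comm]
    · have := hrow i j hij
      simp only [third, hij, Ne.symm hij, if_false]
      split_ifs <;> tauto
  invol := by
    rintro ⟨x, ⟨i, a⟩, c⟩ ⟨y, ⟨j, b⟩, d⟩ h h'
    have hrow : ∀ i j : ZMod 3, i ≠ j → j ≠ i + 1 → i = j + 1 := by decide
    have hsucc : ∀ i : ZMod 3, ¬ i = i + 1 ∧ ¬ i + 1 = i ∧ ¬ i = i + 1 + 1 := by decide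
    simp only at h h'
    by_cases hij : i = j
    · subst hij
      have h1 : 2 * (half * (c + d) - c) = d - c := by linear_combination (c + d) * hhalf
      have h2 : 2 * (half * (c + d)) - c = d := by linear_combination (c + d) * hhalf
      simp [third, apex, base, hsucc, h1, h2, F.ldiv_op]
    · by_cases hji : j = i + 1
      · subst hji
        have h1 : 2 * d - c - c = 2 * (d - c) := by ring
        have h2 : half * (c + (2 * d - c)) = d := by linear_combination d * hhalf
        simp only [third, base, apex, hsucc, if_true, if_false, h1, h2, F.op_ldiv]
        simp
      · obtain rfl := hrow i j hij hji
        have h1 : 2 * (c - (2 * c - d)) = -(2 * (c - d)) := by ring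
        have h2 : 2 * (c - d) ≠ 0 := by
          intro h0
          exact h' (by linear_combination half * h0 - (c - d) * hhalf)
        simp [third, base, hsucc, h1, F.ldiv_neg h2]
  group_ne := by
    rintro ⟨x, ⟨i, a⟩, c⟩ ⟨y, ⟨j, b⟩, d⟩ h h'
    simp only at h h'
    simp only [third]
    split_ifs
    · exact F.op_ne h
    · exact F.ldiv_ne h
    · intro h0
      have h1 := F.op_ldiv (2 * (c - d)) y x
      simp only [base] at h0
      rw [← h0] at h1
      have h2 := F.op_self (2 * (c - d)) x
      have h3 : c - d ≠ 0 := sub_ne_zero.2 h'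
      have h4 : 2 * (c - d) ≠ 0 := fun h5 => h3 (by linear_combination half * h5 - (c - d) * hhalf)
      rw [← F.op_swap _ _ _ h4] at h1
      exact F.op_ne h h1.symm
  hole_ne := by
    rintro ⟨x, ⟨i, a⟩, c⟩ ⟨y, ⟨j, b⟩, d⟩ h h'
    simp only at h h'
    simp only [third]
    split_ifs <;> simp only [apex, base] <;> intro h0 <;> apply h'
    · linear_combination 2 * h0 + (c + d) * hhalf
    · linear_combination half * h0 - (c - d) * hhalf
    · linear_combination - h0
  shift := by
    rintro ⟨x, ⟨i, a⟩, c⟩ ⟨y, ⟨j, b⟩, d⟩ h h'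
    simp only [third]
    split_ifs <;> simp only [apex, base, add_sub_add_right_eq_sub, Prod.mk.injEq, true_and]
    · linear_combination hhalf
    · ring
    · ring

end IdempotentFamily

theorem exists_idempotentFamily {X : Type*} (f : X → X → X) (hf : ∀ x, f x x = x)
    (hrow : ∀ x, Function.Bijective (f x)) (hcol : ∀ y, Function.Bijective fun x => f x y)
    {t : ℕ} (ht : Odd t) : Nonempty (IdempotentFamily X (ZMod t)) := by
  have : NeZero t := ⟨by rintro rfl; simp at ht⟩
  let op (δ : ZMod t) (x y : X) : X := if 2 * δ.val < t then f x y else f y x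
  have hop : ∀ δ x, Function.Bijective (op δ x) := by
    intro δ x
    by_cases h : 2 * δ.val < t
    · simpa [op, h] using hrow x
    · simpa [op, h] using hcol x
  refine ⟨⟨op, fun δ x => (Equiv.ofBijective _ (hop δ x)).symm, ?_, ?_, ?_, ?_⟩⟩
  · intro δ x y hδ
    have : NeZero δ := ⟨hδ⟩
    have h1 : (-δ).val = t - δ.val := ZMod.val_neg_of_ne_zero δ
    have h2 := ZMod.val_lt δ
    obtain ⟨k, hk⟩ := ht
    simp only [op, h1]
    split_ifs <;> first | rfl | omega
  · intro δ x y
    exact (Equiv.ofBijective _ (hop δ x)).apply_symm_apply y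
  · intro δ x y
    exact (Equiv.ofBijective _ (hop δ x)).symm_apply_apply y
  · intro δ x
    simp [op, hf]

/-- The prolongation of the idempotent quasigroup `2 * x - y` on `ZMod n` along its transversal
`y = x + 1`, with new element `none`. -/
def prolongation (n : ℕ) : Option (ZMod n) → Option (ZMod n) → Option (ZMod n)
  | none, none => none
  | none, some y => some (y - 2)
  | some x, none => some (x - 1)
  | some x, some y => if y = x + 1 then none else some (2 * x - y)

theorem prolongation_self {n : ℕ} (hn : 1 < n) (x : Option (ZMod n)) :
    prolongation n x x = x := by
  have : Fact (1 < n) := ⟨hn⟩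
  cases x with
  | none => rfl
  | some x =>
    have : 2 * x - x = x := by ring
    simp [prolongation, this]

theorem prolongation_row_bijective {n : ℕ} [NeZero n] (x : Option (ZMod n)) :
    Function.Bijective (prolongation n x) := by
  rw [← Finite.injective_iff_bijective]
  rintro (_ | y) (_ | y') h <;> rcases x with _ | x <;> simp only [prolongation] at h <;>
    (try split_ifs at h) <;> simp_all
  · grind
  · grind

theorem prolongation_col_bijective {n : ℕ} [NeZero n] (hn : Odd n) (y : Option (ZMod n)) :
    Function.Bijective fun x => prolongation n x y := by
  have h2 : IsUnit (2 : ZMod n) := by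
    simpa using (ZMod.isUnit_iff_coprime 2 n).2 hn.coprime_two_left
  rw [← Finite.injective_iff_bijective]
  rintro (_ | x) (_ | x') h <;> rcases y with _ | y <;> simp only [prolongation] at h <;>
    (try split_ifs at h) <;> simp_all
  · rename_i hy
    exact hy (h2.mul_left_cancel (by linear_combination h))
  · rename_i hy
    exact hy (h2.mul_left_cancel (by linear_combination -h))
  · exact h2.mul_left_cancel h

/-- Let u ≡ 2 (mod 6) with u ≥ 8, and let g, t be positive
integers with g ≡ 3 (mod 6) and t ≡ 3 (mod 6). Then there exists a
(g,t,1)-cyclic 3-HGDD of type (u,g^t). -/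
theorem exists_cyclic_hgdd_g_t_three_mod_six
    (u g t : ℕ) (humod : u % 6 = 2) (hu : 8 ≤ u)
    (hg : g % 6 = 3) (ht : t % 6 = 3) :
    ∃ ℬ : Finset (Finset (Fin u × Fin g × ZMod t)), IsCyclicHGDD u g t ℬ := by
  obtain ⟨n, rfl⟩ : ∃ n, u = n + 1 := ⟨u - 1, by omega⟩
  obtain ⟨m, rfl⟩ : ∃ m, g = 3 * m := ⟨g / 3, by omega⟩
  have : NeZero n := ⟨by omega⟩
  have : NeZero m := ⟨by rintro rfl; simp at hg⟩
  have : NeZero t := ⟨by rintro rfl; simp at ht⟩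
  have htodd : Odd t := Nat.odd_iff.2 (by omega)
  have hnodd : Odd n := Nat.odd_iff.2 (by omega)
  obtain ⟨F⟩ := exists_idempotentFamily (prolongation n) (prolongation_self (by omega))
    prolongation_row_bijective (prolongation_col_bijective hnodd) htodd
  have h2 : IsUnit (2 : ZMod t) := by
    simpa using (ZMod.isUnit_iff_coprime 2 t).2 htodd.coprime_two_left
  obtain ⟨half, hhalf⟩ := h2.exists_right_inv
  have e : Fin (n + 1) ≃ Option (ZMod n) := Fintype.equivOfCardEq (by simp [ZMod.card])
  have f : Fin (3 * m) ≃ ZMod 3 × ZMod m := Fintype.equivOfCardEq (by simp [ZMod.card])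
  exact ((F.blockCompletion half hhalf).congr e f).exists_isCyclicHGDD
end

section
/- Let u ≡ 2 (mod 6) with u ≥ 8, let g ∈ {1,2}, and let h, t be positive integers with h ≡ 3 (mod 6), t ≡ 1 or 5 (mod 6) and t ≥ 5. Then there exists an (h,gt,1)-cyclic 3-HGDD of type (u,(gh)^t). -/
/-- An (h,gt,1)-cyclic 3-HGDD of type (u,(gh)^t): blocks on
`I_u × I_h × Z_{gt}` with groups `{i} × I_h × Z_{gt}` (i ∈ I_u) and holes
`I_u × I_h × {j, t+j, ..., (g−1)t+j}` (j ∈ Z_t); two points lie in the same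
hole iff their last coordinates are congruent modulo t. No block contains two
points of the same group or of the same hole; every pair of points from
distinct groups and distinct holes lies in exactly one block; the cyclic shift
of the last coordinate maps the block set onto itself. -/
def IsCyclicHGDD2 (u h g t : ℕ)
    (ℬ : Finset (Finset (Fin u × Fin h × ZMod (g * t)))) : Prop :=
  (∀ B ∈ ℬ, B.card = 3) ∧
  (∀ B ∈ ℬ, ∀ p ∈ B, ∀ q ∈ B, p ≠ q → p.1 ≠ q.1 ∧
    ZMod.castHom (dvd_mul_left t g) (ZMod t) p.2.2 ≠
      ZMod.castHom (dvd_mul_left t g) (ZMod t) q.2.2) ∧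
  (∀ p q : Fin u × Fin h × ZMod (g * t), p.1 ≠ q.1 →
    ZMod.castHom (dvd_mul_left t g) (ZMod t) p.2.2 ≠
      ZMod.castHom (dvd_mul_left t g) (ZMod t) q.2.2 →
    ∃! B, B ∈ ℬ ∧ p ∈ B ∧ q ∈ B) ∧
  (∀ B ∈ ℬ, B.image (fun p => (p.1, p.2.1, p.2.2 + 1)) ∈ ℬ)

/-- If a family of `n` triples covers every pair of a relation `A` and `A` has at least `6 n`
(ordered) pairs, then every pair inside a triple lies in `A` and is covered only once. -/
theorem cover_tight {X I : Type*} [Fintype X] [DecidableEq X] [Fintype I]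
    (A : X × X → Prop) [DecidablePred A] (f : I → Fin 3 → X)
    (hcov : ∀ p q, A (p, q) → ∃ ι k l, k ≠ l ∧ f ι k = p ∧ f ι l = q)
    (hcard : 6 * Fintype.card I ≤ (Finset.univ.filter A).card) :
    (∀ ι k l, k ≠ l → A (f ι k, f ι l)) ∧
    (∀ ι ι' k l k' l', k ≠ l → k' ≠ l' → f ι k = f ι' k' → f ι l = f ι' l' → ι = ι') := by
  classical
  let S : Finset (I × (Fin 3 × Fin 3)) := Finset.univ ×ˢ (Finset.univ : Finset (Fin 3)).offDiag
  let F : I × (Fin 3 × Fin 3) → X × X := fun i => (f i.1 i.2.1, f i.1 i.2.2)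
  have hS : S.card = 6 * Fintype.card I := by
    simp only [S, Finset.card_product, Finset.offDiag_card, Finset.card_univ, Fintype.card_fin]
    omega
  have hsub : Finset.univ.filter A ⊆ S.image F := by
    rintro ⟨p, q⟩ h
    obtain ⟨ι, k, l, hkl, rfl, rfl⟩ := hcov p q (by simpa using h)
    exact Finset.mem_image.2 ⟨(ι, k, l), by simp [S, hkl], rfl⟩
  have himg : (S.image F).card ≤ S.card := Finset.card_image_le
  have heq : Finset.univ.filter A = S.image F :=
    Finset.eq_of_subset_of_card_le hsub (by omega)
  have hinj : Set.InjOn F S := Finset.card_image_iff.1 (by rw [← heq] at himg ⊢; omega)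
  refine ⟨fun ι k l hkl => ?_, fun ι ι' k l k' l' hkl hkl' h1 h2 => ?_⟩
  · have : F (ι, k, l) ∈ Finset.univ.filter A := by
      rw [heq]
      exact Finset.mem_image_of_mem _ (by simp [S, hkl])
    simpa using this
  · have hmem : (ι, k, l) ∈ S := by simp [S, hkl]
    have hmem' : (ι', k', l') ∈ S := by simp [S, hkl']
    exact congrArg Prod.fst (hinj hmem hmem' (Prod.ext h1 h2))

/-- A criterion for a family of triples to form a cyclic holey group divisible design. -/
theorem isCyclicHGDD2_of_cover {u h g t : ℕ} [NeZero (g * t)] {I : Type*} [Fintype I]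
    (f : I → Fin 3 → Fin u × Fin h × ZMod (g * t))
    (hcov : ∀ p q : Fin u × Fin h × ZMod (g * t), p.1 ≠ q.1 →
      ZMod.castHom (dvd_mul_left t g) (ZMod t) p.2.2 ≠
        ZMod.castHom (dvd_mul_left t g) (ZMod t) q.2.2 →
      ∃ ι k l, k ≠ l ∧ f ι k = p ∧ f ι l = q)
    (hcard : 6 * Fintype.card I ≤ (Finset.univ.filter
      fun z : (Fin u × Fin h × ZMod (g * t)) × (Fin u × Fin h × ZMod (g * t)) =>
        z.1.1 ≠ z.2.1 ∧ ZMod.castHom (dvd_mul_left t g) (ZMod t) z.1.2.2 ≠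
          ZMod.castHom (dvd_mul_left t g) (ZMod t) z.2.2.2).card)
    (hshift : ∀ ι, ∃ ι', ∀ k, f ι' k = ((f ι k).1, (f ι k).2.1, (f ι k).2.2 + 1)) :
    ∃ ℬ : Finset (Finset (Fin u × Fin h × ZMod (g * t))), IsCyclicHGDD2 u h g t ℬ := by
  obtain ⟨hadj, huniq⟩ := cover_tight _ f (fun p q hpq => hcov p q hpq.1 hpq.2) hcard
  have hne : ∀ ι k l, k ≠ l → f ι k ≠ f ι l := fun ι k l hkl he =>
    (hadj ι k l hkl).1 (congrArg Prod.fst he)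
  refine ⟨Finset.univ.image fun ι => Finset.univ.image (f ι), ?_, ?_, ?_, ?_⟩
  · simp only [Finset.mem_image, Finset.mem_univ, true_and, forall_exists_index,
      forall_apply_eq_imp_iff]
    intro ι
    rw [Finset.card_image_of_injective _ fun k l hkl => by_contra fun h => hne ι k l h hkl]
    simp
  · simp only [Finset.mem_image, Finset.mem_univ, true_and, forall_exists_index,
      forall_apply_eq_imp_iff]
    intro ι k l hkl
    exact hadj ι k l fun h => hkl (h ▸ rfl)
  · intro p q h1 h2
    obtain ⟨ι, k, l, hkl, rfl, rfl⟩ := hcov p q h1 h2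
    refine ⟨Finset.univ.image (f ι), ⟨Finset.mem_image_of_mem _ (Finset.mem_univ _),
      Finset.mem_image_of_mem _ (Finset.mem_univ _),
      Finset.mem_image_of_mem _ (Finset.mem_univ _)⟩, ?_⟩
    rintro B ⟨hB, hk, hl⟩
    obtain ⟨ι', -, rfl⟩ := Finset.mem_image.1 hB
    obtain ⟨k', -, hk'⟩ := Finset.mem_image.1 hk
    obtain ⟨l', -, hl'⟩ := Finset.mem_image.1 hl
    have hkl' : k' ≠ l' := by
      rintro rfl
      exact hne ι k l hkl (hk'.symm.trans hl')
    rw [huniq ι' ι k' l' k l hkl' hkl hk' hl']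
  · simp only [Finset.mem_image, Finset.mem_univ, true_and, forall_exists_index,
      forall_apply_eq_imp_iff]
    intro ι
    obtain ⟨ι', hι'⟩ := hshift ι
    refine ⟨ι', ?_⟩
    rw [Finset.image_image]
    exact Finset.image_congr fun k _ => hι' k

/-- Every nonzero residue modulo `2 n + 1` is `± (j + 1)` for some `j < n`. -/
theorem ZMod.exists_eq_or_eq_neg_succ {n : ℕ} {s : ZMod (2 * n + 1)} (hs : s ≠ 0) :
    ∃ j : Fin n, s = (j : ℕ) + 1 ∨ s = -((j : ℕ) + 1) := by
  have h0 : s.val ≠ 0 := fun h => hs ((ZMod.val_eq_zero s).1 h)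
  have hlt := ZMod.val_lt s
  by_cases h : s.val ≤ n
  · refine ⟨⟨s.val - 1, by omega⟩, Or.inl ?_⟩
    have : ((s.val - 1 + 1 : ℕ) : ZMod (2 * n + 1)) = s := by
      rw [Nat.sub_add_cancel (by omega), ZMod.natCast_zmod_val]
    simpa using this.symm
  · refine ⟨⟨2 * n - s.val, by omega⟩, Or.inr ?_⟩
    have : ((s.val + (2 * n - s.val + 1) : ℕ) : ZMod (2 * n + 1)) = 0 := by
      rw [show s.val + (2 * n - s.val + 1) = 2 * n + 1 by omega, ZMod.natCast_self]
    rw [Nat.cast_add, ZMod.natCast_zmod_val] at this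
    rw [eq_neg_iff_add_eq_zero]
    simpa using this

/-- A symbolic label `(z, ε, κ, μ)`; for parameters `w`, `s` it stands for the group element
`((z, κ w), (ε, μ s))`. -/
abbrev GainLabel (g : ℕ) := ZMod 3 × ZMod g × ℤ × ℤ

/-- The group element that a symbolic label stands for. -/
def GainLabel.eval {g : ℕ} (m t : ℕ) (L : GainLabel g) (w : ZMod m) (s : ZMod t) :
    (ZMod 3 × ZMod m) × (ZMod g × ZMod t) :=
  ((L.1, L.2.2.1 * w), (L.2.1, L.2.2.2 * s))

theorem GainLabel.eval_sub {g m t : ℕ} (L L' : GainLabel g) (w : ZMod m) (s : ZMod t) :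
    (L - L').eval m t w s = L.eval m t w s - L'.eval m t w s := by
  simp [GainLabel.eval, sub_mul]

theorem GainLabel.eval_neg {g m t : ℕ} (L : GainLabel g) (w : ZMod m) (s : ZMod t) :
    (-L).eval m t w s = -L.eval m t w s := by
  simp [GainLabel.eval]

/-- The labels satisfying `P` have, for every `(z, ε)`, two opposite multipliers `± μ`. -/
def GainLabel.Covers {g : ℕ} (P : GainLabel g → Prop) : Prop :=
  ∀ (z : ZMod 3) (ε : ZMod g), ∃ μ ∈ ([1, 2, 3, 4, 6] : List ℤ), ∀ σ ∈ ([1, -1] : List ℤ),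
    ∃ κ ∈ ([1, -1, 2, -2] : List ℤ), P (z, ε, κ, σ * μ)

theorem GainLabel.Covers.exists_eval {g m q : ℕ} {P : GainLabel g → Prop}
    (hP : GainLabel.Covers P) (hm : IsUnit (2 : ZMod m)) (h2 : IsUnit (2 : ZMod (2 * q + 1)))
    (h3 : IsUnit (3 : ZMod (2 * q + 1)))
    {γ : (ZMod 3 × ZMod m) × (ZMod g × ZMod (2 * q + 1))} (hγ : γ.2.2 ≠ 0) :
    ∃ L, P L ∧ ∃ (w : ZMod m) (j : Fin q), L.eval m (2 * q + 1) w ((j : ℕ) + 1) = γ := by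
  obtain ⟨⟨z, w⟩, ε, y⟩ := γ
  obtain ⟨μ, hμ, h⟩ := hP z ε
  have hμu : IsUnit (μ : ZMod (2 * q + 1)) := by
    simp only [List.mem_cons, List.not_mem_nil, or_false] at hμ
    rcases hμ with rfl | rfl | rfl | rfl | rfl
    · simp
    · exact_mod_cast h2
    · exact_mod_cast h3
    · have := h2.mul h2
      norm_num at this ⊢
      exact this
    · have := h2.mul h3
      norm_num at this ⊢
      exact this
  obtain ⟨μ', hμ'⟩ := hμu.exists_right_inv
  have hs : μ' * y ≠ 0 := by
    intro h0
    apply hγ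
    change y = 0
    rw [← one_mul y, ← hμ', mul_assoc, h0, mul_zero]
  have key : ∃ j : Fin q, ∃ σ ∈ ([1, -1] : List ℤ),
      (σ * μ : ZMod (2 * q + 1)) * ((j : ℕ) + 1) = y := by
    obtain ⟨j, hj | hj⟩ := ZMod.exists_eq_or_eq_neg_succ hs
    · refine ⟨j, 1, by simp, ?_⟩
      rw [← hj]
      push_cast
      linear_combination y * hμ'
    · refine ⟨j, -1, by simp, ?_⟩
      push_cast
      linear_combination y * hμ' - (μ : ZMod (2 * q + 1)) * hj
  obtain ⟨j, σ, hσ, hj⟩ := key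
  obtain ⟨κ, hκ, hPκ⟩ := h σ hσ
  have hκu : IsUnit (κ : ZMod m) := by
    simp only [List.mem_cons, List.not_mem_nil, or_false] at hκ
    rcases hκ with rfl | rfl | rfl | rfl
    · simp
    · simp
    · exact_mod_cast hm
    · push_cast
      exact hm.neg
  obtain ⟨κ', hκ'⟩ := hκu.exists_right_inv
  refine ⟨_, hPκ, κ' * w, j, ?_⟩
  have hw : (κ : ZMod m) * (κ' * w) = w := by rw [← mul_assoc, hκ', one_mul]
  simp [GainLabel.eval, hw, hj]

/-- Gains of labelled triples on `ZMod v ∪ {∞}`. A type `τ` labels the triple `(x - d, x, x + d)`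
with consecutive gains `a τ` and `b τ`. For `d = 1` the triples of type `(true, r)` are replaced,
edge by edge, by triples through `∞`; the labels `p r k` are the gains from `∞` to the first point
of the edge. -/
structure GainTable (g : ℕ) where
  a : Bool × Fin g → GainLabel g
  b : Bool × Fin g → GainLabel g
  p : Fin g → Fin 3 → GainLabel g
  covers : GainLabel.Covers fun L => (∃ τ, a τ = L ∨ b τ = L) ∨
    ((∃ τ, a τ + b τ = L) ∧ ∃ τ, a τ + b τ = -L)
  covers_infty : GainLabel.Covers fun L => ∃ r k, p r k = L ∨
    p r k + ![a (true, r), b (true, r), a (true, r) + b (true, r)] k = L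

/-- The gain table for `g = 1`. -/
def gainTableOne : GainTable 1 where
  a τ := if τ.1 then (0, 0, 1, -2) else (2, 0, -1, -1)
  b τ := if τ.1 then (1, 0, 1, 1) else (0, 0, -1, 2)
  p _ := ![(0, 0, 1, 1), (1, 0, 1, 1), (1, 0, -1, -1)]
  covers := by unfold GainLabel.Covers; decide
  covers_infty := by unfold GainLabel.Covers; decide

set_option maxRecDepth 10000 in
/-- The gain table for `g = 2`. -/
def gainTableTwo : GainTable 2 where
  a τ := if τ.1 then ![(1, 1, 1, -1), (2, 1, -1, -2)] τ.2 else ![(1, 1, 1, 1), (1, 0, -1, -6)] τ.2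
  b τ := if τ.1 then ![(2, 0, 1, -3), (1, 0, -1, 6)] τ.2 else ![(2, 1, 1, 2), (2, 0, -1, 3)] τ.2
  p := ![![(0, 0, 1, 3), (0, 0, 1, -3), (1, 0, -1, 2)],
    ![(1, 0, -1, -2), (2, 1, -1, -2), (2, 1, 1, 2)]]
  covers := by unfold GainLabel.Covers; decide
  covers_infty := by unfold GainLabel.Covers; decide

namespace GainTable

/-- Indices of the base triples on `ZMod (2 * (n + 1) + 1) ∪ {∞}`: the triples of types
`(false, r)` and `(true, r)`, and the triples through `∞`. -/
abbrev Idx (n g : ℕ) := (Fin (n + 1) × Fin g) ⊕ (Fin n × Fin g) ⊕ (Fin g × Fin 3)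

/-- The underlying points of a base triple, translated by `x`. -/
def pos {n g : ℕ} (x : ZMod (2 * (n + 1) + 1)) :
    Idx n g → Fin 3 → Option (ZMod (2 * (n + 1) + 1))
  | .inl (i, _) => ![some (x - ((i : ℕ) + 1)), some x, some (x + ((i : ℕ) + 1))]
  | .inr (.inl (i, _)) => ![some (x - ((i : ℕ) + 1 + 1)), some x, some (x + ((i : ℕ) + 1 + 1))]
  | .inr (.inr (_, k)) => ![none, some x, some (x + ![1, 1, 2] k)]

/-- The labels of the points of a base triple. -/
def lab {n g : ℕ} (T : GainTable g) : Idx n g → Fin 3 → GainLabel g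
  | .inl (_, r) => ![0, T.a (false, r), T.a (false, r) + T.b (false, r)]
  | .inr (.inl (_, r)) => ![0, T.a (true, r), T.a (true, r) + T.b (true, r)]
  | .inr (.inr (r, k)) => ![0, T.p r k, T.p r k +
      ![T.a (true, r), T.b (true, r), T.a (true, r) + T.b (true, r)] k]

/-- The pair `(p, q)` occurs with gain `γ` in some base triple. -/
def Realizes {g : ℕ} (T : GainTable g) (n m q : ℕ) (p p' : Option (ZMod (2 * (n + 1) + 1)))
    (γ : (ZMod 3 × ZMod m) × (ZMod g × ZMod (2 * q + 1))) : Prop :=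
  ∃ (i : Idx n g) (x : ZMod (2 * (n + 1) + 1)) (w : ZMod m) (j : Fin q) (k l : Fin 3), k ≠ l ∧
    pos x i k = p ∧ pos x i l = p' ∧
      (T.lab i l - T.lab i k).eval m (2 * q + 1) w ((j : ℕ) + 1) = γ

variable {g n m q : ℕ}

theorem Realizes.symm {T : GainTable g} {p p' : Option (ZMod (2 * (n + 1) + 1))}
    {γ : (ZMod 3 × ZMod m) × (ZMod g × ZMod (2 * q + 1))} (h : T.Realizes n m q p p' γ) :
    T.Realizes n m q p' p (-γ) := by
  obtain ⟨i, x, w, j, k, l, hkl, hp, hp', rfl⟩ := h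
  refine ⟨i, x, w, j, l, k, hkl.symm, hp', hp, ?_⟩
  rw [← GainLabel.eval_neg, neg_sub]

theorem realizes_triple (T : GainTable g) (i : Fin (n + 1)) (τ : Bool × Fin g) (x : ZMod (2 * (n + 1) + 1))
    (w : ZMod m) (j : Fin q) :
    T.Realizes n m q (some (x - ((i : ℕ) + 1))) (some x)
      ((T.a τ).eval m (2 * q + 1) w ((j : ℕ) + 1)) ∧
    T.Realizes n m q (some x) (some (x + ((i : ℕ) + 1)))
      ((T.b τ).eval m (2 * q + 1) w ((j : ℕ) + 1)) ∧
    T.Realizes n m q (some (x - ((i : ℕ) + 1))) (some (x + ((i : ℕ) + 1)))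
      ((T.a τ + T.b τ).eval m (2 * q + 1) w ((j : ℕ) + 1)) := by
  obtain ⟨_ | _, r⟩ := τ
  · refine ⟨⟨.inl (i, r), x, w, j, 0, 1, ?_⟩, ⟨.inl (i, r), x, w, j, 1, 2, ?_⟩,
      ⟨.inl (i, r), x, w, j, 0, 2, ?_⟩⟩ <;> simp [pos, lab]
  · induction i using Fin.cases with
    | zero =>
      refine ⟨⟨.inr (.inr (r, 0)), x - 1, w, j, 1, 2, ?_⟩,
        ⟨.inr (.inr (r, 1)), x, w, j, 1, 2, ?_⟩,
        ⟨.inr (.inr (r, 2)), x - 1, w, j, 1, 2, ?_⟩⟩ <;> simp [pos, lab]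
      ring
    | succ i =>
      refine ⟨⟨.inr (.inl (i, r)), x, w, j, 0, 1, ?_⟩, ⟨.inr (.inl (i, r)), x, w, j, 1, 2, ?_⟩,
        ⟨.inr (.inl (i, r)), x, w, j, 0, 2, ?_⟩⟩ <;> simp [pos, lab]

theorem realizes_edge (T : GainTable g) (hm : IsUnit (2 : ZMod m)) (h2 : IsUnit (2 : ZMod (2 * q + 1)))
    (h3 : IsUnit (3 : ZMod (2 * q + 1))) (x e : ZMod (2 * (n + 1) + 1)) (i : Fin (n + 1))
    (he : e = (i : ℕ) + 1) (he0 : e ≠ 0)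
    {γ : (ZMod 3 × ZMod m) × (ZMod g × ZMod (2 * q + 1))} (hγ : γ.2.2 ≠ 0) :
    T.Realizes n m q (some x) (some (x + e)) γ := by
  obtain ⟨L, hL, w, j, rfl⟩ := T.covers.exists_eval hm h2 h3 hγ
  rcases hL with ⟨τ, rfl | rfl⟩ | ⟨⟨τ, hτ⟩, τ', hτ'⟩
  · have := (T.realizes_triple i τ (x + e) w j).1
    rwa [← he, add_sub_cancel_right] at this
  · have := (T.realizes_triple i τ x w j).2.1
    rwa [← he] at this
  · obtain ⟨d, hd⟩ : ∃ d : ZMod (2 * (n + 1) + 1), d + d = e := by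
      refine ⟨e * ((n + 2 : ℕ)), ?_⟩
      have : ((2 * (n + 1) + 1 : ℕ) : ZMod (2 * (n + 1) + 1)) = 0 := ZMod.natCast_self _
      push_cast at this ⊢
      linear_combination e * this
    have hd0 : d ≠ 0 := by
      rintro rfl
      exact he0 (by simpa using hd.symm)
    obtain ⟨i', hi' | hi'⟩ := ZMod.exists_eq_or_eq_neg_succ hd0
    · have := (T.realizes_triple i' τ (x + d) w j).2.2
      rwa [← hi', add_sub_cancel_right, add_assoc, hd, hτ] at this
    · have := (T.realizes_triple i' τ' (x + d) w j).2.2.symm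
      rwa [hτ', GainLabel.eval_neg, neg_neg, ← neg_eq_iff_eq_neg.2 hi', sub_neg_eq_add,
        ← sub_eq_add_neg, add_sub_cancel_right, add_assoc, hd] at this

theorem realizes (T : GainTable g) (hm : IsUnit (2 : ZMod m)) (h2 : IsUnit (2 : ZMod (2 * q + 1)))
    (h3 : IsUnit (3 : ZMod (2 * q + 1))) {p p' : Option (ZMod (2 * (n + 1) + 1))} (hp : p ≠ p')
    {γ : (ZMod 3 × ZMod m) × (ZMod g × ZMod (2 * q + 1))} (hγ : γ.2.2 ≠ 0) :
    T.Realizes n m q p p' γ := by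
  have infty : ∀ (y : ZMod (2 * (n + 1) + 1))
      (γ : (ZMod 3 × ZMod m) × (ZMod g × ZMod (2 * q + 1))), γ.2.2 ≠ 0 →
      T.Realizes n m q none (some y) γ := by
    intro y γ hγ
    obtain ⟨L, ⟨r, k, hL | hL⟩, w, j, rfl⟩ := T.covers_infty.exists_eval hm h2 h3 hγ
    · exact ⟨.inr (.inr (r, k)), y, w, j, 0, 1, by simp [pos, lab, hL]⟩
    · exact ⟨.inr (.inr (r, k)), y - ![1, 1, 2] k, w, j, 0, 2, by simp [pos, lab, hL]⟩
  have hγ' : (-γ).2.2 ≠ 0 := neg_ne_zero.2 hγ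
  rcases p with _ | x <;> rcases p' with _ | y
  · exact absurd rfl hp
  · exact infty y γ hγ
  · simpa using (infty x (-γ) hγ').symm
  · have hxy : y - x ≠ 0 := fun h => hp (by rw [sub_eq_zero.1 h])
    obtain ⟨i, hi | hi⟩ := ZMod.exists_eq_or_eq_neg_succ hxy
    · simpa using T.realizes_edge hm h2 h3 x (y - x) i hi hxy hγ
    · have := (T.realizes_edge hm h2 h3 y (x - y) i (by rw [← neg_sub, hi, neg_neg])
        (by rw [← neg_sub]; exact neg_ne_zero.2 hxy) hγ').symm
      simpa using this

/-- A gain table yields cyclic holey group divisible designs. -/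
theorem exists_isCyclicHGDD2 (T : GainTable g) (hg : 0 < g) (hm0 : 0 < m) (hm : IsUnit (2 : ZMod m))
    (h2 : IsUnit (2 : ZMod (2 * q + 1))) (h3 : IsUnit (3 : ZMod (2 * q + 1)))
    (hgt : Nat.Coprime g (2 * q + 1)) :
    ∃ ℬ : Finset (Finset (Fin (2 * (n + 1) + 2) × Fin (3 * m) × ZMod (g * (2 * q + 1)))),
      IsCyclicHGDD2 (2 * (n + 1) + 2) (3 * m) g (2 * q + 1) ℬ := by
  have : NeZero g := ⟨hg.ne'⟩
  have : NeZero m := ⟨hm0.ne'⟩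
  have : NeZero (g * (2 * q + 1)) := ⟨by positivity⟩
  let crt := ZMod.chineseRemainder hgt
  have hcast : ∀ x, ZMod.castHom (dvd_mul_left (2 * q + 1) g) (ZMod (2 * q + 1)) x = (crt x).2 :=
    fun x => RingHom.congr_fun (Subsingleton.elim (ZMod.castHom _ (ZMod (2 * q + 1)))
      ((RingHom.snd _ _).comp crt.toRingHom)) x
  let eU : Option (ZMod (2 * (n + 1) + 1)) ≃ Fin (2 * (n + 1) + 2) :=
    Fintype.equivFinOfCardEq (by simp [ZMod.card])
  let eH : ZMod 3 × ZMod m ≃ Fin (3 * m) := Fintype.equivFinOfCardEq (by simp [ZMod.card])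
  let f : (Idx n g × ZMod (2 * (n + 1) + 1) × (ZMod m × Fin q)) ×
      ((ZMod 3 × ZMod m) × (ZMod g × ZMod (2 * q + 1))) → Fin 3 →
      Fin (2 * (n + 1) + 2) × Fin (3 * m) × ZMod (g * (2 * q + 1)) := fun ι k =>
    let y := ι.2 + (T.lab ι.1.1 k).eval m (2 * q + 1) ι.1.2.2.1 ((ι.1.2.2.2 : ℕ) + 1)
    (eU (pos ι.1.2.1 ι.1.1 k), eH y.1, crt.symm y.2)
  refine isCyclicHGDD2_of_cover f ?_ ?_ ?_
  · rintro ⟨p, a, x⟩ ⟨p', a', x'⟩ hp hx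
    rw [hcast, hcast] at hx
    obtain ⟨i, y, w, j, k, l, hkl, h1, h2', h3'⟩ := T.realizes (n := n) hm h2 h3
      (p := eU.symm p) (p' := eU.symm p') (fun h => hp (eU.symm.injective h))
      (γ := (eH.symm a', crt x') - (eH.symm a, crt x)) (sub_ne_zero.2 hx.symm)
    rw [GainLabel.eval_sub] at h3'
    refine ⟨((i, y, w, j), (eH.symm a, crt x) -
      (T.lab i k).eval m (2 * q + 1) w ((j : ℕ) + 1)), k, l, hkl, ?_, ?_⟩
    · simp only [f, sub_add_cancel, h1, Equiv.apply_symm_apply, RingEquiv.symm_apply_apply]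
    · simp only [f]
      rw [sub_add_eq_add_sub, add_sub_assoc, h3', add_sub_cancel, h2']
      simp
  · let S := (Finset.univ : Finset (Fin (2 * (n + 1) + 2))).offDiag ×ˢ
      ((Finset.univ : Finset (ZMod (2 * q + 1))).offDiag ×ˢ
        (Finset.univ : Finset ((Fin (3 * m) × Fin (3 * m)) × (ZMod g × ZMod g))))
    have hS : S.card = 6 * Fintype.card ((Idx n g × ZMod (2 * (n + 1) + 1) × (ZMod m × Fin q)) ×
        ((ZMod 3 × ZMod m) × (ZMod g × ZMod (2 * q + 1)))) := by
      simp only [S, Finset.card_product, Finset.offDiag_card, Finset.card_univ, Fintype.card_prod,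
        Fintype.card_sum, Fintype.card_fin, ZMod.card, ← Nat.mul_sub_one]
      have e1 : 2 * (n + 1) + 2 - 1 = 2 * (n + 1) + 1 := by omega
      have e2 : 2 * q + 1 - 1 = 2 * q := by omega
      rw [e1, e2]
      ring
    rw [← hS]
    refine Finset.card_le_card_of_injOn (fun z => ((z.1.1, z.2.2.1.1, crt.symm (z.2.2.2.1, z.2.1.1)),
      (z.1.2, z.2.2.1.2, crt.symm (z.2.2.2.2, z.2.1.2)))) ?_ ?_
    · rintro ⟨⟨p, p'⟩, ⟨y, y'⟩, ⟨a, a'⟩, ε, ε'⟩ hz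
      simp only [S, Finset.coe_product, Set.mem_prod, Finset.mem_coe, Finset.mem_offDiag] at hz
      simp only [Finset.coe_filter, Set.mem_ofPred_eq, hcast, RingEquiv.apply_symm_apply]
      exact ⟨Finset.mem_univ _, hz.1.2.2, hz.2.1.2.2⟩
    · rintro ⟨⟨p, p'⟩, ⟨y, y'⟩, ⟨a, a'⟩, ε, ε'⟩ - ⟨⟨r, r'⟩, ⟨z, z'⟩, ⟨b, b'⟩, δ, δ'⟩ - hz
      simp only [Prod.mk.injEq, EmbeddingLike.apply_eq_iff_eq] at hz ⊢
      tauto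
  · rintro ⟨i, y⟩
    refine ⟨(i, y + (0, 1)), fun k => ?_⟩
    simp only [f, add_right_comm y]
    rw [← map_one crt.symm, ← map_add]
    simp only [Prod.fst_add, Prod.snd_add, add_zero, Prod.one_eq_mk]

end GainTable

/-- Let u ≡ 2 (mod 6) with u ≥ 8, let g ∈ {1,2}, and let h, t be
positive integers with h ≡ 3 (mod 6), t ≡ 1 or 5 (mod 6) and t ≥ 5. Then there
exists an (h,gt,1)-cyclic 3-HGDD of type (u,(gh)^t). -/
theorem exists_cyclic_hgdd2
    (u g h t : ℕ) (humod : u % 6 = 2) (hu : 8 ≤ u) (hg : g = 1 ∨ g = 2)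
    (hh : h % 6 = 3) (ht : t % 6 = 1 ∨ t % 6 = 5) (ht5 : 5 ≤ t) :
    ∃ ℬ : Finset (Finset (Fin u × Fin h × ZMod (g * t))),
      IsCyclicHGDD2 u h g t ℬ := by
  have isUnit_two : ∀ k : ℕ, k % 2 = 1 → IsUnit (2 : ZMod k) := fun k hk => by
    have := (ZMod.isUnit_iff_coprime 2 k).2 (Nat.coprime_two_left.2 (Nat.odd_iff.2 hk))
    exact_mod_cast this
  have isUnit_three : IsUnit (3 : ZMod t) := by
    have := (ZMod.isUnit_iff_coprime 3 t).2
      ((Nat.Prime.coprime_iff_not_dvd Nat.prime_three).2 (by omega))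
    exact_mod_cast this
  obtain ⟨n, rfl⟩ : ∃ n, u = 2 * (n + 1) + 2 := ⟨u / 2 - 2, by omega⟩
  obtain ⟨m, rfl⟩ : ∃ m, h = 3 * m := ⟨h / 3, by omega⟩
  obtain ⟨q, rfl⟩ : ∃ q, t = 2 * q + 1 := ⟨t / 2, by omega⟩
  have hm : IsUnit (2 : ZMod m) := isUnit_two m (by omega)
  have h2 : IsUnit (2 : ZMod (2 * q + 1)) := isUnit_two _ (by omega)
  rcases hg with rfl | rfl
  · exact gainTableOne.exists_isCyclicHGDD2 one_pos (by omega) hm h2 isUnit_three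
      (Nat.coprime_one_left _)
  · exact gainTableTwo.exists_isCyclicHGDD2 two_pos (by omega) hm h2 isUnit_three
      (Nat.coprime_two_left.2 (odd_two_mul_add_one q))
end

section
/- For every odd prime p there exists a 3-SCIHGDD of type (8,2,1^p). -/
/-- Ordered triples on eight points covering every ordered pair of distinct points not both in
`{6, 7}` exactly once (see `exists_baseTriple` and `baseTriple_unique`), such that a pair and its
reverse occur at the same distance (see `baseTriple_reverse`). -/
def baseTriple : Fin 18 → Fin 3 → Fin 8 :=
  ![![1, 0, 3], ![0, 1, 7], ![2, 6, 0], ![0, 6, 2], ![4, 3, 0], ![0, 5, 4],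
    ![7, 5, 0], ![2, 5, 1], ![1, 5, 2], ![3, 7, 1], ![4, 6, 1], ![1, 6, 4],
    ![3, 4, 2], ![2, 7, 3], ![7, 2, 4], ![5, 3, 6], ![6, 3, 5], ![4, 5, 7]]

theorem baseTriple_pair : ∀ t k l, k ≠ l → baseTriple t k ≠ baseTriple t l ∧
    ¬((baseTriple t k = 6 ∨ baseTriple t k = 7) ∧ (baseTriple t l = 6 ∨ baseTriple t l = 7)) := by
  decide +kernel

theorem exists_baseTriple : ∀ i j : Fin 8, i ≠ j → ¬((i = 6 ∨ i = 7) ∧ (j = 6 ∨ j = 7)) →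
    ∃ t k l, k < l ∧ baseTriple t k = i ∧ baseTriple t l = j := by
  decide +kernel

theorem baseTriple_unique : ∀ t k l t' k' l', k < l → k' < l' →
    baseTriple t k = baseTriple t' k' → baseTriple t l = baseTriple t' l' →
    t = t' ∧ k = k' ∧ l = l' := by
  decide +kernel

theorem baseTriple_reverse : ∀ t k l t' k' l', k < l → k' < l' →
    baseTriple t k = baseTriple t' l' → baseTriple t l = baseTriple t' k' →
    l.val + k'.val = k.val + l'.val := by
  decide +kernel

/-- The block obtained by placing the points of `baseTriple t` on the arithmetic progression with
first term `c` and common difference `s`. -/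
def progressionBlock (n : ℕ) (t : Fin 18) (c s : ZMod n) : Finset (Fin 8 × ZMod n) :=
  Finset.univ.image fun k : Fin 3 => (baseTriple t k, c + (k.val : ZMod n) * s)

theorem mem_progressionBlock {n : ℕ} {t : Fin 18} {c s : ZMod n} {x : Fin 8 × ZMod n} :
    x ∈ progressionBlock n t c s ↔
      ∃ k : Fin 3, x.1 = baseTriple t k ∧ x.2 = c + (k.val : ZMod n) * s := by
  simp [progressionBlock, Prod.ext_iff, eq_comm]

theorem card_progressionBlock (n : ℕ) (t : Fin 18) (c s : ZMod n) :
    (progressionBlock n t c s).card = 3 := by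
  rw [progressionBlock, Finset.card_image_of_injective _ fun k l h => ?_]
  · simp
  · by_contra hkl
    exact (baseTriple_pair t k l hkl).1 (Prod.ext_iff.1 h).1

theorem image_progressionBlock (n : ℕ) (t : Fin 18) (c s : ZMod n) :
    (progressionBlock n t c s).image (fun x => (x.1, x.2 + 1)) =
      progressionBlock n t (c + 1) s := by
  rw [progressionBlock, Finset.image_image, progressionBlock]
  congr 1
  ext k : 1
  simp [add_right_comm]

/-- Over a field of odd prime order, distinct positions in a triple stay distinct. -/
theorem natCast_sub_ne_zero {p : ℕ} [Fact p.Prime] (hodd : Odd p) {k l : Fin 3} (hkl : k ≠ l) :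
    (l.val : ZMod p) - (k.val : ZMod p) ≠ 0 := by
  have hp2 : p ≠ 2 := by
    rintro rfl
    exact absurd hodd (by decide)
  have hp : 2 < p := lt_of_le_of_ne (Fact.out : p.Prime).two_le hp2.symm
  intro h
  have h' : ((l.val : ℕ) : ZMod p) = (k.val : ℕ) := sub_eq_zero.1 h
  rw [ZMod.natCast_eq_natCast_iff'] at h'
  rw [Nat.mod_eq_of_lt (by omega), Nat.mod_eq_of_lt (by omega)] at h'
  exact hkl (Fin.ext h'.symm)

/-- In odd characteristic the nonzero residues split into a half-system and its negative. -/
theorem two_mul_val_neg_lt_iff {p : ℕ} [Fact p.Prime] (hodd : Odd p) {s : ZMod p} (hs : s ≠ 0) :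
    2 * (-s).val < p ↔ ¬ 2 * s.val < p := by
  have : NeZero s := ⟨hs⟩
  rw [ZMod.val_neg_of_ne_zero]
  have := ZMod.val_lt s
  obtain ⟨m, rfl⟩ := hodd
  omega

/-- All blocks whose common difference lies in the lower half of the nonzero residues. -/
def progressionBlocks (p : ℕ) [NeZero p] : Finset (Finset (Fin 8 × ZMod p)) :=
  (Finset.univ.filter fun a : Fin 18 × ZMod p × ZMod p => a.2.2 ≠ 0 ∧ 2 * a.2.2.val < p).image
    fun a => progressionBlock p a.1 a.2.1 a.2.2

theorem mem_progressionBlocks {p : ℕ} [NeZero p] {B : Finset (Fin 8 × ZMod p)} :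
    B ∈ progressionBlocks p ↔
      ∃ t c s, s ≠ 0 ∧ 2 * s.val < p ∧ progressionBlock p t c s = B := by
  simp [progressionBlocks, and_assoc]

theorem exists_mem_progressionBlocks {p : ℕ} [Fact p.Prime] (hodd : Odd p)
    {x y : Fin 8 × ZMod p} (h₁ : x.1 ≠ y.1) (h₂ : x.2 ≠ y.2)
    (hY : ¬((x.1 = 6 ∨ x.1 = 7) ∧ (y.1 = 6 ∨ y.1 = 7))) :
    ∃ B ∈ progressionBlocks p, x ∈ B ∧ y ∈ B := by
  obtain ⟨t, k, l, hkl, hk, hl⟩ := exists_baseTriple x.1 y.1 h₁ hY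
  obtain ⟨t', k', l', hkl', hk', hl'⟩ := exists_baseTriple y.1 x.1 h₁.symm fun h => hY h.symm
  have hrev := baseTriple_reverse t k l t' k' l' hkl hkl' (hk.trans hl'.symm) (hl.trans hk'.symm)
  have hm := natCast_sub_ne_zero (p := p) hodd hkl.ne
  have hm' : (l'.val : ZMod p) - k'.val = l.val - k.val := by
    have : ((l.val + k'.val : ℕ) : ZMod p) = (k.val + l'.val : ℕ) := by rw [hrev]
    push_cast at this
    linear_combination -this
  set m : ZMod p := (l.val : ZMod p) - k.val with hmdef
  have hs : (y.2 - x.2) / m ≠ 0 := div_ne_zero (sub_ne_zero.2 h₂.symm) hm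
  have hms : m * ((y.2 - x.2) / m) = y.2 - x.2 := mul_div_cancel₀ _ hm
  generalize (y.2 - x.2) / m = s at hs hms
  by_cases hS : 2 * s.val < p
  · refine ⟨_, mem_progressionBlocks.2 ⟨t, x.2 - k.val * s, s, hs, hS, rfl⟩,
      mem_progressionBlock.2 ⟨k, hk.symm, by ring⟩, mem_progressionBlock.2 ⟨l, hl.symm, ?_⟩⟩
    rw [hmdef] at hms
    linear_combination -hms
  · refine ⟨_, mem_progressionBlocks.2 ⟨t', y.2 - k'.val * (-s), -s, neg_ne_zero.2 hs,
      (two_mul_val_neg_lt_iff hodd hs).2 hS, rfl⟩,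
      mem_progressionBlock.2 ⟨l', hl'.symm, ?_⟩, mem_progressionBlock.2 ⟨k', hk'.symm, by ring⟩⟩
    linear_combination s * hm' + hms

theorem eq_of_mem_progressionBlocks {p : ℕ} [Fact p.Prime] (hodd : Odd p)
    {x y : Fin 8 × ZMod p} (h₁ : x.1 ≠ y.1) {B B' : Finset (Fin 8 × ZMod p)}
    (hB : B ∈ progressionBlocks p) (hxB : x ∈ B) (hyB : y ∈ B)
    (hB' : B' ∈ progressionBlocks p) (hxB' : x ∈ B') (hyB' : y ∈ B') : B = B' := by
  obtain ⟨t, c, s, hs, hS, rfl⟩ := mem_progressionBlocks.1 hB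
  obtain ⟨t', c', s', hs', hS', rfl⟩ := mem_progressionBlocks.1 hB'
  obtain ⟨k, hk, hxk⟩ := mem_progressionBlock.1 hxB
  obtain ⟨l, hl, hyl⟩ := mem_progressionBlock.1 hyB
  obtain ⟨k', hk', hxk'⟩ := mem_progressionBlock.1 hxB'
  obtain ⟨l', hl', hyl'⟩ := mem_progressionBlock.1 hyB'
  have hkl : k ≠ l := by
    rintro rfl
    exact h₁ (hk.trans hl.symm)
  have hkl' : k' ≠ l' := by
    rintro rfl
    exact h₁ (hk'.trans hl'.symm)
  have hm := natCast_sub_ne_zero (p := p) hodd hkl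
  have same : t = t' ∧ k = k' ∧ l = l' →
      progressionBlock p t c s = progressionBlock p t' c' s' := by
    rintro ⟨rfl, rfl, rfl⟩
    have hss : s = s' := mul_left_cancel₀ hm (by linear_combination hxk - hyl - hxk' + hyl')
    subst hss
    have hcc : c = c' := by linear_combination hxk' - hxk
    rw [hcc]
  have opposite : l.val + l'.val = k.val + k'.val → False := by
    intro h
    have h' : ((l.val + l'.val : ℕ) : ZMod p) = (k.val + k'.val : ℕ) := by rw [h]
    push_cast at h'
    have hss : s' = -s := mul_left_cancel₀ hm (by
      linear_combination hxk - hyl - hxk' + hyl' + s' * h')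
    rw [hss] at hS'
    exact (two_mul_val_neg_lt_iff hodd hs).1 hS' hS
  rcases lt_or_gt_of_ne hkl with h | h <;> rcases lt_or_gt_of_ne hkl' with h' | h'
  · exact same (baseTriple_unique t k l t' k' l' h h' (hk.symm.trans hk') (hl.symm.trans hl'))
  · exact (opposite (baseTriple_reverse t k l t' l' k' h h' (hk.symm.trans hk')
      (hl.symm.trans hl'))).elim
  · exact (opposite (baseTriple_reverse t l k t' k' l' h h' (hl.symm.trans hl')
      (hk.symm.trans hk')).symm).elim
  · obtain ⟨h₁, h₂, h₃⟩ :=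
      baseTriple_unique t l k t' l' k' h h' (hl.symm.trans hl') (hk.symm.trans hk')
    exact same ⟨h₁, h₃, h₂⟩


/-- A 3-SCIHGDD of type (8,2,1^t) with distinguished groups indexed by `a` and
`b` (a ≠ b): blocks on `I_8 × Z_t` with groups `{i} × Z_t`, holes
`I_8 × {j}`, and `Y = ({a} ∪ {b}) × Z_t`. No block contains two points of the
same group, two points of the same hole, or two points of Y; every pair of
points from distinct groups and distinct holes not both in Y lies in exactly
one block; the cyclic shift of the second coordinate maps the block set onto
itself. -/
def IsSCIHGDD (t : ℕ) (a b : Fin 8) (ℬ : Finset (Finset (Fin 8 × ZMod t))) : Prop :=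
  (∀ B ∈ ℬ, B.card = 3) ∧
  (∀ B ∈ ℬ, ∀ p ∈ B, ∀ q ∈ B, p ≠ q →
    p.1 ≠ q.1 ∧ p.2 ≠ q.2 ∧
    ¬((p.1 = a ∨ p.1 = b) ∧ (q.1 = a ∨ q.1 = b))) ∧
  (∀ p q : Fin 8 × ZMod t, p.1 ≠ q.1 → p.2 ≠ q.2 →
    ¬((p.1 = a ∨ p.1 = b) ∧ (q.1 = a ∨ q.1 = b)) →
    ∃! B, B ∈ ℬ ∧ p ∈ B ∧ q ∈ B) ∧
  (∀ B ∈ ℬ, B.image (fun p => (p.1, p.2 + 1)) ∈ ℬ)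

/-- For every odd prime p there exists a 3-SCIHGDD of type
(8,2,1^p). -/
theorem exists_scihgdd_odd_prime (p : ℕ) (hp : p.Prime) (hodd : Odd p) :
    ∃ (a b : Fin 8) (ℬ : Finset (Finset (Fin 8 × ZMod p))),
      a ≠ b ∧ IsSCIHGDD p a b ℬ := by
  have : Fact p.Prime := ⟨hp⟩
  refine ⟨6, 7, progressionBlocks p, by decide, ?_, ?_, ?_, ?_⟩
  · intro B hB
    obtain ⟨t, c, s, -, -, rfl⟩ := mem_progressionBlocks.1 hB
    exact card_progressionBlock p t c s
  · intro B hB x hx y hy hxy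
    obtain ⟨t, c, s, hs, -, rfl⟩ := mem_progressionBlocks.1 hB
    obtain ⟨k, hk, hxk⟩ := mem_progressionBlock.1 hx
    obtain ⟨l, hl, hyl⟩ := mem_progressionBlock.1 hy
    have hkl : k ≠ l := by
      rintro rfl
      exact hxy (Prod.ext (hk.trans hl.symm) (hxk.trans hyl.symm))
    obtain ⟨hne, hY⟩ := baseTriple_pair t k l hkl
    rw [hk, hl]
    refine ⟨hne, fun h => ?_, hY⟩
    refine mul_ne_zero (natCast_sub_ne_zero hodd hkl) hs ?_
    linear_combination hxk - hyl - h
  · intro x y h₁ h₂ hY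
    obtain ⟨B, hB, hxB, hyB⟩ := exists_mem_progressionBlocks hodd h₁ h₂ hY
    exact ⟨B, ⟨hB, hxB, hyB⟩, fun B' ⟨hB', hxB', hyB'⟩ =>
      eq_of_mem_progressionBlocks hodd h₁ hB' hxB' hyB' hB hxB hyB⟩
  · intro B hB
    obtain ⟨t, c, s, hs, hS, rfl⟩ := mem_progressionBlocks.1 hB
    exact mem_progressionBlocks.2 ⟨t, c + 1, s, hs, hS, (image_progressionBlock p t c s).symm⟩
end

section
/- For every odd integer t ≥ 3 there exists a 3-SCIHGDD of type (8,2,1^t). -/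
/-- A decomposition of the complete digraph on `Fin 8`, with both arcs between `6` and `7` removed,
into transitive triples `(i, j, k)` with arcs `i → j`, `j → k`, `i → k`, such that the arc `i → k`
is the outer arc of its triple if and only if the arc `k → i` is the outer arc of its triple. -/
def transitiveTriple : Fin 18 → Fin 3 → Fin 8 :=
  ![![0, 1, 7], ![0, 2, 4], ![0, 3, 5], ![1, 2, 5], ![1, 3, 4], ![2, 1, 6],
    ![2, 3, 7], ![3, 0, 6], ![4, 3, 1], ![4, 5, 7], ![4, 6, 0], ![5, 2, 0],
    ![5, 6, 1], ![6, 4, 2], ![6, 5, 3], ![7, 1, 0], ![7, 3, 2], ![7, 5, 4]]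

theorem transitiveTriple_injective (c : Fin 18) : Function.Injective (transitiveTriple c) := by
  revert c
  unfold Function.Injective
  decide

theorem transitiveTriple_not_both (c : Fin 18) (u v : Fin 3) (h : u ≠ v) :
    ¬((transitiveTriple c u = 6 ∨ transitiveTriple c u = 7) ∧
      (transitiveTriple c v = 6 ∨ transitiveTriple c v = 7)) := by
  revert c u v
  decide

set_option maxRecDepth 100000 in
theorem exists_transitiveTriple (i j : Fin 8) (hij : i ≠ j)
    (h : ¬((i = 6 ∨ i = 7) ∧ (j = 6 ∨ j = 7))) :
    ∃ u v : Fin 3, u ≠ v ∧ (∃ c, transitiveTriple c u = i ∧ transitiveTriple c v = j) ∧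
      ∃ u' v' : Fin 3, u.val + u'.val = v.val + v'.val ∧
        ∃ c, transitiveTriple c u' = i ∧ transitiveTriple c v' = j := by
  revert i j
  decide

set_option maxRecDepth 100000 in
theorem transitiveTriple_unique (c c' : Fin 18) (u v u' v' : Fin 3) (h : u ≠ v)
    (hu : transitiveTriple c u = transitiveTriple c' u')
    (hv : transitiveTriple c v = transitiveTriple c' v') :
    (c = c' ∧ u = u' ∧ v = v') ∨ u.val + u'.val = v.val + v'.val := by
  have key : ∀ u v : Fin 3, u ≠ v → ∀ (c c' : Fin 18) (u' : Fin 3),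
      transitiveTriple c u = transitiveTriple c' u' → ∀ v' : Fin 3,
      transitiveTriple c v = transitiveTriple c' v' →
      (c = c' ∧ u = u' ∧ v = v') ∨ u.val + u'.val = v.val + v'.val := by
    decide
  exact key u v h c c' u' hu v' hv

theorem ZMod.isUnit_two_of_odd {t : ℕ} (ht : Odd t) : IsUnit (2 : ZMod t) := by
  have := (ZMod.isUnit_iff_coprime 2 t).2 ht.coprime_two_left
  exact_mod_cast this

theorem ZMod.isUnit_fin_three_sub {t : ℕ} (ht : Odd t) {u v : Fin 3} (h : u ≠ v) :
    IsUnit ((v.val : ZMod t) - (u.val : ZMod t)) := by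
  have h2 := ZMod.isUnit_two_of_odd ht
  fin_cases u <;> fin_cases v <;> first | exact absurd rfl h | skip
  all_goals norm_num
  all_goals exact h2

/-- For odd `t`, the residues `1, …, (t - 1) / 2` contain exactly one of `x`, `-x` for each
nonzero `x`. -/
theorem ZMod.exists_half_system {t : ℕ} (ht : Odd t) :
    ∃ P : ZMod t → Prop, (∀ x, x ≠ 0 → P x ∨ P (-x)) ∧ ∀ x, P x → ¬ P (-x) := by
  have : NeZero t := ⟨by rintro rfl; simp at ht⟩
  obtain ⟨m, rfl⟩ := ht
  refine ⟨fun x => x ≠ 0 ∧ x.val ≤ m, fun x hx => ?_, fun x hx hx' => ?_⟩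
  · have : NeZero x := ⟨hx⟩
    have hneg := ZMod.val_neg_of_ne_zero x
    simp only [ne_eq, neg_eq_zero, hx, not_false_eq_true, true_and]
    omega
  · have : NeZero x := ⟨hx.1⟩
    have hneg := ZMod.val_neg_of_ne_zero x
    have := ZMod.val_lt x
    have := hx.2
    have := hx'.2
    omega

/-- The base block `{(i, 0), (j, x), (k, 2x)}` on the `c`-th transitive triple `(i, j, k)`,
translated by `s`. -/
def tripleBlock {t : ℕ} (c : Fin 18) (x s : ZMod t) : Finset (Fin 8 × ZMod t) :=
  Finset.univ.image fun u : Fin 3 => (transitiveTriple c u, s + u.val * x)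

theorem mem_tripleBlock {t : ℕ} {c : Fin 18} {x s : ZMod t} {p : Fin 8 × ZMod t} :
    p ∈ tripleBlock c x s ↔
      ∃ u : Fin 3, transitiveTriple c u = p.1 ∧ s + u.val * x = p.2 := by
  simp [tripleBlock, Prod.ext_iff]

theorem card_tripleBlock {t : ℕ} (c : Fin 18) (x s : ZMod t) : (tripleBlock c x s).card = 3 := by
  rw [tripleBlock, Finset.card_image_of_injective, Finset.card_univ, Fintype.card_fin]
  intro u v h
  exact transitiveTriple_injective c (Prod.ext_iff.1 h).1

theorem image_add_one_tripleBlock {t : ℕ} (c : Fin 18) (x s : ZMod t) :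
    (tripleBlock c x s).image (fun p => (p.1, p.2 + 1)) = tripleBlock c x (s + 1) := by
  rw [tripleBlock, tripleBlock, Finset.image_image]
  congr 1
  funext u
  simp only [Function.comp_apply]
  congr 1
  ring

theorem tripleBlock_unique {t : ℕ} (ht : Odd t) {P : ZMod t → Prop}
    (hP : ∀ x, P x → ¬ P (-x)) {c c' : Fin 18} {x x' s s' : ZMod t} (hx : P x) (hx' : P x')
    {p q : Fin 8 × ZMod t} (hpq : p.1 ≠ q.1)
    (hp : p ∈ tripleBlock c x s) (hq : q ∈ tripleBlock c x s)
    (hp' : p ∈ tripleBlock c' x' s') (hq' : q ∈ tripleBlock c' x' s') :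
    tripleBlock c x s = tripleBlock c' x' s' := by
  rw [mem_tripleBlock] at hp hq hp' hq'
  obtain ⟨u, hu1, hu2⟩ := hp
  obtain ⟨v, hv1, hv2⟩ := hq
  obtain ⟨u', hu1', hu2'⟩ := hp'
  obtain ⟨v', hv1', hv2'⟩ := hq'
  have huv : u ≠ v := by
    rintro rfl
    exact hpq (hu1.symm.trans hv1)
  have hunit := ZMod.isUnit_fin_three_sub ht huv
  rcases transitiveTriple_unique c c' u v u' v' huv (hu1.trans hu1'.symm)
    (hv1.trans hv1'.symm) with ⟨rfl, rfl, rfl⟩ | h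
  · obtain rfl : x = x' := hunit.mul_left_cancel (by linear_combination hv2 - hu2 - hv2' + hu2')
    obtain rfl : s = s' := by linear_combination hu2 - hu2'
    rfl
  · have h' : (u.val : ZMod t) + u'.val = v.val + v'.val := by exact_mod_cast congrArg _ h
    have : x' = -x := hunit.mul_left_cancel (by
      linear_combination hu2' - hv2' + hv2 - hu2 - x' * h')
    exact absurd (this ▸ hx') (hP x hx)

theorem exists_tripleBlock {t : ℕ} (ht : Odd t) {P : ZMod t → Prop}
    (hP : ∀ x, x ≠ 0 → P x ∨ P (-x)) {p q : Fin 8 × ZMod t} (h₁ : p.1 ≠ q.1) (h₂ : p.2 ≠ q.2)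
    (h : ¬((p.1 = 6 ∨ p.1 = 7) ∧ (q.1 = 6 ∨ q.1 = 7))) :
    ∃ c x s, P x ∧ p ∈ tripleBlock c x s ∧ q ∈ tripleBlock c x s := by
  obtain ⟨u, v, huv, ⟨c, hcu, hcv⟩, u', v', he, c', hcu', hcv'⟩ :=
    exists_transitiveTriple p.1 q.1 h₁ h
  obtain ⟨y, hy⟩ := (ZMod.isUnit_fin_three_sub ht huv).dvd (a := q.2 - p.2)
  have hy0 : y ≠ 0 := by
    rintro rfl
    exact h₂ (by linear_combination -hy)
  simp only [mem_tripleBlock]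
  rcases hP y hy0 with hy' | hy'
  · exact ⟨c, y, p.2 - u.val * y, hy', ⟨u, hcu, by ring⟩, v, hcv, by linear_combination -hy⟩
  · have he' : (u.val : ZMod t) + u'.val = v.val + v'.val := by exact_mod_cast congrArg _ he
    exact ⟨c', -y, p.2 - u'.val * -y, hy', ⟨u', hcu', by ring⟩, v', hcv',
      by linear_combination -hy + y * he'⟩


/-- For every odd integer t ≥ 3 there exists a 3-SCIHGDD of type
(8,2,1^t). -/
theorem exists_scihgdd_odd (t : ℕ) (ht : Odd t) (ht3 : 3 ≤ t) :
    ∃ (a b : Fin 8) (ℬ : Finset (Finset (Fin 8 × ZMod t))),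
      a ≠ b ∧ IsSCIHGDD t a b ℬ := by
  classical
  have : NeZero t := ⟨by omega⟩
  obtain ⟨P, hP, hP'⟩ := ZMod.exists_half_system ht
  have mem_iff (B : Finset (Fin 8 × ZMod t)) :
      B ∈ Finset.univ.filter (fun B => ∃ c x s, P x ∧ B = tripleBlock c x s) ↔
        ∃ c x s, P x ∧ B = tripleBlock c x s := by simp
  refine ⟨6, 7, Finset.univ.filter fun B => ∃ c x s, P x ∧ B = tripleBlock c x s,
    by decide, ?_, ?_, ?_, ?_⟩
  · intro B hB
    obtain ⟨c, x, s, -, rfl⟩ := (mem_iff B).1 hB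
    exact card_tripleBlock c x s
  · intro B hB p hp q hq hpq
    obtain ⟨c, x, s, hx, rfl⟩ := (mem_iff B).1 hB
    obtain ⟨u, hu1, hu2⟩ := mem_tripleBlock.1 hp
    obtain ⟨v, hv1, hv2⟩ := mem_tripleBlock.1 hq
    have huv : u ≠ v := by
      rintro rfl
      exact hpq (Prod.ext (hu1.symm.trans hv1) (hu2.symm.trans hv2))
    refine ⟨?_, ?_, ?_⟩
    · rw [← hu1, ← hv1]
      exact (transitiveTriple_injective c).ne huv
    · intro h
      have hx0 : x = 0 := (ZMod.isUnit_fin_three_sub ht huv).mul_left_cancel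
        (by linear_combination hv2 - hu2 - h)
      subst hx0
      exact hP' 0 hx (by simpa using hx)
    · rw [← hu1, ← hv1]
      exact transitiveTriple_not_both c u v huv
  · intro p q h₁ h₂ h
    obtain ⟨c, x, s, hx, hp, hq⟩ := exists_tripleBlock ht hP h₁ h₂ h
    refine ⟨tripleBlock c x s, ⟨(mem_iff _).2 ⟨c, x, s, hx, rfl⟩, hp, hq⟩, ?_⟩
    rintro B ⟨hB, hpB, hqB⟩
    obtain ⟨c', x', s', hx', rfl⟩ := (mem_iff B).1 hB
    exact tripleBlock_unique ht hP' hx' hx h₁ hpB hqB hp hq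
  · intro B hB
    obtain ⟨c, x, s, hx, rfl⟩ := (mem_iff B).1 hB
    exact (mem_iff _).2 ⟨c, x, s + 1, hx, image_add_one_tripleBlock c x s⟩
end
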